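/- There exists an absolute constant α > 1/2 such that for every prime p and every power q of p, for all x sufficiently large depending only on p, one has (1/x)·Σ_{d ≤ x, d ∈ U_p} φ(d)/ℓ_q(d) ≥ x^α. (Every d ∈ U_p is coprime to p and hence to q, so ℓ_q(d) is defined.) -/

import Mathlib

open scoped Classical

/-- The additive phase `e(x) = exp (2 * π * i * x)`. -/
noncomputable def addPhase (x : ℝ) : ℂ := Complex.exp ((2 * Real.pi * x : ℝ) * Complex.I)

lemma addPhase_add (x y : ℝ) : addPhase (x + y) = addPhase x * addPhase y := by
  rw [addPhase, addPhase, addPhase, ← Complex.exp_add]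
  congr 1; push_cast; ring

lemma norm_addPhase (x : ℝ) : ‖addPhase x‖ = 1 := Complex.norm_exp_ofReal_mul_I _

lemma conj_addPhase (x : ℝ) : (starRingEnd ℂ) (addPhase x) = addPhase (-x) := by
  rw [addPhase, addPhase, ← Complex.exp_conj, map_mul, Complex.conj_ofReal, Complex.conj_I]
  congr 1; push_cast; ring

lemma addPhase_nat_mul (n : ℕ) (x : ℝ) : addPhase (n * x) = addPhase x ^ n := by
  rw [addPhase, addPhase, ← Complex.exp_nat_mul]
  congr 1; push_cast; ring

lemma norm_addPhase_sub_one (x : ℝ) : ‖addPhase x - 1‖ = 2 * |Real.sin (Real.pi * x)| := by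
  have := Complex.norm_exp_I_mul_ofReal_sub_one (2 * Real.pi * x)
  rw [addPhase, mul_comm, this, norm_mul, Real.norm_eq_abs, Real.norm_eq_abs]
  rw [show 2 * Real.pi * x / 2 = Real.pi * x by ring]; norm_num

lemma two_mul_min_fract_le_abs_sin (x : ℝ) :
    2 * min (Int.fract x) (1 - Int.fract x) ≤ |Real.sin (Real.pi * x)| := by
  have key : ∀ f : ℝ, 0 ≤ f → f ≤ 1 / 2 → 2 * f ≤ Real.sin (Real.pi * f) := fun f h0 h1 => by
    have := Real.mul_le_sin (x := Real.pi * f) (by positivity) (by nlinarith [Real.pi_pos])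
    calc 2 * f = 2 / Real.pi * (Real.pi * f) := by field_simp
      _ ≤ _ := this
  have hs : |Real.sin (Real.pi * x)| = |Real.sin (Real.pi * Int.fract x)| := by
    conv_lhs => rw [← Int.floor_add_fract x, mul_add, mul_comm Real.pi (⌊x⌋ : ℝ),
      add_comm, Real.sin_add_int_mul_pi, abs_mul]
    simp
  rw [hs]
  have h0 := Int.fract_nonneg x
  have h1 := (Int.fract_lt_one x).le
  rcases le_total (Int.fract x) (1 / 2) with h | h
  · exact (mul_le_mul_of_nonneg_left (min_le_left _ _) zero_le_two).trans
      ((key _ h0 h).trans (le_abs_self _))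
  · refine (mul_le_mul_of_nonneg_left (min_le_right _ _) zero_le_two).trans
      ((key _ (by linarith) (by linarith)).trans ?_)
    rw [show Real.pi * (1 - Int.fract x) = Real.pi - Real.pi * Int.fract x by ring,
      Real.sin_pi_sub]
    exact le_abs_self _

/-- A summable majorant for `min 1 (1 / (4 * j ^ 2))`. -/
noncomputable def decayWeight (j : ℕ) : ℝ := 2 / ((j + 1) * (j + 2))

lemma decayWeight_pos (j : ℕ) : 0 < decayWeight j := by unfold decayWeight; positivity

lemma sum_decayWeight_le (s : Finset ℕ) : ∑ j ∈ s, decayWeight j ≤ 2 := by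
  obtain ⟨n, hn⟩ := s.exists_nat_subset_range
  have : ∀ n : ℕ, ∑ j ∈ Finset.range n, decayWeight j = 2 - 2 / (n + 1) := by
    intro n
    induction n with
    | zero => simp
    | succ k ih => rw [Finset.sum_range_succ, ih, decayWeight]; push_cast; field_simp; ring
  refine (Finset.sum_le_sum_of_subset_of_nonneg hn
    (fun j _ _ => (decayWeight_pos j).le)).trans ?_
  rw [this]
  have : (0 : ℝ) ≤ 2 / (n + 1) := by positivity
  linarith

lemma norm_geom_sum_addPhase_sq_le {K : ℕ} {δ : ℝ} (hδ : 0 < δ) (hK : 1 ≤ K * δ) (β : ℝ) :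
    ‖∑ i ∈ Finset.range K, addPhase (i * β)‖ ^ 2 ≤
      (K : ℝ) ^ 2 * (decayWeight ⌊Int.fract β / δ⌋₊ + decayWeight ⌊(1 - Int.fract β) / δ⌋₊) := by
  set f := Int.fract β with hf
  have hf0 : 0 ≤ f := Int.fract_nonneg β
  have hf1 : 0 < 1 - f := by have := Int.fract_lt_one β; linarith
  have triv : ‖∑ i ∈ Finset.range K, addPhase (i * β)‖ ^ 2 ≤ (K : ℝ) ^ 2 := by
    gcongr
    refine (norm_sum_le _ _).trans ?_
    simp [norm_addPhase]
  have w0 : decayWeight 0 = 1 := by norm_num [decayWeight]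
  have hKp : (0 : ℝ) < K := by
    by_contra h
    nlinarith
  rcases Nat.eq_zero_or_pos ⌊f / δ⌋₊ with h1 | h1
  · rw [h1, w0]; nlinarith [decayWeight_pos ⌊(1 - f) / δ⌋₊, sq_nonneg (K : ℝ)]
  rcases Nat.eq_zero_or_pos ⌊(1 - f) / δ⌋₊ with h2 | h2
  · rw [h2, w0]; nlinarith [decayWeight_pos ⌊f / δ⌋₊, sq_nonneg (K : ℝ)]
  have aux : ∀ g : ℝ, 0 ≤ g → 0 < ⌊g / δ⌋₊ →
      0 < g ∧ 1 / (4 * g ^ 2) ≤ (K : ℝ) ^ 2 * decayWeight ⌊g / δ⌋₊ := by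
    intro g hg0 hj
    set j := ⌊g / δ⌋₊
    have hj1 : (1 : ℝ) ≤ j := by exact_mod_cast hj
    have hjg : j * δ ≤ g := by
      have := Nat.floor_le (show 0 ≤ g / δ by positivity)
      rwa [le_div_iff₀ hδ] at this
    have hg : 0 < g := lt_of_lt_of_le (by positivity) hjg
    refine ⟨hg, ?_⟩
    have h3 : (j : ℝ) ≤ K * g := by nlinarith
    have h4 : (j : ℝ) ^ 2 ≤ K ^ 2 * g ^ 2 := by
      rw [← mul_pow]; gcongr
    rw [decayWeight, ← mul_div_assoc, div_le_div_iff₀ (by positivity) (by positivity)]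
    nlinarith [sq_nonneg ((j : ℝ) - 1)]
  obtain ⟨g1, a1⟩ := aux f hf0 h1
  obtain ⟨g2, a2⟩ := aux (1 - f) hf1.le h2
  have hsin := two_mul_min_fract_le_abs_sin β
  rw [← hf] at hsin
  have hmin : 0 < min f (1 - f) := lt_min g1 g2
  have hne : addPhase β ≠ 1 := by
    intro h
    have := norm_addPhase_sub_one β
    rw [h] at this
    simp only [sub_self, norm_zero] at this
    linarith
  have hE : ‖∑ i ∈ Finset.range K, addPhase (i * β)‖ ≤ 1 / (2 * min f (1 - f)) := by
    simp_rw [addPhase_nat_mul]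
    rw [geom_sum_eq hne, norm_div, norm_addPhase_sub_one]
    have : ‖addPhase β ^ K - 1‖ ≤ 2 := by
      refine (norm_sub_le _ _).trans ?_
      rw [norm_pow, norm_addPhase]; norm_num
    rw [div_le_div_iff₀ (by linarith) (by positivity)]
    nlinarith [abs_nonneg (Real.sin (Real.pi * β))]
  have hE2 : ‖∑ i ∈ Finset.range K, addPhase (i * β)‖ ^ 2 ≤ 1 / (4 * (min f (1 - f)) ^ 2) := by
    calc _ ≤ (1 / (2 * min f (1 - f))) ^ 2 := by gcongr
      _ = _ := by rw [div_pow, mul_pow]; norm_num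
  have p1 := mul_pos (pow_pos hKp 2) (decayWeight_pos ⌊f / δ⌋₊)
  have p2 := mul_pos (pow_pos hKp 2) (decayWeight_pos ⌊(1 - f) / δ⌋₊)
  rcases min_choice f (1 - f) with h | h <;> rw [h] at hE2 <;> nlinarith

lemma sum_decayWeight_floor_le {ι : Type*} (R : Finset ι) (g : ι → ℝ) {δ : ℝ} (hδ : 0 < δ)
    (h0 : ∀ s ∈ R, 0 ≤ g s) (hsep : ∀ s ∈ R, ∀ t ∈ R, s ≠ t → δ ≤ |g s - g t|) :
    ∑ s ∈ R, decayWeight ⌊g s / δ⌋₊ ≤ 2 := by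
  have inj : Set.InjOn (fun s => ⌊g s / δ⌋₊) (R : Set ι) := by
    intro s hs t ht hst
    by_contra hne
    have h1 := hsep s hs t ht hne
    have a1 := Nat.floor_le (show 0 ≤ g s / δ from div_nonneg (h0 s hs) hδ.le)
    have a2 := Nat.lt_floor_add_one (g s / δ)
    have b1 := Nat.floor_le (show 0 ≤ g t / δ from div_nonneg (h0 t ht) hδ.le)
    have b2 := Nat.lt_floor_add_one (g t / δ)
    simp only at hst
    rw [hst] at a1 a2
    have : |g s / δ - g t / δ| < 1 := by rw [abs_lt]; constructor <;> linarith
    rw [← sub_div, abs_div, abs_of_pos hδ, div_lt_one hδ] at this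
    linarith
  rw [← Finset.sum_image (f := decayWeight) (g := fun s => ⌊g s / δ⌋₊) inj]
  exact sum_decayWeight_le _

/-- The dual large sieve inequality for well-spaced points. -/
lemma dual_large_sieve {ι : Type*} (R : Finset ι) (α : ι → ℝ) (c : ι → ℂ) {δ : ℝ} (hδ : 0 < δ)
    (hsep : ∀ r ∈ R, ∀ s ∈ R, r ≠ s → ∀ k : ℤ, δ ≤ |α r - α s - k|) {N M : ℕ} (hNM : N ≤ M)
    (hM : 1 ≤ M * δ) :
    ∑ n ∈ Finset.range N, ‖∑ r ∈ R, c r * addPhase (n * α r)‖ ^ 2 ≤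
      16 * M * ∑ r ∈ R, ‖c r‖ ^ 2 := by
  set K := N + M with hK
  have hKδ : 1 ≤ (K : ℝ) * δ := by
    rw [hK]; push_cast; nlinarith [mul_nonneg (Nat.cast_nonneg (α := ℝ) N) hδ.le]
  set E : ℝ → ℂ := fun β => ∑ i ∈ Finset.range K, addPhase (i * β) with hE
  set F : ℤ → ℂ := fun n => ∑ r ∈ R, c r * addPhase (n * α r) with hF
  have hMpos : (0 : ℝ) < M := by
    by_contra h
    nlinarith
  have row : ∀ r ∈ R, ∑ s ∈ R, ‖E (α s - α r)‖ ^ 2 ≤ 4 * (K : ℝ) ^ 2 := by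
    intro r _
    have fsep : ∀ s ∈ R, ∀ t ∈ R, s ≠ t →
        δ ≤ |Int.fract (α s - α r) - Int.fract (α t - α r)| := by
      intro s hs t ht hst
      have := hsep s hs t ht hst (⌊α s - α r⌋ - ⌊α t - α r⌋)
      rw [Int.fract, Int.fract]
      push_cast at this
      convert this using 2
      ring
    calc ∑ s ∈ R, ‖E (α s - α r)‖ ^ 2
        ≤ ∑ s ∈ R, (K : ℝ) ^ 2 * (decayWeight ⌊Int.fract (α s - α r) / δ⌋₊
            + decayWeight ⌊(1 - Int.fract (α s - α r)) / δ⌋₊) :=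
          Finset.sum_le_sum fun s _ => norm_geom_sum_addPhase_sq_le hδ hKδ _
      _ = (K : ℝ) ^ 2 * (∑ s ∈ R, decayWeight ⌊Int.fract (α s - α r) / δ⌋₊
            + ∑ s ∈ R, decayWeight ⌊(1 - Int.fract (α s - α r)) / δ⌋₊) := by
          rw [← Finset.mul_sum, Finset.sum_add_distrib]
      _ ≤ (K : ℝ) ^ 2 * (2 + 2) := by
          gcongr
          · exact sum_decayWeight_floor_le R (fun s => Int.fract (α s - α r)) hδ
              (fun s _ => Int.fract_nonneg _) fsep
          · refine sum_decayWeight_floor_le R (fun s => 1 - Int.fract (α s - α r)) hδ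
              (fun s _ => by have := Int.fract_lt_one (α s - α r); linarith) ?_
            intro s hs t ht hst
            rw [show (1 - Int.fract (α s - α r)) - (1 - Int.fract (α t - α r))
              = -(Int.fract (α s - α r) - Int.fract (α t - α r)) by ring, abs_neg]
            exact fsep s hs t ht hst
      _ = _ := by ring
  have expand : ((∑ i ∈ Finset.range K, ∑ j ∈ Finset.range K, ‖F ((i : ℤ) - j)‖ ^ 2 : ℝ) : ℂ)
      = ∑ r ∈ R, ∑ s ∈ R, (starRingEnd ℂ) (c r) * c s *
          (E (α s - α r) * (starRingEnd ℂ) (E (α s - α r))) := by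
    have h1 : ∀ i j : ℕ, ((‖F ((i : ℤ) - j)‖ ^ 2 : ℝ) : ℂ) =
        ∑ r ∈ R, ∑ s ∈ R, (starRingEnd ℂ) (c r) * c s *
          (addPhase (i * (α s - α r)) * (starRingEnd ℂ) (addPhase (j * (α s - α r)))) := by
      intro i j
      push_cast
      rw [← Complex.conj_mul', hF]
      simp only [map_sum, Finset.sum_mul_sum, map_mul]
      refine Finset.sum_congr rfl fun r _ => Finset.sum_congr rfl fun s _ => ?_
      rw [conj_addPhase, conj_addPhase, mul_mul_mul_comm, ← addPhase_add, ← addPhase_add]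
      congr 2; push_cast; ring
    push_cast at h1 ⊢
    simp_rw [h1]
    rw [Finset.sum_congr rfl fun i _ => Finset.sum_comm, Finset.sum_comm]
    refine Finset.sum_congr rfl fun r _ => ?_
    rw [Finset.sum_congr rfl fun i _ => Finset.sum_comm, Finset.sum_comm]
    refine Finset.sum_congr rfl fun s _ => ?_
    rw [hE]
    simp only [map_sum]
    rw [Finset.sum_mul_sum]
    simp only [Finset.mul_sum]
  have upper : ∑ i ∈ Finset.range K, ∑ j ∈ Finset.range K, ‖F ((i : ℤ) - j)‖ ^ 2 ≤
      4 * (K : ℝ) ^ 2 * ∑ r ∈ R, ‖c r‖ ^ 2 := by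
    have h0 : (0 : ℝ) ≤ ∑ i ∈ Finset.range K, ∑ j ∈ Finset.range K, ‖F ((i : ℤ) - j)‖ ^ 2 := by
      positivity
    rw [← abs_of_nonneg h0, ← Real.norm_eq_abs, ← Complex.norm_real, expand]
    have sy : ∀ r s, ‖E (α s - α r)‖ = ‖E (α r - α s)‖ := by
      intro r s
      rw [← RCLike.norm_conj (E (α s - α r)), hE]
      simp only [map_sum, conj_addPhase]
      congr 2; ext i; congr 1; ring
    calc _ ≤ ∑ r ∈ R, ∑ s ∈ R, (‖c r‖ ^ 2 / 2 * ‖E (α s - α r)‖ ^ 2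
            + ‖c s‖ ^ 2 / 2 * ‖E (α s - α r)‖ ^ 2) := by
          refine (norm_sum_le _ _).trans (Finset.sum_le_sum fun r _ =>
            (norm_sum_le _ _).trans (Finset.sum_le_sum fun s _ => ?_))
          rw [norm_mul, norm_mul, norm_mul, RCLike.norm_conj, RCLike.norm_conj, ← sq, ← add_mul]
          gcongr
          nlinarith [sq_nonneg (‖c r‖ - ‖c s‖)]
      _ = ∑ r ∈ R, ‖c r‖ ^ 2 / 2 * ∑ s ∈ R, ‖E (α s - α r)‖ ^ 2
          + ∑ s ∈ R, ‖c s‖ ^ 2 / 2 * ∑ r ∈ R, ‖E (α r - α s)‖ ^ 2 := by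
          simp_rw [Finset.sum_add_distrib, Finset.mul_sum]
          congr 1
          rw [Finset.sum_comm]
          exact Finset.sum_congr rfl fun s _ => Finset.sum_congr rfl fun r _ => by rw [sy]
      _ ≤ ∑ r ∈ R, ‖c r‖ ^ 2 / 2 * (4 * (K : ℝ) ^ 2)
          + ∑ s ∈ R, ‖c s‖ ^ 2 / 2 * (4 * (K : ℝ) ^ 2) := by
          gcongr with r hr s hs
          · exact row r hr
          · exact row s hs
      _ = _ := by rw [← Finset.sum_mul, ← Finset.sum_div]; ring
  have lower : (M : ℝ) * ∑ n ∈ Finset.range N, ‖F n‖ ^ 2 ≤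
      ∑ i ∈ Finset.range K, ∑ j ∈ Finset.range K, ‖F ((i : ℤ) - j)‖ ^ 2 := by
    have h1 : ∀ j ∈ Finset.range M, ∑ n ∈ Finset.range N, ‖F n‖ ^ 2 ≤
        ∑ i ∈ Finset.range K, ‖F ((i : ℤ) - j)‖ ^ 2 := by
      intro j hj
      have hj := Finset.mem_range.1 hj
      have h2 : ∑ n ∈ Finset.range N, ‖F n‖ ^ 2
          = ∑ i ∈ (Finset.range N).map (addRightEmbedding j), ‖F ((i : ℤ) - j)‖ ^ 2 := by
        rw [Finset.sum_map]
        simp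
      rw [h2]
      refine Finset.sum_le_sum_of_subset_of_nonneg ?_ (fun _ _ _ => by positivity)
      intro i hi
      simp only [Finset.mem_map, Finset.mem_range, addRightEmbedding_apply] at hi ⊢
      omega
    rw [Finset.sum_comm]
    calc (M : ℝ) * ∑ n ∈ Finset.range N, ‖F n‖ ^ 2
        = ∑ j ∈ Finset.range M, ∑ n ∈ Finset.range N, ‖F n‖ ^ 2 := by simp
      _ ≤ ∑ j ∈ Finset.range M, ∑ i ∈ Finset.range K, ‖F ((i : ℤ) - j)‖ ^ 2 :=
          Finset.sum_le_sum h1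
      _ ≤ _ := Finset.sum_le_sum_of_subset_of_nonneg
          (Finset.range_subset_range.2 (by omega)) (fun _ _ _ => by positivity)
  have hKM : (K : ℝ) ≤ 2 * M := by rw [hK]; push_cast; have : (N : ℝ) ≤ M := by exact_mod_cast hNM
                                   linarith
  have hc : 0 ≤ ∑ r ∈ R, ‖c r‖ ^ 2 := by positivity
  have fin : (M : ℝ) * ∑ n ∈ Finset.range N, ‖F n‖ ^ 2 ≤ M * (16 * M * ∑ r ∈ R, ‖c r‖ ^ 2) := by
    refine (lower.trans upper).trans ?_
    have : (K : ℝ) ^ 2 ≤ (2 * M) ^ 2 := by gcongr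
    nlinarith
  have := le_of_mul_le_mul_left fin hMpos
  simpa [hF] using this

/-- The large sieve inequality for well-spaced points. -/
lemma large_sieve {ι : Type*} (R : Finset ι) (α : ι → ℝ) {δ : ℝ} (hδ : 0 < δ)
    (hsep : ∀ r ∈ R, ∀ s ∈ R, r ≠ s → ∀ k : ℤ, δ ≤ |α r - α s - k|) {N M : ℕ} (hNM : N ≤ M)
    (hM : 1 ≤ M * δ) {S : Finset ℕ} (hS : S ⊆ Finset.range N) (a : ℕ → ℝ) :
    ∑ r ∈ R, ‖∑ n ∈ S, (a n : ℂ) * addPhase (n * α r)‖ ^ 2 ≤ 16 * M * ∑ n ∈ S, a n ^ 2 := by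
  set T : ι → ℂ := fun r => ∑ n ∈ S, (a n : ℂ) * addPhase (n * α r) with hT
  set V := ∑ r ∈ R, ‖T r‖ ^ 2 with hV
  have hV0 : 0 ≤ V := by positivity
  have h1 : V ≤ ∑ n ∈ S, |a n| * ‖∑ r ∈ R, (starRingEnd ℂ) (T r) * addPhase (n * α r)‖ := by
    have e1 : (V : ℂ) = ∑ n ∈ S, (a n : ℂ) *
        ∑ r ∈ R, (starRingEnd ℂ) (T r) * addPhase (n * α r) := by
      rw [hV]; push_cast
      simp_rw [Finset.mul_sum]
      rw [Finset.sum_comm]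
      refine Finset.sum_congr rfl fun r _ => ?_
      rw [← Complex.conj_mul']
      conv_lhs => rw [hT]
      simp only [Finset.mul_sum]
      exact Finset.sum_congr rfl fun n _ => by ring
    rw [← abs_of_nonneg hV0, ← Real.norm_eq_abs, ← Complex.norm_real, e1]
    refine (norm_sum_le _ _).trans (le_of_eq (Finset.sum_congr rfl fun n _ => ?_))
    rw [norm_mul, Complex.norm_real, Real.norm_eq_abs]
  have h2 := Finset.sum_mul_sq_le_sq_mul_sq S (fun n => |a n|)
    (fun n => ‖∑ r ∈ R, (starRingEnd ℂ) (T r) * addPhase (n * α r)‖)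
  have h3 : ∑ n ∈ S, ‖∑ r ∈ R, (starRingEnd ℂ) (T r) * addPhase (n * α r)‖ ^ 2 ≤ 16 * M * V := by
    refine (Finset.sum_le_sum_of_subset_of_nonneg hS (fun _ _ _ => by positivity)).trans ?_
    refine (dual_large_sieve R α (fun r => (starRingEnd ℂ) (T r)) hδ hsep hNM hM).trans
      (le_of_eq ?_)
    simp [hV]
  simp only [sq_abs] at h2
  have ha : 0 ≤ ∑ n ∈ S, a n ^ 2 := by positivity
  have h4 : V ^ 2 ≤ (16 * M * ∑ n ∈ S, a n ^ 2) * V := by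
    calc V ^ 2 ≤ _ := pow_le_pow_left₀ hV0 h1 2
      _ ≤ _ := h2
      _ ≤ (∑ n ∈ S, a n ^ 2) * (16 * M * V) := by gcongr
      _ = _ := by ring
  rcases hV0.eq_or_lt with h | h
  · rw [← h]; positivity
  · rw [sq] at h4
    exact le_of_mul_le_mul_right h4 h

lemma addPhase_int (k : ℤ) : addPhase k = 1 := by
  rw [addPhase, Complex.exp_eq_one_iff]
  exact ⟨k, by push_cast; ring⟩

lemma sum_addPhase_range {ℓ : ℕ} (hℓ : 0 < ℓ) (k : ℤ) :
    ∑ t ∈ Finset.range ℓ, addPhase (t * (k / ℓ)) = if (ℓ : ℤ) ∣ k then (ℓ : ℂ) else 0 := by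
  have hℓ' : (ℓ : ℝ) ≠ 0 := by positivity
  split_ifs with h
  · obtain ⟨m, rfl⟩ := h
    rw [Finset.sum_congr rfl (g := fun _ => (1 : ℂ))]
    · simp
    · intro t _
      rw [← addPhase_int (t * m)]
      congr 1; push_cast; field_simp
  · simp_rw [addPhase_nat_mul]
    have hne : addPhase (k / ℓ) ≠ 1 := by
      intro h1
      have h2 := norm_addPhase_sub_one (k / ℓ)
      rw [h1, sub_self, norm_zero, eq_comm, mul_eq_zero, abs_eq_zero, Real.sin_eq_zero_iff] at h2
      rcases h2 with h2 | ⟨n, hn⟩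
      · norm_num at h2
      · apply h
        refine ⟨n, ?_⟩
        have hpi := Real.pi_ne_zero
        have : (n : ℝ) = k / ℓ := by
          apply mul_right_cancel₀ hpi; rw [hn]; ring
        rw [eq_div_iff hℓ'] at this
        have : ((n * ℓ : ℤ) : ℝ) = (k : ℤ) := by push_cast; exact this
        have := Int.cast_injective this
        rw [← this]; ring
    rw [geom_sum_eq hne, ← addPhase_nat_mul, show (ℓ : ℝ) * (k / ℓ) = (k : ℤ) by field_simp,
      addPhase_int]
    simp

/-- The sum of `a` over the elements of `S` in the residue class `h` mod `ℓ`. -/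
noncomputable def classSum (ℓ : ℕ) (S : Finset ℕ) (a : ℕ → ℝ) (h : ZMod ℓ) : ℝ :=
  ∑ n ∈ S.filter (fun n : ℕ => (n : ZMod ℓ) = h), a n

/-- The variance of `a` over all residue classes mod `ℓ`. -/
noncomputable def classVariance (ℓ : ℕ) [NeZero ℓ] (S : Finset ℕ) (a : ℕ → ℝ) : ℝ :=
  ∑ h : ZMod ℓ, (classSum ℓ S a h - (∑ n ∈ S, a n) / ℓ) ^ 2

lemma sum_classSum_mul (ℓ : ℕ) [NeZero ℓ] (S : Finset ℕ) (a : ℕ → ℝ) (w : ZMod ℓ → ℝ) :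
    ∑ h : ZMod ℓ, classSum ℓ S a h * w h = ∑ n ∈ S, a n * w n := by
  unfold classSum
  rw [← Finset.sum_fiberwise S (fun n : ℕ => (n : ZMod ℓ))]
  refine Finset.sum_congr rfl fun h _ => ?_
  rw [Finset.sum_mul]
  exact Finset.sum_congr rfl fun n hn => by rw [(Finset.mem_filter.1 hn).2]

lemma sum_classSum (ℓ : ℕ) [NeZero ℓ] (S : Finset ℕ) (a : ℕ → ℝ) :
    ∑ h : ZMod ℓ, classSum ℓ S a h = ∑ n ∈ S, a n := by
  simpa using sum_classSum_mul ℓ S a (fun _ => 1)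

lemma classVariance_eq (ℓ : ℕ) [NeZero ℓ] (S : Finset ℕ) (a : ℕ → ℝ) :
    classVariance ℓ S a = ∑ h : ZMod ℓ, classSum ℓ S a h ^ 2 - (∑ n ∈ S, a n) ^ 2 / ℓ := by
  have hℓ : (ℓ : ℝ) ≠ 0 := NeZero.ne _
  unfold classVariance
  simp_rw [sub_sq]
  rw [Finset.sum_add_distrib, Finset.sum_sub_distrib, ← Finset.sum_mul, ← Finset.mul_sum,
    sum_classSum]
  simp only [Finset.sum_const, Finset.card_univ, ZMod.card, nsmul_eq_mul]
  field_simp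
  ring

lemma classVariance_eq_exponential_sums (ℓ : ℕ) [NeZero ℓ] (S : Finset ℕ) (a : ℕ → ℝ) :
    (ℓ : ℝ) * classVariance ℓ S a =
      ∑ t ∈ Finset.Ico 1 ℓ, ‖∑ n ∈ S, (a n : ℂ) * addPhase (n * ((t : ℝ) / ℓ))‖ ^ 2 := by
  have hℓ : 0 < ℓ := Nat.pos_of_ne_zero (NeZero.ne _)
  have hℓ' : (ℓ : ℝ) ≠ 0 := NeZero.ne _
  have full : ∑ t ∈ Finset.range ℓ, ‖∑ n ∈ S, (a n : ℂ) * addPhase (n * ((t : ℝ) / ℓ))‖ ^ 2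
      = ℓ * ∑ h : ZMod ℓ, classSum ℓ S a h ^ 2 := by
    have e1 : ∑ h : ZMod ℓ, classSum ℓ S a h ^ 2 =
        ∑ n ∈ S, ∑ m ∈ S, a n * a m * (if (ℓ : ℤ) ∣ (m : ℤ) - n then 1 else 0) := by
      simp_rw [sq]
      rw [sum_classSum_mul]
      refine Finset.sum_congr rfl fun n _ => ?_
      rw [classSum, Finset.sum_filter, Finset.mul_sum]
      refine Finset.sum_congr rfl fun m _ => ?_
      have : (m : ZMod ℓ) = n ↔ (ℓ : ℤ) ∣ (m : ℤ) - n := by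
        rw [← ZMod.intCast_zmod_eq_zero_iff_dvd, eq_comm] 
        push_cast
        rw [sub_eq_zero, eq_comm]
      simp only [this]
      split_ifs <;> simp
    apply Complex.ofReal_injective
    rw [e1]
    push_cast
    have e2 : ∀ t : ℕ, ((‖∑ n ∈ S, (a n : ℂ) * addPhase (n * ((t : ℝ) / ℓ))‖ : ℂ)) ^ 2 =
        ∑ n ∈ S, ∑ m ∈ S, (a n : ℂ) * a m * addPhase (t * (((m : ℤ) - n : ℤ) / ℓ)) := by
      intro t
      rw [← Complex.conj_mul']
      simp only [map_sum, Finset.sum_mul_sum, map_mul, Complex.conj_ofReal, conj_addPhase]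
      refine Finset.sum_congr rfl fun n _ => Finset.sum_congr rfl fun m _ => ?_
      rw [mul_mul_mul_comm, ← addPhase_add]
      congr 2; push_cast; ring
    simp_rw [e2]
    rw [Finset.sum_comm, Finset.mul_sum]
    refine Finset.sum_congr rfl fun n _ => ?_
    rw [Finset.sum_comm, Finset.mul_sum]
    refine Finset.sum_congr rfl fun m _ => ?_
    rw [← Finset.mul_sum, sum_addPhase_range hℓ]
    split_ifs <;> push_cast <;> ring
  rw [Finset.range_eq_Ico, Finset.sum_eq_sum_Ico_succ_bot hℓ] at full
  rw [classVariance_eq, mul_sub, ← full]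
  have : ‖∑ n ∈ S, (a n : ℂ) * addPhase (n * (((0 : ℕ) : ℝ) / ℓ))‖ ^ 2 = (∑ n ∈ S, a n) ^ 2 := by
    have h0 : addPhase 0 = 1 := by simp [addPhase]
    simp only [Nat.cast_zero, zero_div, mul_zero, h0, mul_one]
    rw [← Complex.ofReal_sum, Complex.norm_real, Real.norm_eq_abs, sq_abs]
  rw [this]
  field_simp
  ring

/-- The large sieve for prime moduli in `(D, 4 * D]`. -/
lemma sum_classVariance_le {D : ℕ} (hD : 0 < D) {P : Finset ℕ}
    (hP : ∀ ℓ ∈ P, ℓ.Prime ∧ D < ℓ ∧ ℓ ≤ 4 * D) {N : ℕ} {S : Finset ℕ} (hS : S ⊆ Finset.range N)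
    (a : ℕ → ℝ) (V : ℕ → ℝ)
    (hV : ∀ ℓ ∈ P, ∀ _ : NeZero ℓ, V ℓ = classVariance ℓ S a) :
    ∑ ℓ ∈ P, V ℓ ≤ 256 * ((N : ℝ) / D + D) * ∑ n ∈ S, a n ^ 2 := by
  have hD' : (0 : ℝ) < D := by exact_mod_cast hD
  set R : Finset (Σ _ : ℕ, ℕ) := P.sigma (fun ℓ => Finset.Ico 1 ℓ) with hR
  have hsep : ∀ r ∈ R, ∀ s ∈ R, r ≠ s → ∀ k : ℤ,
      1 / (16 * (D : ℝ) ^ 2) ≤ |(r.2 : ℝ) / r.1 - (s.2 : ℝ) / s.1 - k| := by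
    rintro ⟨l1, t1⟩ hr ⟨l2, t2⟩ hs hne k
    simp only [hR, Finset.mem_sigma, Finset.mem_Ico] at hr hs ⊢
    obtain ⟨p1, d1, u1⟩ := hP l1 hr.1
    obtain ⟨p2, d2, u2⟩ := hP l2 hs.1
    have q1 : (0 : ℝ) < l1 := by exact_mod_cast p1.pos
    have q2 : (0 : ℝ) < l2 := by exact_mod_cast p2.pos
    have nz : (t1 : ℤ) * l2 - t2 * l1 - k * l1 * l2 ≠ 0 := by
      intro h0
      by_cases hl : l1 = l2
      · subst hl
        have hz : (l1 : ℤ) ≠ 0 := by exact_mod_cast p1.ne_zero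
        have h1 : (t1 : ℤ) - t2 = k * l1 := by
          apply mul_right_cancel₀ hz; linarith
        have h2 : ((t1 : ℤ) - t2) = 0 := by
          apply Int.eq_zero_of_abs_lt_dvd (m := (l1 : ℤ)) ⟨k, by linarith⟩
          rw [abs_lt]; constructor <;> omega
        apply hne
        have : t1 = t2 := by omega
        rw [this]
      · have h1 : (l1 : ℤ) ∣ (t1 : ℤ) * l2 := ⟨t2 + k * l2, by linarith⟩
        have h2 : l1 ∣ t1 * l2 := by exact_mod_cast h1
        rcases p1.dvd_mul.1 h2 with h3 | h3
        · have := Nat.le_of_dvd (by omega) h3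
          omega
        · exact hl ((Nat.prime_dvd_prime_iff_eq p1 p2).1 h3)
    have e : (t1 : ℝ) / l1 - (t2 : ℝ) / l2 - k
        = ((t1 : ℤ) * l2 - t2 * l1 - k * l1 * l2 : ℤ) / ((l1 : ℝ) * l2) := by
      push_cast; field_simp
    rw [e, abs_div, abs_of_pos (mul_pos q1 q2)]
    have h1 : (1 : ℝ) ≤ |(((t1 : ℤ) * l2 - t2 * l1 - k * l1 * l2 : ℤ) : ℝ)| := by
      rw [← Int.cast_abs]; exact_mod_cast Int.one_le_abs nz
    have v1 : (l1 : ℝ) ≤ 4 * D := by exact_mod_cast u1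
    have v2 : (l2 : ℝ) ≤ 4 * D := by exact_mod_cast u2
    apply div_le_div₀ (by linarith) h1 (by positivity)
    nlinarith
  have ls := large_sieve R (fun r => (r.2 : ℝ) / r.1) (δ := 1 / (16 * (D : ℝ) ^ 2)) (by positivity)
    hsep (N := N) (M := N + 16 * D ^ 2) (by omega)
    (by push_cast; rw [mul_one_div, le_div_iff₀ (by positivity)]
        linarith [Nat.cast_nonneg (α := ℝ) N])
    hS a
  rw [hR, Finset.sum_sigma] at ls
  have h1 : (D : ℝ) * ∑ ℓ ∈ P, V ℓ ≤
      ∑ ℓ ∈ P, ∑ t ∈ Finset.Ico 1 ℓ, ‖∑ n ∈ S, (a n : ℂ) * addPhase (n * ((t : ℝ) / ℓ))‖ ^ 2 := by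
    rw [Finset.mul_sum]
    refine Finset.sum_le_sum fun ℓ hℓ => ?_
    obtain ⟨p, d, u⟩ := hP ℓ hℓ
    have : NeZero ℓ := ⟨p.ne_zero⟩
    rw [← classVariance_eq_exponential_sums, hV ℓ hℓ inferInstance]
    have : (D : ℝ) ≤ ℓ := by exact_mod_cast d.le
    have h0 : 0 ≤ classVariance ℓ S a := by unfold classVariance; positivity
    gcongr
  have h2 := h1.trans ls
  push_cast at h2
  have h3 : (D : ℝ) * ∑ ℓ ∈ P, V ℓ ≤ D * (256 * ((N : ℝ) / D + D) * ∑ n ∈ S, a n ^ 2) := by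
    refine h2.trans ?_
    have hs : 0 ≤ ∑ n ∈ S, a n ^ 2 := by positivity
    have : (D : ℝ) * (256 * ((N : ℝ) / D + D) * ∑ n ∈ S, a n ^ 2)
      = 256 * (N + (D : ℝ) ^ 2) * ∑ n ∈ S, a n ^ 2 := by field_simp
    rw [this]
    apply mul_le_mul_of_nonneg_right _ hs
    nlinarith [sq_nonneg (D : ℝ), Nat.cast_nonneg (α := ℝ) N]
  exact le_of_mul_le_mul_left h3 hD'

/-- The deviation of the indicator of `n ≡ 1 (mod ℓ)` from its mean over reduced classes. -/
noncomputable def apDisc (ℓ n : ℕ) : ℝ :=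
  (if (n : ZMod ℓ) = 1 then 1 else 0) - (if (n : ZMod ℓ) = 0 then 0 else 1 / ((ℓ : ℝ) - 1))

lemma sq_sum_apDisc_le {ℓ : ℕ} (hℓ : ℓ.Prime) [NeZero ℓ] (S T : Finset ℕ) (a b : ℕ → ℝ) :
    (∑ m ∈ S, ∑ n ∈ T, a m * b n * apDisc ℓ (m * n)) ^ 2 ≤
      classVariance ℓ S a * classVariance ℓ T b := by
  have : Fact ℓ.Prime := ⟨hℓ⟩
  set A := classSum ℓ S a
  set B := classSum ℓ T b
  set E : Finset (ZMod ℓ) := Finset.univ.erase 0 with hE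
  have hcard : (E.card : ℝ) = ℓ - 1 := by
    rw [hE, Finset.card_erase_of_mem (Finset.mem_univ _), Finset.card_univ, ZMod.card,
      Nat.cast_sub hℓ.one_le, Nat.cast_one]
  have hpos : (0 : ℝ) < ℓ - 1 := by
    have : (1 : ℝ) < ℓ := by exact_mod_cast hℓ.one_lt
    linarith
  set a0 := (∑ h ∈ E, A h) / (ℓ - 1) with ha0
  set b0 := (∑ h ∈ E, B h) / (ℓ - 1) with hb0
  have invsum : ∀ f : ZMod ℓ → ℝ, ∑ h ∈ E, f h⁻¹ = ∑ h ∈ E, f h := by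
    intro f
    refine Finset.sum_nbij' (fun h => h⁻¹) (fun h => h⁻¹) ?_ ?_ ?_ ?_ ?_ <;> simp [hE]
  have dec : ∀ (S : Finset ℕ) (a : ℕ → ℝ) (w : ZMod ℓ → ℝ), w 0 = 0 →
      ∑ n ∈ S, a n * w n = ∑ h ∈ E, classSum ℓ S a h * w h := by
    intro S a w hw
    rw [← sum_classSum_mul, hE, ← Finset.add_sum_erase _ _ (Finset.mem_univ (0 : ZMod ℓ)), hw,
      mul_zero, zero_add]
  have key : ∑ m ∈ S, ∑ n ∈ T, a m * b n * apDisc ℓ (m * n) =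
      ∑ h ∈ E, (A h - a0) * (B h⁻¹ - b0) := by
    have e1 : ∑ m ∈ S, ∑ n ∈ T, a m * b n * apDisc ℓ (m * n)
        = ∑ h ∈ E, A h * (B h⁻¹ - b0) := by
      rw [← (dec S a (fun h => if h = 0 then 0 else B h⁻¹ - b0) (by simp)).trans
        (Finset.sum_congr rfl fun h hh => by
          rw [if_neg (Finset.ne_of_mem_erase hh)])]
      refine Finset.sum_congr rfl fun m _ => ?_
      simp_rw [mul_assoc]
      rw [← Finset.mul_sum]
      congr 1
      by_cases hm : (m : ZMod ℓ) = 0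
      · simp [apDisc, hm]
      · rw [if_neg hm]
        have h2 : ∀ n : ℕ, apDisc ℓ (m * n) =
            (fun h : ZMod ℓ => (if h = (m : ZMod ℓ)⁻¹ then 1 else 0)
            - (if h = 0 then 0 else 1 / ((ℓ : ℝ) - 1))) n := by
          intro n
          unfold apDisc
          have i1 : ((m * n : ℕ) : ZMod ℓ) = 1 ↔ (n : ZMod ℓ) = (m : ZMod ℓ)⁻¹ := by
            push_cast
            exact ⟨fun h => eq_inv_of_mul_eq_one_right h, fun h => by rw [h, mul_inv_cancel₀ hm]⟩
          have i2 : ((m * n : ℕ) : ZMod ℓ) = 0 ↔ (n : ZMod ℓ) = 0 := by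
            push_cast; simp [hm]
          simp only [i1, i2]
        rw [Finset.sum_congr rfl (fun n _ => by rw [h2 n])]
        rw [dec T b (fun h : ZMod ℓ => (if h = (m : ZMod ℓ)⁻¹ then 1 else 0)
            - (if h = 0 then 0 else 1 / ((ℓ : ℝ) - 1))) (by simp [eq_comm, hm])]
        have hmE : (m : ZMod ℓ)⁻¹ ∈ E := by simp [hE, hm]
        simp_rw [mul_sub]
        rw [Finset.sum_sub_distrib]
        congr 1
        · rw [Finset.sum_eq_single_of_mem _ hmE]
          · simp [B]
          · intro h _ hne; simp [hne]
        · rw [hb0, Finset.sum_div]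
          refine Finset.sum_congr rfl fun h hh => ?_
          rw [if_neg (Finset.ne_of_mem_erase hh)]; ring
    have e2 : ∑ h ∈ E, a0 * (B h⁻¹ - b0) = 0 := by
      rw [← Finset.mul_sum, Finset.sum_sub_distrib, invsum B]
      simp only [Finset.sum_const, nsmul_eq_mul, hcard, hb0]
      field_simp
      ring
    rw [e1]
    simp_rw [sub_mul]
    rw [Finset.sum_sub_distrib, e2, sub_zero]
  have vle : ∀ (A : ZMod ℓ → ℝ) (c : ℝ),
      ∑ h ∈ E, (A h - (∑ h ∈ E, A h) / (ℓ - 1)) ^ 2 ≤ ∑ h, (A h - c) ^ 2 := by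
    intro A c
    have h1 : ∑ h ∈ E, (A h - c) ^ 2 ≤ ∑ h, (A h - c) ^ 2 :=
      Finset.sum_le_sum_of_subset_of_nonneg (Finset.subset_univ _) (fun _ _ _ => by positivity)
    refine le_trans ?_ h1
    set s := ∑ h ∈ E, A h with hs
    simp_rw [sub_sq]
    rw [Finset.sum_add_distrib, Finset.sum_sub_distrib, Finset.sum_add_distrib,
      Finset.sum_sub_distrib, ← Finset.sum_mul, ← Finset.mul_sum, ← Finset.sum_mul,
      ← Finset.mul_sum, ← hs]
    simp only [Finset.sum_const, nsmul_eq_mul, hcard]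
    have : 0 ≤ (s - c * (ℓ - 1)) ^ 2 / ((ℓ : ℝ) - 1) := by positivity
    have e : (s - c * (ℓ - 1)) ^ 2 / ((ℓ : ℝ) - 1) =
        s ^ 2 / (ℓ - 1) - 2 * s * c + (ℓ - 1) * c ^ 2 := by
      field_simp
      ring
    have e' : 2 * s * (s / ((ℓ : ℝ) - 1)) = 2 * (s ^ 2 / (ℓ - 1)) := by ring
    have e'' : ((ℓ : ℝ) - 1) * (s / (ℓ - 1)) ^ 2 = s ^ 2 / (ℓ - 1) := by field_simp
    rw [e', e'']
    linarith
  rw [key]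
  refine (Finset.sum_mul_sq_le_sq_mul_sq E (fun h => A h - a0) (fun h => B h⁻¹ - b0)).trans ?_
  rw [invsum (fun h => (B h - b0) ^ 2)]
  unfold classVariance
  exact mul_le_mul (vle A _) (vle B _) (by positivity) (by positivity)

/-- The bilinear estimate for the average deviation over prime moduli in `(D, 4 * D]`. -/
lemma abs_bilinear_apDisc_le {D : ℕ} (hD : 0 < D) {P : Finset ℕ}
    (hP : ∀ ℓ ∈ P, ℓ.Prime ∧ D < ℓ ∧ ℓ ≤ 4 * D) {M N : ℕ} {S T : Finset ℕ}
    (hS : S ⊆ Finset.range M) (hT : T ⊆ Finset.range N) (a b : ℕ → ℝ) :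
    |∑ m ∈ S, ∑ n ∈ T, a m * b n * ∑ ℓ ∈ P, apDisc ℓ (m * n)| ≤
      256 * √(((M : ℝ) / D + D) * ((N : ℝ) / D + D)) *
        (√(∑ m ∈ S, a m ^ 2) * √(∑ n ∈ T, b n ^ 2)) := by
  set V : ℕ → ℝ := fun ℓ => if h : ℓ ≠ 0 then have : NeZero ℓ := ⟨h⟩; classVariance ℓ S a else 0
    with hVdef
  set W : ℕ → ℝ := fun ℓ => if h : ℓ ≠ 0 then have : NeZero ℓ := ⟨h⟩; classVariance ℓ T b else 0
    with hWdef
  have hV : ∀ ℓ ∈ P, ∀ _ : NeZero ℓ, V ℓ = classVariance ℓ S a := by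
    intro ℓ _ i; simp [hVdef, i.out]
  have hW : ∀ ℓ ∈ P, ∀ _ : NeZero ℓ, W ℓ = classVariance ℓ T b := by
    intro ℓ _ i; simp [hWdef, i.out]
  have V0 : ∀ ℓ, 0 ≤ V ℓ := by
    intro ℓ; simp only [hVdef]; split_ifs <;> (try unfold classVariance) <;> positivity
  have W0 : ∀ ℓ, 0 ≤ W ℓ := by
    intro ℓ; simp only [hWdef]; split_ifs <;> (try unfold classVariance) <;> positivity
  have s1 := sum_classVariance_le hD hP hS a V hV
  have s2 := sum_classVariance_le hD hP hT b W hW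
  have e : ∑ m ∈ S, ∑ n ∈ T, a m * b n * ∑ ℓ ∈ P, apDisc ℓ (m * n) =
      ∑ ℓ ∈ P, ∑ m ∈ S, ∑ n ∈ T, a m * b n * apDisc ℓ (m * n) := by
    simp_rw [Finset.mul_sum]
    rw [Finset.sum_congr rfl fun m _ => Finset.sum_comm, Finset.sum_comm]
  rw [e]
  have A0 : 0 ≤ ∑ m ∈ S, a m ^ 2 := by positivity
  have B0 : 0 ≤ ∑ m ∈ T, b m ^ 2 := by positivity
  calc |∑ ℓ ∈ P, ∑ m ∈ S, ∑ n ∈ T, a m * b n * apDisc ℓ (m * n)|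
      ≤ ∑ ℓ ∈ P, √(V ℓ) * √(W ℓ) := by
        refine (Finset.abs_sum_le_sum_abs _ _).trans (Finset.sum_le_sum fun ℓ hℓ => ?_)
        have : NeZero ℓ := ⟨(hP ℓ hℓ).1.ne_zero⟩
        rw [← Real.sqrt_mul (V0 ℓ), hV ℓ hℓ inferInstance, hW ℓ hℓ inferInstance]
        exact Real.abs_le_sqrt (sq_sum_apDisc_le (hP ℓ hℓ).1 S T a b)
    _ ≤ √(∑ ℓ ∈ P, V ℓ) * √(∑ ℓ ∈ P, W ℓ) :=
        Real.sum_sqrt_mul_sqrt_le _ V0 W0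
    _ ≤ √(256 * ((M : ℝ) / D + D) * ∑ m ∈ S, a m ^ 2) *
          √(256 * ((N : ℝ) / D + D) * ∑ n ∈ T, b n ^ 2) := by gcongr
    _ = _ := by
        rw [← Real.sqrt_mul (by positivity), ← Real.sqrt_mul A0]
        rw [show (256 : ℝ) = √(256 ^ 2) by rw [Real.sqrt_sq (by norm_num)],
          ← Real.sqrt_mul (by positivity), ← Real.sqrt_mul (by positivity)]
        rw [Real.sqrt_sq (by norm_num)]
        congr 1; ring

lemma sqrt_mul_sqrt_add_le {a b c d : ℝ} (ha : 0 ≤ a) (hb : 0 ≤ b) (hc : 0 ≤ c) (hd : 0 ≤ d) :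
    √a * √b + √c * √d ≤ √(a + c) * √(b + d) := by
  rw [← Real.sqrt_mul (add_nonneg ha hc)]
  apply Real.le_sqrt_of_sq_le
  have h1 := Real.sq_sqrt ha
  have h2 := Real.sq_sqrt hb
  have h3 := Real.sq_sqrt hc
  have h4 := Real.sq_sqrt hd
  nlinarith [sq_nonneg (√a * √d - √b * √c)]

/-- A bound for all rectangles implies a bound for the region under a monotone staircase, at the
cost of a logarithm. -/
lemma abs_staircase_sum_le {F : ℕ → ℕ → ℝ} {A B : ℕ → ℝ} (hA : ∀ n, 0 ≤ A n) (hB : ∀ n, 0 ≤ B n)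
    {K : ℝ} (hK : 0 ≤ K) {M N : ℕ} {f : ℕ → ℕ} (hf : Antitone f)
    (H : ∀ a b c d, b ≤ M → d ≤ N → |∑ m ∈ Finset.Ico a b, ∑ n ∈ Finset.Ioc c d, F m n| ≤
      K * (√(∑ m ∈ Finset.Ico a b, A m) * √(∑ n ∈ Finset.Ioc c d, B n))) (k : ℕ) :
    ∀ a, a + 2 ^ k ≤ M → f a ≤ N →
    |∑ m ∈ Finset.Ico a (a + 2 ^ k), ∑ n ∈ Finset.Ioc (f (a + 2 ^ k)) (f m), F m n| ≤
      (k + 1) * K * (√(∑ m ∈ Finset.Ico a (a + 2 ^ k), A m) *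
        √(∑ n ∈ Finset.Ioc (f (a + 2 ^ k)) (f a), B n)) := by
  induction k with
  | zero =>
    intro a h1 h2
    have := H a (a + 1) (f (a + 1)) (f a) (by simpa using h1) h2
    simpa using this
  | succ k ih =>
    intro a h1 h2
    set b := a + 2 ^ k with hb
    have hc : a + 2 ^ (k + 1) = b + 2 ^ k := by rw [hb, pow_succ]; ring
    rw [hc] at h1 ⊢
    set c := b + 2 ^ k with hcdef
    have hab : a ≤ b := Nat.le_add_right _ _
    have hbc : b ≤ c := Nat.le_add_right _ _
    have i1 := ih a ((Nat.le_add_right b (2 ^ k)).trans h1) h2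
    have i2 := ih b h1 ((hf hab).trans h2)
    rw [← hb] at i1
    rw [← hcdef] at i2
    have r := H a b (f c) (f b) (by omega) ((hf hab).trans h2)
    have split : ∑ m ∈ Finset.Ico a c, ∑ n ∈ Finset.Ioc (f c) (f m), F m n =
        ∑ m ∈ Finset.Ico a b, ∑ n ∈ Finset.Ioc (f c) (f b), F m n +
        (∑ m ∈ Finset.Ico a b, ∑ n ∈ Finset.Ioc (f b) (f m), F m n +
          ∑ m ∈ Finset.Ico b c, ∑ n ∈ Finset.Ioc (f c) (f m), F m n) := by
      rw [← Finset.sum_Ico_consecutive _ hab hbc, ← add_assoc, ← Finset.sum_add_distrib]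
      congr 1
      refine Finset.sum_congr rfl fun m hm => ?_
      rw [Finset.mem_Ico] at hm
      rw [Finset.sum_Ioc_consecutive _ (hf hbc) (hf hm.2.le)]
    have sA : ∑ m ∈ Finset.Ico a c, A m = ∑ m ∈ Finset.Ico a b, A m + ∑ m ∈ Finset.Ico b c, A m :=
      (Finset.sum_Ico_consecutive _ hab hbc).symm
    have sB : ∑ n ∈ Finset.Ioc (f c) (f a), B n =
        ∑ n ∈ Finset.Ioc (f b) (f a), B n + ∑ n ∈ Finset.Ioc (f c) (f b), B n := by
      rw [add_comm]; exact (Finset.sum_Ioc_consecutive _ (hf hbc) (hf hab)).symm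
    rw [split, sA, sB]
    set A1 := ∑ m ∈ Finset.Ico a b, A m
    set A2 := ∑ m ∈ Finset.Ico b c, A m
    set B1 := ∑ n ∈ Finset.Ioc (f b) (f a), B n
    set B2 := ∑ n ∈ Finset.Ioc (f c) (f b), B n
    have A1n : 0 ≤ A1 := Finset.sum_nonneg fun _ _ => hA _
    have A2n : 0 ≤ A2 := Finset.sum_nonneg fun _ _ => hA _
    have B1n : 0 ≤ B1 := Finset.sum_nonneg fun _ _ => hB _
    have B2n : 0 ≤ B2 := Finset.sum_nonneg fun _ _ => hB _
    have cs := sqrt_mul_sqrt_add_le A1n B1n A2n B2n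
    have rr : √A1 * √B2 ≤ √(A1 + A2) * √(B1 + B2) := by
      gcongr <;> linarith
    calc _ ≤ K * (√A1 * √B2) + ((k + 1) * K * (√A1 * √B1) + (k + 1) * K * (√A2 * √B2)) := by
          refine (abs_add_le _ _).trans (add_le_add r ((abs_add_le _ _).trans (add_le_add i1 i2)))
      _ = K * (√A1 * √B2) + (k + 1) * K * (√A1 * √B1 + √A2 * √B2) := by ring
      _ ≤ K * (√(A1 + A2) * √(B1 + B2)) + (k + 1) * K * (√(A1 + A2) * √(B1 + B2)) := by gcongr
      _ = _ := by push_cast; ring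

/-- The bilinear estimate over a dyadic block of the hyperbolic region `m * n ≤ Y`. -/
lemma abs_dyadic_hyperbola_sum_le {D : ℕ} (hD : 0 < D) {P : Finset ℕ}
    (hP : ∀ ℓ ∈ P, ℓ.Prime ∧ D < ℓ ∧ ℓ ≤ 4 * D) (Y k : ℕ) (a b : ℕ → ℝ) :
    |∑ m ∈ Finset.Ico (2 ^ k) (2 ^ (k + 1)), ∑ n ∈ Finset.Ioc 0 (Y / m),
        a m * b n * ∑ ℓ ∈ P, apDisc ℓ (m * n)| ≤
      (k + 2) * (256 * √((2 * (2 : ℝ) ^ k / D + D) * (((Y / 2 ^ k : ℕ) + 1 : ℝ) / D + D))) *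
        (√(∑ m ∈ Finset.Ico (2 ^ k) (2 ^ (k + 1)), a m ^ 2) *
          √(∑ n ∈ Finset.Ioc 0 (Y / 2 ^ k), b n ^ 2)) := by
  set K := 256 * √((2 * (2 : ℝ) ^ k / D + D) * (((Y / 2 ^ k : ℕ) + 1 : ℝ) / D + D)) with hK
  have K0 : 0 ≤ K := by positivity
  have H : ∀ a' b' c d, b' ≤ 2 ^ (k + 1) → d ≤ Y / 2 ^ k →
      |∑ m ∈ Finset.Ico a' b', ∑ n ∈ Finset.Ioc c d, a m * b n * ∑ ℓ ∈ P, apDisc ℓ (m * n)| ≤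
      K * (√(∑ m ∈ Finset.Ico a' b', a m ^ 2) * √(∑ n ∈ Finset.Ioc c d, b n ^ 2)) := by
    intro a' b' c d h1 h2
    have := abs_bilinear_apDisc_le hD hP (M := 2 ^ (k + 1)) (N := Y / 2 ^ k + 1)
      (S := Finset.Ico a' b') (T := Finset.Ioc c d)
      (by intro x hx; simp only [Finset.mem_Ico, Finset.mem_range] at *; omega)
      (by intro x hx; simp only [Finset.mem_Ioc, Finset.mem_range] at *; omega) a b
    rw [hK]
    push_cast at this
    rw [pow_succ, mul_comm _ (2 : ℝ)] at this
    exact this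
  have hf : Antitone (fun m : ℕ => if m = 0 then Y else Y / m) := by
    intro x y hxy
    dsimp only
    split_ifs with h1 h2 h2
    · rfl
    · omega
    · exact Nat.div_le_self _ _
    · exact Nat.div_le_div_left hxy (Nat.pos_of_ne_zero h2)
  have st := abs_staircase_sum_le (fun n => sq_nonneg (a n)) (fun n => sq_nonneg (b n)) K0 hf H k
    (2 ^ k) (by rw [pow_succ]; omega) (by simp)
  have r := H (2 ^ k) (2 ^ (k + 1)) 0 (Y / 2 ^ (k + 1)) le_rfl
    (Nat.div_le_div_left (Nat.pow_le_pow_right (by norm_num) (by omega)) (by positivity))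
  have e2 : 2 ^ k + 2 ^ k = 2 ^ (k + 1) := by rw [pow_succ]; omega
  rw [e2] at st
  have p0 : ∀ j, 2 ^ j ≠ 0 := fun j => by positivity
  simp only [p0, if_false] at st
  have split : ∑ m ∈ Finset.Ico (2 ^ k) (2 ^ (k + 1)), ∑ n ∈ Finset.Ioc 0 (Y / m),
        a m * b n * ∑ ℓ ∈ P, apDisc ℓ (m * n) =
      ∑ m ∈ Finset.Ico (2 ^ k) (2 ^ (k + 1)), ∑ n ∈ Finset.Ioc 0 (Y / 2 ^ (k + 1)),
        a m * b n * ∑ ℓ ∈ P, apDisc ℓ (m * n) +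
      ∑ m ∈ Finset.Ico (2 ^ k) (2 ^ (k + 1)),
        ∑ n ∈ Finset.Ioc (Y / 2 ^ (k + 1)) (if m = 0 then Y else Y / m),
        a m * b n * ∑ ℓ ∈ P, apDisc ℓ (m * n) := by
    rw [← Finset.sum_add_distrib]
    refine Finset.sum_congr rfl fun m hm => ?_
    rw [Finset.mem_Ico] at hm
    have : m ≠ 0 := by have := p0 k; omega
    rw [if_neg this, Finset.sum_Ioc_consecutive _ (Nat.zero_le _)
      (Nat.div_le_div_left hm.2.le (by omega))]
  rw [split]
  have m1 : Y / 2 ^ (k + 1) ≤ Y / 2 ^ k :=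
    Nat.div_le_div_left (Nat.pow_le_pow_right (by norm_num) (by omega)) (by positivity)
  have g1 : √(∑ n ∈ Finset.Ioc 0 (Y / 2 ^ (k + 1)), b n ^ 2) ≤
      √(∑ n ∈ Finset.Ioc 0 (Y / 2 ^ k), b n ^ 2) := by
    apply Real.sqrt_le_sqrt
    exact Finset.sum_le_sum_of_subset_of_nonneg (Finset.Ioc_subset_Ioc_right m1)
      fun _ _ _ => by positivity
  have g2 : √(∑ n ∈ Finset.Ioc (Y / 2 ^ (k + 1)) (Y / 2 ^ k), b n ^ 2) ≤
      √(∑ n ∈ Finset.Ioc 0 (Y / 2 ^ k), b n ^ 2) := by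
    apply Real.sqrt_le_sqrt
    exact Finset.sum_le_sum_of_subset_of_nonneg (Finset.Ioc_subset_Ioc_left (Nat.zero_le _))
      fun _ _ _ => by positivity
  calc _ ≤ K * (√(∑ m ∈ Finset.Ico (2 ^ k) (2 ^ (k + 1)), a m ^ 2) *
          √(∑ n ∈ Finset.Ioc 0 (Y / 2 ^ k), b n ^ 2)) +
        (k + 1) * K * (√(∑ m ∈ Finset.Ico (2 ^ k) (2 ^ (k + 1)), a m ^ 2) *
          √(∑ n ∈ Finset.Ioc 0 (Y / 2 ^ k), b n ^ 2)) := by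
        refine (abs_add_le _ _).trans (add_le_add (r.trans ?_) (st.trans ?_)) <;> gcongr
    _ = _ := by ring

/-- The type II estimate on average over prime moduli in `(D, 4 * D]`. -/
lemma abs_typeII_sum_le {D : ℕ} {P : Finset ℕ}
    (hP : ∀ ℓ ∈ P, ℓ.Prime ∧ D < ℓ ∧ ℓ ≤ 4 * D) {Y U : ℕ} (hU : 0 < U) (hUD : U ≤ D)
    (hDY : D ^ 2 * U ≤ Y) {a b : ℕ → ℝ} {A B : ℝ} (hA : 0 ≤ A) (hB : 0 ≤ B)
    (ha : ∀ m, m ≤ U → a m = 0) (hb : ∀ m, m ≤ U → b m = 0)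
    (ha' : ∀ m, m ≤ 2 * Y → |a m| ≤ A)
    (hb' : ∀ N, N ≤ Y → ∑ n ∈ Finset.Ioc 0 N, b n ^ 2 ≤ N * B ^ 2) :
    |∑ m ∈ Finset.Ioc 0 Y, ∑ n ∈ Finset.Ioc 0 (Y / m), a m * b n * ∑ ℓ ∈ P, apDisc ℓ (m * n)| ≤
      1024 * A * B * ((Nat.log 2 Y + 2 : ℕ) : ℝ) ^ 2 * (Y / √U) := by
  have hD : 0 < D := by omega
  have hY : 0 < Y := lt_of_lt_of_le (by positivity) hDY
  set G : ℕ → ℝ := fun m => ∑ n ∈ Finset.Ioc 0 (Y / m), a m * b n * ∑ ℓ ∈ P, apDisc ℓ (m * n)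
    with hG
  set k0 := Nat.log 2 Y + 1 with hk0
  have lt2 : Y < 2 ^ k0 := Nat.lt_pow_succ_log_self (by norm_num) _
  have blocks : ∀ k, ∑ m ∈ Finset.Ico 1 (2 ^ k), G m =
      ∑ j ∈ Finset.range k, ∑ m ∈ Finset.Ico (2 ^ j) (2 ^ (j + 1)), G m := by
    intro k
    induction k with
    | zero => simp
    | succ k ih =>
      rw [Finset.sum_range_succ, ← ih, Finset.sum_Ico_consecutive _ Nat.one_le_two_pow
        (Nat.pow_le_pow_right (by norm_num) (by omega))]
  have e : ∑ m ∈ Finset.Ioc 0 Y, G m = ∑ m ∈ Finset.Ico 1 (2 ^ k0), G m := by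
    apply Finset.sum_subset
    · intro m hm; simp only [Finset.mem_Ioc, Finset.mem_Ico] at *; omega
    · intro m hm hm'
      simp only [Finset.mem_Ioc, Finset.mem_Ico] at hm hm'
      simp [hG, Nat.div_eq_of_lt (show Y < m by omega)]
  have U0 : (0 : ℝ) < U := by exact_mod_cast hU
  have D0 : (0 : ℝ) < D := by exact_mod_cast hD
  have hUD' : (U : ℝ) ≤ D := by exact_mod_cast hUD
  have hDY' : (D : ℝ) ^ 2 * U ≤ Y := by exact_mod_cast hDY
  have D1 : (1 : ℝ) ≤ D := by exact_mod_cast hD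
  have block : ∀ k ∈ Finset.range k0, |∑ m ∈ Finset.Ico (2 ^ k) (2 ^ (k + 1)), G m| ≤
      (Nat.log 2 Y + 2 : ℕ) * 1024 * A * B * (Y / √U) := by
    intro k hk
    rw [Finset.mem_range] at hk
    have R0 : 0 ≤ ((Nat.log 2 Y + 2 : ℕ) : ℝ) * 1024 * A * B * (Y / √U) := by positivity
    refine (abs_dyadic_hyperbola_sum_le hD hP Y k a b).trans ?_
    have kle : 2 ^ k ≤ Y := by
      calc 2 ^ k ≤ 2 ^ Nat.log 2 Y := Nat.pow_le_pow_right (by norm_num) (by omega)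
        _ ≤ Y := Nat.pow_log_le_self 2 hY.ne'
    by_cases c1 : 2 ^ (k + 1) ≤ U + 1
    · rw [Finset.sum_eq_zero (s := Finset.Ico _ _)]
      · simpa using R0
      · intro m hm; rw [Finset.mem_Ico] at hm; rw [ha m (by omega)]; simp
    by_cases c2 : Y / 2 ^ k ≤ U
    · rw [Finset.sum_eq_zero (s := Finset.Ioc _ _)]
      · simpa using R0
      · intro m hm; rw [Finset.mem_Ioc] at hm; rw [hb m (by omega)]; simp
    set N := Y / 2 ^ k with hN
    have N1 : (1 : ℝ) ≤ N := by exact_mod_cast (show 1 ≤ N by omega)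
    set x : ℝ := 2 ^ k with hx
    have x0 : 0 < x := by positivity
    have NU : (U : ℝ) ≤ N := by exact_mod_cast (show U ≤ N by omega)
    have xU : (U : ℝ) ≤ 2 * x := by
      have : U ≤ 2 * 2 ^ k := by rw [pow_succ] at c1; omega
      rw [hx]; exact_mod_cast this
    have Nx : (N : ℝ) * x ≤ Y := by
      rw [hx, hN]; exact_mod_cast Nat.div_mul_le_self Y (2 ^ k)
    have hAs : ∑ m ∈ Finset.Ico (2 ^ k) (2 ^ (k + 1)), a m ^ 2 ≤ x * A ^ 2 := by
      calc _ ≤ ∑ m ∈ Finset.Ico (2 ^ k) (2 ^ (k + 1)), A ^ 2 := by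
            refine Finset.sum_le_sum fun m hm => ?_
            rw [← sq_abs]
            rw [Finset.mem_Ico, pow_succ] at hm
            have := ha' m (by omega)
            gcongr
        _ = x * A ^ 2 := by
            rw [Finset.sum_const, Nat.card_Ico, pow_succ, nsmul_eq_mul, hx]
            congr 1
            rw [show 2 ^ k * 2 - 2 ^ k = 2 ^ k by omega]; push_cast; rfl
    have hBs := hb' N (Nat.div_le_self _ _)
    have key : √((2 * x / D + D) * ((N + 1 : ℝ) / D + D)) * (√(x * A ^ 2) * √(N * B ^ 2)) ≤
        4 * A * B * (Y / √U) := by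
      rw [← Real.sqrt_mul (by positivity), ← Real.sqrt_mul (by positivity)]
      apply Real.sqrt_le_iff.2
      refine ⟨by positivity, ?_⟩
      have e1 : (4 * A * B * (Y / √U)) ^ 2 = (A * B) ^ 2 * (16 * (Y : ℝ) ^ 2 / U) := by
        rw [mul_pow, div_pow, Real.sq_sqrt U0.le]; ring
      rw [e1, show (2 * x / D + D) * ((N + 1 : ℝ) / D + D) * (x * A ^ 2 * (N * B ^ 2)) =
        (A * B) ^ 2 * ((2 * x / D + D) * ((N + 1 : ℝ) / D + D) * (x * N)) by ring]
      apply mul_le_mul_of_nonneg_left _ (by positivity)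
      calc (2 * x / D + D) * ((N + 1 : ℝ) / D + D) * (x * N)
          ≤ (2 * x / D + D) * ((2 * N : ℝ) / D + D) * (x * N) := by gcongr; linarith
        _ = (4 * (N * x) / (D : ℝ) ^ 2 + 2 * x + 2 * N + D ^ 2) * (N * x) := by
            field_simp; ring
        _ ≤ (16 * Y / U) * Y := by
            have hx' : x ≤ Y / U := by
              rw [le_div_iff₀ U0]; nlinarith
            have hN' : (N : ℝ) ≤ 2 * (Y / U) := by
              rw [← mul_div_assoc, le_div_iff₀ U0]; nlinarith
            have hD2 : (D : ℝ) ^ 2 ≤ Y / U := by rw [le_div_iff₀ U0]; exact hDY'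
            have h4 : 4 * (N * x) / (D : ℝ) ^ 2 ≤ 4 * (Y / U) := by
              rw [← mul_div_assoc]
              apply div_le_div₀ (by positivity) (by linarith) U0
              nlinarith
            have : (4 * (N * x) / (D : ℝ) ^ 2 + 2 * x + 2 * N + D ^ 2) ≤ 16 * Y / U := by
              rw [mul_div_assoc 16]
              have : (0 : ℝ) ≤ Y / U := by positivity
              linarith
            gcongr
        _ = 16 * (Y : ℝ) ^ 2 / U := by ring
    have kk : ((k : ℝ) + 2) ≤ (Nat.log 2 Y + 2 : ℕ) := by
      exact_mod_cast (show k + 2 ≤ Nat.log 2 Y + 2 by omega)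
    calc _ ≤ ((Nat.log 2 Y + 2 : ℕ) : ℝ) * (256 * √((2 * x / D + D) * ((N + 1 : ℝ) / D + D))) *
          (√(x * A ^ 2) * √(N * B ^ 2)) := by gcongr
      _ = ((Nat.log 2 Y + 2 : ℕ) : ℝ) * 256 * (√((2 * x / D + D) * ((N + 1 : ℝ) / D + D)) *
          (√(x * A ^ 2) * √(N * B ^ 2))) := by ring
      _ ≤ ((Nat.log 2 Y + 2 : ℕ) : ℝ) * 256 * (4 * A * B * (Y / √U)) := by gcongr
      _ = _ := by ring
  rw [e, blocks]
  calc _ ≤ ∑ k ∈ Finset.range k0, ((Nat.log 2 Y + 2 : ℕ) : ℝ) * 1024 * A * B * (Y / √U) :=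
        (Finset.abs_sum_le_sum_abs _ _).trans (Finset.sum_le_sum block)
    _ = k0 * (((Nat.log 2 Y + 2 : ℕ) : ℝ) * 1024 * A * B * (Y / √U)) := by
        rw [Finset.sum_const, Finset.card_range, nsmul_eq_mul]
    _ ≤ ((Nat.log 2 Y + 2 : ℕ) : ℝ) * (((Nat.log 2 Y + 2 : ℕ) : ℝ) * 1024 * A * B * (Y / √U)) := by
        gcongr; omega
    _ = _ := by ring

lemma abs_sum_range_periodic_le {W : ℕ → ℝ} {N : ℕ} (hN : 0 < N) (hW : Function.Periodic W N)
    (h0 : ∑ k ∈ Finset.range N, W k = 0) {B : ℝ} (hB : ∑ k ∈ Finset.range N, |W k| ≤ B) (K : ℕ) :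
    |∑ k ∈ Finset.range K, W k| ≤ B := by
  have per : ∀ q s, ∑ k ∈ Finset.range (q * N + s), W k = ∑ k ∈ Finset.range s, W k := by
    intro q
    induction q with
    | zero => intro s; simp
    | succ q ih =>
      intro s
      rw [show (q + 1) * N + s = q * N + (N + s) by ring, ih, Finset.sum_range_add, h0, zero_add]
      exact Finset.sum_congr rfl fun k _ => by rw [add_comm]; exact hW k
  rw [← Nat.div_add_mod' K N, per]
  refine (Finset.abs_sum_le_sum_abs _ _).trans (le_trans ?_ hB)
  exact Finset.sum_le_sum_of_subset_of_nonneg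
    (Finset.range_subset_range.2 (Nat.mod_lt _ hN).le) fun _ _ _ => abs_nonneg _

lemma sum_range_zmod {ℓ : ℕ} [NeZero ℓ] (F : ZMod ℓ → ℝ) :
    ∑ k ∈ Finset.range ℓ, F k = ∑ s : ZMod ℓ, F s := by
  refine Finset.sum_nbij' (fun k => (k : ZMod ℓ)) ZMod.val ?_ ?_ ?_ ?_ ?_
  · intro k _; simp
  · intro s _; simpa using ZMod.val_lt s
  · intro k hk; exact ZMod.val_cast_of_lt (Finset.mem_range.1 hk)
  · intro s _; simp
  · intro k _; rfl

lemma sum_range_mul_zmod {Q ℓ : ℕ} [NeZero ℓ] (hQ : IsUnit (Q : ZMod ℓ)) {g : ℕ → ℝ}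
    (hg : Function.Periodic g Q) (V : ZMod ℓ → ℝ) :
    ∑ k ∈ Finset.range (Q * ℓ), g k * V k = (∑ r ∈ Finset.range Q, g r) * ∑ s : ZMod ℓ, V s := by
  have e : ∀ t, ∑ k ∈ Finset.range (Q * t), g k * V k =
      ∑ j ∈ Finset.range t, ∑ r ∈ Finset.range Q, g r * V ((r : ZMod ℓ) + Q * (j : ZMod ℓ)) := by
    intro t
    induction t with
    | zero => simp
    | succ t ih =>
      rw [mul_add, mul_one, Finset.sum_range_add, ih, Finset.sum_range_succ]
      congr 1
      refine Finset.sum_congr rfl fun r _ => ?_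
      have : g (Q * t + r) = g r := by
        rw [add_comm, mul_comm]; exact hg.nat_mul t r
      rw [this]; push_cast; rw [add_comm]
  rw [e, Finset.sum_comm, Finset.sum_mul]
  refine Finset.sum_congr rfl fun r _ => ?_
  rw [← Finset.mul_sum]
  congr 1
  rw [sum_range_zmod (fun s : ZMod ℓ => V ((r : ZMod ℓ) + (Q : ZMod ℓ) * s))]
  obtain ⟨u, hu⟩ := hQ
  rw [← hu]
  exact Fintype.sum_equiv ((Units.mulLeft u).trans (Equiv.addLeft (r : ZMod ℓ))) _ _ (fun s => rfl)

/-- Completely multiplicative functions bounded by `1` with period `Q`. -/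
structure IsBoundedPeriodicMul (g : ℕ → ℝ) (Q : ℕ) : Prop where
  pos : 0 < Q
  map_mul : ∀ m n, g (m * n) = g m * g n
  abs_le_one : ∀ n, |g n| ≤ 1
  periodic : Function.Periodic g Q

lemma abs_apDisc_le_one {ℓ : ℕ} (hℓ : ℓ.Prime) (n : ℕ) : |apDisc ℓ n| ≤ 1 := by
  have : Fact ℓ.Prime := ⟨hℓ⟩
  have h1 : (1 : ℝ) ≤ (ℓ : ℝ) - 1 := by
    have : (2 : ℝ) ≤ ℓ := by exact_mod_cast hℓ.two_le
    linarith
  have h2 : 1 / ((ℓ : ℝ) - 1) ≤ 1 := by rw [div_le_one (by linarith)]; exact h1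
  have h3 : 0 ≤ 1 / ((ℓ : ℝ) - 1) := by positivity
  unfold apDisc
  rw [abs_le]
  split_ifs <;> constructor <;> linarith

lemma abs_sum_mul_apDisc_le {g : ℕ → ℝ} {Q : ℕ} (hg : IsBoundedPeriodicMul g Q) {ℓ : ℕ}
    (hℓ : ℓ.Prime) (hQℓ : Q < ℓ) (m K : ℕ) :
    |∑ k ∈ Finset.Ioc 0 K, g k * apDisc ℓ (m * k)| ≤ 3 * Q := by
  have : Fact ℓ.Prime := ⟨hℓ⟩
  have : NeZero ℓ := ⟨hℓ.ne_zero⟩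
  have hQ1 : (1 : ℝ) ≤ Q := by exact_mod_cast hg.pos
  by_cases hm : (m : ZMod ℓ) = 0
  · rw [Finset.sum_eq_zero]
    · simp
    · intro k _; simp [apDisc, hm]
  have hQu : IsUnit (Q : ZMod ℓ) := by
    rw [isUnit_iff_ne_zero, Ne, ZMod.natCast_eq_zero_iff]
    intro h
    exact absurd (Nat.le_of_dvd hg.pos h) (by omega)
  set V : ZMod ℓ → ℝ := fun s => (if s = (m : ZMod ℓ)⁻¹ then 1 else 0) -
    (if s = 0 then 0 else 1 / ((ℓ : ℝ) - 1)) with hV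
  have eV : ∀ k : ℕ, apDisc ℓ (m * k) = V k := by
    intro k
    have i1 : ((m * k : ℕ) : ZMod ℓ) = 1 ↔ (k : ZMod ℓ) = (m : ZMod ℓ)⁻¹ := by
      push_cast
      exact ⟨fun h => eq_inv_of_mul_eq_one_right h, fun h => by rw [h, mul_inv_cancel₀ hm]⟩
    have i2 : ((m * k : ℕ) : ZMod ℓ) = 0 ↔ (k : ZMod ℓ) = 0 := by
      push_cast; simp [hm]
    simp only [apDisc, i1, i2, hV]
  have hpos : (0 : ℝ) < ℓ - 1 := by
    have : (1 : ℝ) < ℓ := by exact_mod_cast hℓ.one_lt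
    linarith
  have hcard : ∑ s : ZMod ℓ, (if s = 0 then (0 : ℝ) else 1 / ((ℓ : ℝ) - 1)) = 1 := by
    rw [← Finset.add_sum_erase _ _ (Finset.mem_univ (0 : ZMod ℓ)), if_pos rfl, zero_add,
      Finset.sum_congr rfl (g := fun _ => 1 / ((ℓ : ℝ) - 1))
      (fun s hs => by rw [if_neg (Finset.ne_of_mem_erase hs)]), Finset.sum_const,
      Finset.card_erase_of_mem (Finset.mem_univ _), Finset.card_univ, ZMod.card, nsmul_eq_mul,
      Nat.cast_sub hℓ.one_le, Nat.cast_one]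
    field_simp
  have hV0 : ∑ s : ZMod ℓ, V s = 0 := by
    simp only [hV]
    rw [Finset.sum_sub_distrib, hcard]
    simp
  have hV1 : ∑ s : ZMod ℓ, |V s| ≤ 2 := by
    calc ∑ s : ZMod ℓ, |V s| ≤ ∑ s : ZMod ℓ, ((if s = (m : ZMod ℓ)⁻¹ then (1 : ℝ) else 0) +
          (if s = 0 then 0 else 1 / ((ℓ : ℝ) - 1))) := by
          refine Finset.sum_le_sum fun s _ => ?_
          refine (abs_sub _ _).trans ?_
          rw [abs_of_nonneg, abs_of_nonneg]
          · split_ifs <;> positivity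
          · split_ifs <;> norm_num
      _ = 2 := by rw [Finset.sum_add_distrib, hcard]; simp; norm_num
  set W : ℕ → ℝ := fun k => g k * V k with hW
  have hper : Function.Periodic W (Q * ℓ) := by
    intro k
    simp only [hW]
    have hp : g (k + ℓ * Q) = g k := hg.periodic.nat_mul ℓ k
    rw [mul_comm Q ℓ, hp]
    push_cast; simp
  have hz : ∑ k ∈ Finset.range (Q * ℓ), W k = 0 := by
    simp only [hW]; rw [sum_range_mul_zmod hQu hg.periodic, hV0, mul_zero]
  have hab : ∑ k ∈ Finset.range (Q * ℓ), |W k| ≤ 2 * Q := by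
    simp only [hW, abs_mul]
    have hp : Function.Periodic (fun k => |g k|) Q := fun k => by
      simp only [hg.periodic k]
    rw [sum_range_mul_zmod hQu hp (fun s => |V s|), mul_comm (2 : ℝ)]
    apply mul_le_mul _ hV1 (by positivity) (by positivity)
    calc ∑ r ∈ Finset.range Q, |g r| ≤ ∑ r ∈ Finset.range Q, (1 : ℝ) :=
          Finset.sum_le_sum fun r _ => hg.abs_le_one r
      _ = Q := by simp
  have main := abs_sum_range_periodic_le (Nat.mul_pos hg.pos hℓ.pos) hper hz hab (K + 1)
  have e : ∑ k ∈ Finset.Ioc 0 K, g k * apDisc ℓ (m * k) =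
      ∑ k ∈ Finset.range (K + 1), W k - W 0 := by
    rw [Finset.range_eq_Ico, Finset.sum_eq_sum_Ico_succ_bot (by omega), add_sub_cancel_left]
    rw [show Finset.Ico (0 + 1) (K + 1) = Finset.Ioc 0 K by ext x; simp; omega]
    exact Finset.sum_congr rfl fun k _ => by rw [eV]
  have w0 : |W 0| ≤ 1 := by
    simp only [hW]
    rw [← eV, abs_mul]
    exact mul_le_one₀ (hg.abs_le_one 0) (abs_nonneg _) (abs_apDisc_le_one hℓ _)
  rw [e]
  refine (abs_sub _ _).trans ?_
  linarith

/-- Abel summation with a monotone weight. -/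
lemma abs_sum_monotone_mul_le {w h : ℕ → ℝ} (hw : Monotone w) (hw0 : 0 ≤ w 0) {B : ℝ}
    (hB : ∀ K, |∑ k ∈ Finset.Ioc 0 K, h k| ≤ B) (K : ℕ) :
    |∑ k ∈ Finset.Ioc 0 K, w k * h k| ≤ 2 * B * w K := by
  set S : ℕ → ℝ := fun K => ∑ k ∈ Finset.Ioc 0 K, h k with hS
  have B0 : 0 ≤ B := (abs_nonneg _).trans (hB 0)
  have id : ∀ K, ∑ k ∈ Finset.Ioc 0 K, w k * h k =
      w K * S K - ∑ j ∈ Finset.range K, (w (j + 1) - w j) * S j := by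
    intro K
    induction K with
    | zero => simp [hS]
    | succ K ih =>
      rw [← Finset.insert_Ioc_right_eq_Ioc_add_one (Nat.zero_le K), Finset.sum_insert (by simp), ih,
        Finset.sum_range_succ]
      have : S (K + 1) = h (K + 1) + S K := by
        simp only [hS]
        rw [← Finset.insert_Ioc_right_eq_Ioc_add_one (Nat.zero_le K), Finset.sum_insert (by simp)]
      rw [this]; ring
  rw [id]
  have wK : 0 ≤ w K := hw0.trans (hw (Nat.zero_le K))
  have h1 : |w K * S K| ≤ w K * B := by
    rw [abs_mul, abs_of_nonneg wK]; exact mul_le_mul_of_nonneg_left (hB K) wK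
  have h2 : |∑ j ∈ Finset.range K, (w (j + 1) - w j) * S j| ≤ (w K - w 0) * B := by
    refine (Finset.abs_sum_le_sum_abs _ _).trans ?_
    rw [← Finset.sum_range_sub w K, Finset.sum_mul]
    refine Finset.sum_le_sum fun j _ => ?_
    have : 0 ≤ w (j + 1) - w j := sub_nonneg.2 (hw (Nat.le_succ j))
    rw [abs_mul, abs_of_nonneg this]; exact mul_le_mul_of_nonneg_left (hB j) this
  refine (abs_sub _ _).trans ?_
  nlinarith

lemma monotone_log_natCast : Monotone fun n : ℕ => Real.log n := by
  intro a b hab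
  dsimp only
  rcases Nat.eq_zero_or_pos a with rfl | ha
  · simpa using Real.log_natCast_nonneg b
  · exact Real.log_le_log (by exact_mod_cast ha) (by exact_mod_cast hab)

open ArithmeticFunction in
lemma sum_Ioc_mul_apply_mul (F G : ArithmeticFunction ℝ) (f : ℕ → ℝ) (Y : ℕ) :
    ∑ n ∈ Finset.Ioc 0 Y, (F * G) n * f n =
      ∑ m ∈ Finset.Ioc 0 Y, ∑ k ∈ Finset.Ioc 0 (Y / m), F m * G k * f (m * k) := by
  have h1 : ∀ n ∈ Finset.Ioc 0 Y, (F * G) n * f n = ∑ m ∈ Finset.Ioc 0 Y,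
      ∑ k ∈ Finset.Ioc 0 Y, if m * k = n then F m * G k * f (m * k) else 0 := by
    intro n hn
    rw [Finset.mem_Ioc] at hn
    rw [ArithmeticFunction.mul_apply, Nat.divisorsAntidiagonal_eq_prod_filter_of_le hn.1.ne' hn.2,
      Finset.sum_filter, Finset.sum_product, Finset.sum_mul]
    refine Finset.sum_congr rfl fun m _ => ?_
    rw [Finset.sum_mul]
    refine Finset.sum_congr rfl fun k _ => ?_
    split_ifs with h
    · rw [h]
    · simp
  rw [Finset.sum_congr rfl h1, Finset.sum_comm]
  refine Finset.sum_congr rfl fun m hm => ?_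
  rw [Finset.mem_Ioc] at hm
  rw [Finset.sum_comm]
  have h2 : ∀ k ∈ Finset.Ioc 0 Y, (∑ n ∈ Finset.Ioc 0 Y,
      if m * k = n then F m * G k * f (m * k) else 0) =
      if k ≤ Y / m then F m * G k * f (m * k) else 0 := by
    intro k hk
    rw [Finset.mem_Ioc] at hk
    rw [Finset.sum_ite_eq]
    congr 1
    rw [Finset.mem_Ioc, Nat.le_div_iff_mul_le hm.1, mul_comm k m]
    simp [hm.1.ne', hk.1.ne', Nat.pos_iff_ne_zero]
  rw [Finset.sum_congr rfl h2, ← Finset.sum_filter]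
  refine Finset.sum_congr ?_ fun _ _ => rfl
  ext k
  simp only [Finset.mem_filter, Finset.mem_Ioc]
  constructor
  · rintro ⟨h, h'⟩; exact ⟨h.1, h'⟩
  · rintro ⟨h, h'⟩; exact ⟨⟨h, h'.trans (Nat.div_le_self _ _)⟩, h'⟩

lemma card_divisors_mul_le (m n : ℕ) :
    (m * n).divisors.card ≤ m.divisors.card * n.divisors.card := by
  rw [Nat.divisors_mul]; exact Finset.card_mul_le

lemma sum_Ioc_inv_le (N : ℕ) : ∑ n ∈ Finset.Ioc 0 N, (1 : ℝ) / n ≤ 1 + Real.log N := by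
  have := harmonic_le_one_add_log N
  rw [harmonic_eq_sum_Icc] at this
  push_cast at this
  refine le_trans (le_of_eq ?_) this
  refine Finset.sum_congr ?_ fun _ _ => by rw [one_div]
  ext; simp; omega

lemma sum_divisors_eq_sum_sum (f : ℕ → ℕ → ℝ) (N : ℕ) :
    ∑ n ∈ Finset.Ioc 0 N, ∑ d ∈ n.divisors, f d n =
      ∑ d ∈ Finset.Ioc 0 N, ∑ k ∈ Finset.Ioc 0 (N / d), f d (d * k) := by
  have h : ∀ n ∈ Finset.Ioc 0 N, ∑ d ∈ n.divisors, f d n =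
      ∑ d ∈ Finset.Ioc 0 N, if d ∣ n then f d n else 0 := by
    intro n hn
    rw [Finset.mem_Ioc] at hn
    rw [← Finset.sum_filter]
    refine Finset.sum_congr ?_ fun _ _ => rfl
    ext d
    simp only [Nat.mem_divisors, Finset.mem_filter, Finset.mem_Ioc]
    constructor
    · rintro ⟨h1, h2⟩
      exact ⟨⟨Nat.pos_of_dvd_of_pos h1 hn.1, (Nat.le_of_dvd hn.1 h1).trans hn.2⟩, h1⟩
    · rintro ⟨_, h1⟩
      exact ⟨h1, hn.1.ne'⟩
  rw [Finset.sum_congr rfl h, Finset.sum_comm]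
  refine Finset.sum_congr rfl fun d hd => ?_
  rw [Finset.mem_Ioc] at hd
  rw [← Finset.sum_filter]
  symm
  refine Finset.sum_nbij' (fun k => d * k) (fun n => n / d) ?_ ?_ ?_ ?_ ?_
  · intro k hk
    simp only [Finset.mem_Ioc, Finset.mem_filter] at hk ⊢
    refine ⟨⟨Nat.mul_pos hd.1 hk.1, ?_⟩, dvd_mul_right _ _⟩
    rw [mul_comm]; exact (Nat.le_div_iff_mul_le hd.1).1 hk.2
  · intro n hn
    simp only [Finset.mem_Ioc, Finset.mem_filter] at hn ⊢
    exact ⟨Nat.div_pos (Nat.le_of_dvd hn.1.1 hn.2) hd.1, Nat.div_le_div_right hn.1.2⟩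
  · intro k _; exact Nat.mul_div_cancel_left _ hd.1
  · intro n hn; exact Nat.mul_div_cancel' (Finset.mem_filter.1 hn).2
  · intro k _; rfl

lemma sum_card_divisors_le (N : ℕ) :
    ∑ n ∈ Finset.Ioc 0 N, (n.divisors.card : ℝ) ≤ N * (1 + Real.log N) := by
  have := sum_divisors_eq_sum_sum (fun _ _ => 1) N
  simp only [Finset.sum_const, nsmul_eq_mul, mul_one, Nat.card_Ioc, tsub_zero] at this
  rw [this]
  calc ∑ d ∈ Finset.Ioc 0 N, ((N / d : ℕ) : ℝ) ≤ ∑ d ∈ Finset.Ioc 0 N, (N : ℝ) * (1 / d) := by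
        refine Finset.sum_le_sum fun d _ => ?_
        rw [mul_one_div]; exact Nat.cast_div_le
    _ ≤ _ := by
        rw [← Finset.mul_sum]
        exact mul_le_mul_of_nonneg_left (sum_Ioc_inv_le N) (by positivity)

lemma log_natCast_le_of_le {a b : ℕ} (h : a ≤ b) : Real.log a ≤ Real.log b :=
  monotone_log_natCast h

lemma sum_card_divisors_sq_le (N : ℕ) :
    ∑ n ∈ Finset.Ioc 0 N, (n.divisors.card : ℝ) ^ 2 ≤ N * (1 + Real.log N) ^ 3 := by
  have L0 : 0 ≤ Real.log N := Real.log_natCast_nonneg N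
  have e1 : ∑ n ∈ Finset.Ioc 0 N, (n.divisors.card : ℝ) ^ 2 =
      ∑ n ∈ Finset.Ioc 0 N, ∑ d ∈ n.divisors, (n.divisors.card : ℝ) := by
    refine Finset.sum_congr rfl fun n _ => ?_
    rw [Finset.sum_const, nsmul_eq_mul, sq]
  have e2 : ∑ d ∈ Finset.Ioc 0 N, (d.divisors.card : ℝ) * (1 / d) ≤ (1 + Real.log N) ^ 2 := by
    have : ∑ d ∈ Finset.Ioc 0 N, (d.divisors.card : ℝ) * (1 / d) =
        ∑ d ∈ Finset.Ioc 0 N, ∑ e ∈ d.divisors, (1 : ℝ) / d := by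
      refine Finset.sum_congr rfl fun n _ => ?_
      rw [Finset.sum_const, nsmul_eq_mul]
    rw [this, sum_divisors_eq_sum_sum (fun _ n => (1 : ℝ) / n) N, sq]
    calc ∑ d ∈ Finset.Ioc 0 N, ∑ k ∈ Finset.Ioc 0 (N / d), (1 : ℝ) / ((d * k : ℕ) : ℝ)
        ≤ ∑ d ∈ Finset.Ioc 0 N, (1 : ℝ) / d * (1 + Real.log N) := by
          refine Finset.sum_le_sum fun d _ => ?_
          have : ∀ k : ℕ, (1 : ℝ) / ((d * k : ℕ) : ℝ) = 1 / d * (1 / k) := by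
            intro k; push_cast; rw [one_div_mul_one_div]
          simp_rw [this]
          rw [← Finset.mul_sum]
          apply mul_le_mul_of_nonneg_left _ (by positivity)
          refine (sum_Ioc_inv_le _).trans ?_
          have := log_natCast_le_of_le (Nat.div_le_self N d)
          linarith
      _ ≤ _ := by
          rw [← Finset.sum_mul]
          apply mul_le_mul_of_nonneg_right (sum_Ioc_inv_le N) (by positivity)
  rw [e1, sum_divisors_eq_sum_sum (fun _ n => (n.divisors.card : ℝ)) N]
  calc ∑ d ∈ Finset.Ioc 0 N, ∑ k ∈ Finset.Ioc 0 (N / d), ((d * k).divisors.card : ℝ)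
      ≤ ∑ d ∈ Finset.Ioc 0 N, (d.divisors.card : ℝ) * (1 / d) * (N * (1 + Real.log N)) := by
        refine Finset.sum_le_sum fun d hd => ?_
        calc _ ≤ ∑ k ∈ Finset.Ioc 0 (N / d), (d.divisors.card : ℝ) * (k.divisors.card : ℝ) := by
              refine Finset.sum_le_sum fun k _ => ?_
              exact_mod_cast card_divisors_mul_le d k
          _ ≤ (d.divisors.card : ℝ) * ((N / d) * (1 + Real.log N)) := by
              rw [← Finset.mul_sum]
              apply mul_le_mul_of_nonneg_left _ (by positivity)
              refine (sum_card_divisors_le _).trans ?_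
              have h1 := log_natCast_le_of_le (Nat.div_le_self N d)
              have h2 : ((N / d : ℕ) : ℝ) ≤ N / d := Nat.cast_div_le
              have := Real.log_natCast_nonneg (N / d)
              gcongr
          _ = _ := by ring
    _ ≤ (1 + Real.log N) ^ 2 * (N * (1 + Real.log N)) := by
        rw [← Finset.sum_mul]
        apply mul_le_mul_of_nonneg_right e2 (by positivity)
    _ = _ := by ring

section Vaughan

open ArithmeticFunction ArithmeticFunction.Moebius ArithmeticFunction.zeta

lemma arithmeticFunction_sub_apply (F G : ArithmeticFunction ℝ) (n : ℕ) :
    (F - G) n = F n - G n := by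
  rw [sub_eq_add_neg, sub_eq_add_neg]; rfl

/-- The restriction of an arithmetic function to arguments at most `U`. -/
noncomputable def truncLE (F : ArithmeticFunction ℝ) (U : ℕ) : ArithmeticFunction ℝ :=
  ⟨fun n => if n ≤ U then F n else 0, by simp⟩

lemma truncLE_apply (F : ArithmeticFunction ℝ) (U n : ℕ) :
    truncLE F U n = if n ≤ U then F n else 0 := rfl

lemma vaughan_identity (U : ℕ) :
    Λ = truncLE Λ U + truncLE (μ : ArithmeticFunction ℝ) U * ArithmeticFunction.log
      - (truncLE Λ U * truncLE (μ : ArithmeticFunction ℝ) U) * (ζ : ArithmeticFunction ℝ)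
      + (Λ - truncLE Λ U) *
        ((ζ : ArithmeticFunction ℝ) *
          ((μ : ArithmeticFunction ℝ) - truncLE (μ : ArithmeticFunction ℝ) U)) := by
  have h1 : (ζ : ArithmeticFunction ℝ) * (μ : ArithmeticFunction ℝ) = 1 := coe_zeta_mul_coe_moebius
  have h2 : Λ * (ζ : ArithmeticFunction ℝ) = ArithmeticFunction.log := vonMangoldt_mul_zeta
  rw [← h2]
  linear_combination (truncLE Λ U - Λ) * h1

lemma abs_moebius_real_le_one (n : ℕ) : |((μ n : ℤ) : ℝ)| ≤ 1 := by
  rw [← Int.cast_abs]; exact_mod_cast ArithmeticFunction.abs_moebius_le_one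

/-- An averaged form of the Bombieri-Vinogradov theorem for prime moduli in `(D, 4 * D]`. -/
theorem abs_sum_vonMangoldt_mul_apDisc_le {g : ℕ → ℝ} {Q : ℕ} (hg : IsBoundedPeriodicMul g Q)
    {D : ℕ} {P : Finset ℕ} (hP : ∀ ℓ ∈ P, ℓ.Prime ∧ D < ℓ ∧ ℓ ≤ 4 * D) {Y U : ℕ} (hU : 0 < U)
    (hUD : U ≤ D) (hQD : Q ≤ D) (hDY : D ^ 2 * U ≤ Y) :
    |∑ n ∈ Finset.Ioc 0 Y, Λ n * (g n * ∑ ℓ ∈ P, apDisc ℓ n)| ≤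
      40 * Q * D * U ^ 2 * (1 + Real.log Y) + 4096 * (1 + Real.log Y) ^ 5 * (Y / √U) := by
  have hD : 0 < D := by omega
  have hY : 0 < Y := lt_of_lt_of_le (by positivity) hDY
  have hUY : U ≤ Y := by nlinarith [pow_pos hD 2]
  have L0 : 0 ≤ Real.log Y := Real.log_natCast_nonneg Y
  have hU1 : (1 : ℝ) ≤ U := by exact_mod_cast hU
  have hQ1 : (1 : ℝ) ≤ Q := by exact_mod_cast hg.pos
  have hD1 : (1 : ℝ) ≤ D := by exact_mod_cast hD
  have hcard : (P.card : ℝ) ≤ 3 * D := by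
    have : P ⊆ Finset.Ioc D (4 * D) := fun ℓ h => Finset.mem_Ioc.2 (hP ℓ h).2
    have := Finset.card_le_card this
    rw [Nat.card_Ioc] at this
    have h3 : P.card ≤ 3 * D := by omega
    exact_mod_cast h3
  set f : ℕ → ℝ := fun n => g n * ∑ ℓ ∈ P, apDisc ℓ n with hf
  have f1 : ∀ n, |f n| ≤ 3 * D := by
    intro n
    simp only [hf, abs_mul]
    calc |g n| * |∑ ℓ ∈ P, apDisc ℓ n| ≤ 1 * ∑ ℓ ∈ P, (1 : ℝ) := by
          apply mul_le_mul (hg.abs_le_one n) _ (abs_nonneg _) (by norm_num)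
          exact (Finset.abs_sum_le_sum_abs _ _).trans
            (Finset.sum_le_sum fun ℓ h => abs_apDisc_le_one (hP ℓ h).1 n)
      _ ≤ _ := by simpa using hcard
  have tI : ∀ m K, |∑ k ∈ Finset.Ioc 0 K, f (m * k)| ≤ 9 * Q * D := by
    intro m K
    have e : ∑ k ∈ Finset.Ioc 0 K, f (m * k) =
        g m * ∑ ℓ ∈ P, ∑ k ∈ Finset.Ioc 0 K, g k * apDisc ℓ (m * k) := by
      rw [Finset.sum_comm, Finset.mul_sum]
      refine Finset.sum_congr rfl fun k _ => ?_
      simp only [hf]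
      rw [hg.map_mul, mul_assoc, Finset.mul_sum]
    rw [e, abs_mul]
    calc _ ≤ 1 * ∑ ℓ ∈ P, (3 * Q : ℝ) := by
          apply mul_le_mul (hg.abs_le_one m) _ (abs_nonneg _) (by norm_num)
          exact (Finset.abs_sum_le_sum_abs _ _).trans
            (Finset.sum_le_sum fun ℓ h => abs_sum_mul_apDisc_le hg (hP ℓ h).1
              (by have := hP ℓ h; omega) m K)
      _ = P.card * (3 * Q) := by simp
      _ ≤ 3 * D * (3 * Q) := by gcongr
      _ = _ := by ring
  have tIlog : ∀ m K, K ≤ Y → |∑ k ∈ Finset.Ioc 0 K, Real.log k * f (m * k)| ≤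
      18 * Q * D * Real.log Y := by
    intro m K hK
    refine (abs_sum_monotone_mul_le monotone_log_natCast (by simp) (tI m) K).trans ?_
    have := log_natCast_le_of_le hK
    rw [show (18 * Q * D * Real.log Y : ℝ) = 2 * (9 * Q * D) * Real.log Y by ring]
    gcongr
  set Λ1 := truncLE Λ U with hΛ1
  set μ1 := truncLE (μ : ArithmeticFunction ℝ) U with hμ1
  have Λlog : ∀ n ≤ Y, |Λ n| ≤ Real.log Y := fun n hn => by
    rw [abs_of_nonneg vonMangoldt_nonneg]
    exact vonMangoldt_le_log.trans (log_natCast_le_of_le hn)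
  -- the initial segment
  have T0 : |∑ n ∈ Finset.Ioc 0 Y, Λ1 n * f n| ≤ U * (Real.log Y * (3 * D)) := by
    have e : ∑ n ∈ Finset.Ioc 0 Y, Λ1 n * f n = ∑ n ∈ Finset.Ioc 0 U, Λ n * f n := by
      symm
      rw [← Finset.sum_subset (Finset.Ioc_subset_Ioc_right hUY) (fun n _ hn => ?_)]
      · refine Finset.sum_congr rfl fun n hn => ?_
        rw [hΛ1, truncLE_apply, if_pos (Finset.mem_Ioc.1 hn).2]
      · rw [hΛ1, truncLE_apply, if_neg, zero_mul]
        simp only [Finset.mem_Ioc] at *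
        omega
    rw [e]
    refine (Finset.abs_sum_le_sum_abs _ _).trans ?_
    calc _ ≤ ∑ n ∈ Finset.Ioc 0 U, Real.log Y * (3 * D) := by
          refine Finset.sum_le_sum fun n hn => ?_
          rw [abs_mul]
          exact mul_le_mul (Λlog n ((Finset.mem_Ioc.1 hn).2.trans hUY)) (f1 n) (abs_nonneg _) L0
      _ = _ := by simp
  have T1 : |∑ n ∈ Finset.Ioc 0 Y, (μ1 * ArithmeticFunction.log) n * f n| ≤
      U * (18 * Q * D * Real.log Y) := by
    rw [sum_Ioc_mul_apply_mul]
    rw [← Finset.sum_subset (Finset.Ioc_subset_Ioc_right hUY) (fun n _ hn => ?_)]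
    · refine (Finset.abs_sum_le_sum_abs _ _).trans ?_
      calc _ ≤ ∑ n ∈ Finset.Ioc 0 U, 18 * Q * D * Real.log Y := by
            refine Finset.sum_le_sum fun m hm => ?_
            simp_rw [mul_assoc (μ1 m)]
            rw [← Finset.mul_sum, abs_mul]
            have h1 : |μ1 m| ≤ 1 := by
              rw [hμ1, truncLE_apply]
              split_ifs
              · exact abs_moebius_real_le_one m
              · simp
            have := tIlog m (Y / m) (Nat.div_le_self _ _)
            simp only [ArithmeticFunction.log_apply]
            calc _ ≤ 1 * (18 * Q * D * Real.log Y) := by gcongr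
              _ = _ := one_mul _
        _ = _ := by simp
    · rw [hμ1, truncLE_apply, if_neg]
      · simp
      · simp only [Finset.mem_Ioc] at *
        omega
  have c1 : ∀ m, |(Λ1 * μ1) m| ≤ Real.log m := by
    intro m
    rw [ArithmeticFunction.mul_apply]
    refine (Finset.abs_sum_le_sum_abs _ _).trans ?_
    rw [← vonMangoldt_sum, ← Nat.map_div_right_divisors, Finset.sum_map]
    refine Finset.sum_le_sum fun d _ => ?_
    simp only [abs_mul]
    have h1 : |Λ1 d| ≤ Λ d := by
      rw [hΛ1, truncLE_apply]
      split_ifs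
      · rw [abs_of_nonneg vonMangoldt_nonneg]
      · simp
    have h2 : |μ1 (m / d)| ≤ 1 := by
      rw [hμ1, truncLE_apply]
      split_ifs
      · exact abs_moebius_real_le_one _
      · simp
    calc _ ≤ Λ d * 1 := mul_le_mul h1 h2 (abs_nonneg _) vonMangoldt_nonneg
      _ = _ := mul_one _
  have c2 : ∀ m, U ^ 2 < m → (Λ1 * μ1) m = 0 := by
    intro m hm
    rw [ArithmeticFunction.mul_apply]
    refine Finset.sum_eq_zero fun x hx => ?_
    have := (Nat.mem_divisorsAntidiagonal.1 hx).1
    rw [hΛ1, hμ1, truncLE_apply, truncLE_apply]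
    by_cases h1 : x.1 ≤ U
    · by_cases h2 : x.2 ≤ U
      · exfalso; nlinarith
      · simp [h2]
    · simp [h1]
  have T2 : |∑ n ∈ Finset.Ioc 0 Y, ((Λ1 * μ1) * (ζ : ArithmeticFunction ℝ)) n * f n| ≤
      U ^ 2 * (Real.log Y * (9 * Q * D)) := by
    rw [sum_Ioc_mul_apply_mul]
    have hbd : ∀ m ∈ Finset.Ioc 0 Y, |∑ k ∈ Finset.Ioc 0 (Y / m),
        (Λ1 * μ1) m * (ζ : ArithmeticFunction ℝ) k * f (m * k)| ≤
        if m ≤ U ^ 2 then Real.log Y * (9 * Q * D) else 0 := by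
      intro m hm
      simp_rw [mul_assoc ((Λ1 * μ1) m)]
      rw [← Finset.mul_sum, abs_mul]
      split_ifs with h
      · apply mul_le_mul _ _ (abs_nonneg _) L0
        · exact (c1 m).trans (log_natCast_le_of_le (Finset.mem_Ioc.1 hm).2)
        · refine le_trans (le_of_eq ?_) (tI m (Y / m))
          congr 1
          refine Finset.sum_congr rfl fun k hk => ?_
          have : k ≠ 0 := (Finset.mem_Ioc.1 hk).1.ne'
          simp [ArithmeticFunction.natCoe_apply, this]
      · rw [c2 m (by omega)]; simp
    refine (Finset.abs_sum_le_sum_abs _ _).trans ((Finset.sum_le_sum hbd).trans ?_)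
    rw [← Finset.sum_filter, Finset.sum_const, nsmul_eq_mul]
    apply mul_le_mul_of_nonneg_right _ (by positivity)
    have : (Finset.Ioc 0 Y).filter (fun m => m ≤ U ^ 2) ⊆ Finset.Ioc 0 (U ^ 2) := by
      intro m hm; simp only [Finset.mem_filter, Finset.mem_Ioc] at *; omega
    have := Finset.card_le_card this
    rw [Nat.card_Ioc, tsub_zero] at this
    exact_mod_cast this
  have T3 : |∑ n ∈ Finset.Ioc 0 Y, ((Λ - Λ1) *
      ((ζ : ArithmeticFunction ℝ) * ((μ : ArithmeticFunction ℝ) - μ1))) n * f n| ≤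
      4096 * (1 + Real.log Y) ^ 5 * (Y / √U) := by
    rw [sum_Ioc_mul_apply_mul]
    set b0 := (ζ : ArithmeticFunction ℝ) * ((μ : ArithmeticFunction ℝ) - μ1) with hb0
    have bb : ∀ k, |b0 k| ≤ k.divisors.card := by
      intro k
      rw [hb0, coe_zeta_mul_apply]
      refine (Finset.abs_sum_le_sum_abs _ _).trans ?_
      calc _ ≤ ∑ i ∈ k.divisors, (1 : ℝ) := by
            refine Finset.sum_le_sum fun i _ => ?_
            rw [arithmeticFunction_sub_apply, hμ1, truncLE_apply]
            split_ifs
            · simp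
            · simpa using abs_moebius_real_le_one i
        _ = _ := by simp
    have bz : ∀ k, k ≤ U → b0 k = 0 := by
      intro k hk
      rw [hb0, coe_zeta_mul_apply]
      refine Finset.sum_eq_zero fun i hi => ?_
      have : i ≤ U := (Nat.divisor_le hi).trans hk
      rw [arithmeticFunction_sub_apply, hμ1, truncLE_apply, if_pos this, sub_self]
    have e : ∀ m k, (Λ - Λ1) m * b0 k * f (m * k) =
        ((Λ - Λ1) m * g m) * (b0 k * g k) * ∑ ℓ ∈ P, apDisc ℓ (m * k) := by
      intro m k; simp only [hf, hg.map_mul]; ring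
    simp_rw [e]
    have main := abs_typeII_sum_le hP hU hUD hDY (a := fun m => (Λ - Λ1) m * g m)
      (b := fun k => b0 k * g k) (A := 1 + Real.log Y) (B := (1 + Real.log Y) ^ 2)
      (by positivity) (by positivity)
      (fun m hm => by
        rw [arithmeticFunction_sub_apply, hΛ1, truncLE_apply, if_pos hm, sub_self, zero_mul])
      (fun k hk => by rw [bz k hk, zero_mul])
      (fun m hm => by
        rw [abs_mul]
        have h1 : |(Λ - Λ1) m| ≤ 1 + Real.log Y := by
          have h2 : Real.log m ≤ 1 + Real.log Y := by
            have := log_natCast_le_of_le hm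
            push_cast at this
            rw [Real.log_mul (by norm_num) (by positivity)] at this
            have := Real.log_two_lt_d9
            linarith
          rw [arithmeticFunction_sub_apply, hΛ1, truncLE_apply]
          split_ifs
          · simp; positivity
          · rw [sub_zero, abs_of_nonneg vonMangoldt_nonneg]
            exact vonMangoldt_le_log.trans h2
        calc _ ≤ (1 + Real.log Y) * 1 := by gcongr; exact hg.abs_le_one m
          _ = _ := mul_one _)
      (fun N hN => by
        have hl := log_natCast_le_of_le hN
        have l0 := Real.log_natCast_nonneg N
        calc _ ≤ ∑ n ∈ Finset.Ioc 0 N, (n.divisors.card : ℝ) ^ 2 := by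
              refine Finset.sum_le_sum fun n _ => ?_
              rw [← sq_abs, abs_mul]
              have : |b0 n| * |g n| ≤ n.divisors.card * 1 := by
                gcongr
                · exact bb n
                · exact hg.abs_le_one n
              rw [mul_one] at this
              gcongr
          _ ≤ N * (1 + Real.log N) ^ 3 := sum_card_divisors_sq_le N
          _ ≤ N * (1 + Real.log Y) ^ 3 := by gcongr
          _ ≤ N * (1 + Real.log Y) ^ 4 := by
              gcongr
              · linarith
              · norm_num
          _ = _ := by ring)
    refine main.trans ?_
    have hlog : ((Nat.log 2 Y + 2 : ℕ) : ℝ) ≤ 2 * (1 + Real.log Y) := by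
      have h1 : (2 : ℝ) ^ Nat.log 2 Y ≤ Y := by exact_mod_cast Nat.pow_log_le_self 2 hY.ne'
      have h2 := Real.log_le_log (by positivity) h1
      rw [Real.log_pow] at h2
      have h3 := Real.log_two_gt_d9
      push_cast
      have : (0 : ℝ) ≤ Nat.log 2 Y := by positivity
      nlinarith
    have s0 : 0 < √(U : ℝ) := Real.sqrt_pos.2 (by linarith)
    calc _ ≤ 1024 * (1 + Real.log Y) * (1 + Real.log Y) ^ 2 *
        (2 * (1 + Real.log Y)) ^ 2 * (Y / √U) := by
          gcongr
      _ = _ := by ring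
  have split : ∑ n ∈ Finset.Ioc 0 Y, Λ n * f n =
      ∑ n ∈ Finset.Ioc 0 Y, Λ1 n * f n
      + ∑ n ∈ Finset.Ioc 0 Y, (μ1 * ArithmeticFunction.log) n * f n
      - ∑ n ∈ Finset.Ioc 0 Y, ((Λ1 * μ1) * (ζ : ArithmeticFunction ℝ)) n * f n
      + ∑ n ∈ Finset.Ioc 0 Y, ((Λ - Λ1) *
        ((ζ : ArithmeticFunction ℝ) * ((μ : ArithmeticFunction ℝ) - μ1))) n * f n := by
    rw [← Finset.sum_add_distrib, ← Finset.sum_sub_distrib, ← Finset.sum_add_distrib]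
    refine Finset.sum_congr rfl fun n _ => ?_
    have := congrArg (fun F : ArithmeticFunction ℝ => F n) (vaughan_identity U)
    simp only [ArithmeticFunction.add_apply, arithmeticFunction_sub_apply] at this
    rw [this]
    ring
  rw [split]
  have hl : Real.log Y ≤ 1 + Real.log Y := by linarith
  have b0 : (U : ℝ) * (Real.log Y * (3 * D)) ≤ 3 * (Q * D * U ^ 2 * (1 + Real.log Y)) := by
    calc (U : ℝ) * (Real.log Y * (3 * D)) = 3 * (1 * D * (U * 1) * Real.log Y) := by ring
      _ ≤ 3 * (Q * D * (U * U) * (1 + Real.log Y)) := by gcongr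
      _ = _ := by ring
  have b1 : (U : ℝ) * (18 * Q * D * Real.log Y) ≤ 18 * (Q * D * U ^ 2 * (1 + Real.log Y)) := by
    calc (U : ℝ) * (18 * Q * D * Real.log Y) = 18 * (Q * D * (U * 1) * Real.log Y) := by ring
      _ ≤ 18 * (Q * D * (U * U) * (1 + Real.log Y)) := by gcongr
      _ = _ := by ring
  have b2 : (U : ℝ) ^ 2 * (Real.log Y * (9 * Q * D)) ≤ 9 * (Q * D * U ^ 2 * (1 + Real.log Y)) := by
    calc (U : ℝ) ^ 2 * (Real.log Y * (9 * Q * D)) = 9 * (Q * D * U ^ 2 * Real.log Y) := by ring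
      _ ≤ 9 * (Q * D * U ^ 2 * (1 + Real.log Y)) := by gcongr
  have b3 : 0 ≤ (Q : ℝ) * D * U ^ 2 * (1 + Real.log Y) := by positivity
  rw [abs_le] at T0 T1 T2 T3 ⊢
  constructor <;> linarith [T0.1, T0.2, T1.1, T1.2, T2.1, T2.2, T3.1, T3.2]

end Vaughan

lemma abs_sum_antitone_mul_le {w h : ℕ → ℝ} {N : ℕ} (hw : AntitoneOn w (Set.Ici N))
    (hw0 : ∀ n, 0 ≤ w n) {B : ℝ} (hB : ∀ K, |∑ k ∈ Finset.Ioc 0 K, h k| ≤ B) {M : ℕ}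
    (hNM : N ≤ M) :
    |∑ k ∈ Finset.Ioc N M, w k * h k| ≤ 4 * B * w N := by
  have B0 : 0 ≤ B := (abs_nonneg _).trans (hB 0)
  have split : ∀ f : ℕ → ℝ, ∑ k ∈ Finset.Ioc N M, f k =
      ∑ k ∈ Finset.Ioc 0 M, f k - ∑ k ∈ Finset.Ioc 0 N, f k := fun f => by
    rw [← Finset.sum_Ioc_consecutive f (Nat.zero_le N) hNM]; ring
  have h1 := abs_sum_monotone_mul_le (w := fun k => w N - w (max k N)) (h := h)
    (fun a b hab => by
      dsimp only
      have := hw (Set.mem_Ici.2 (le_max_right a N)) (Set.mem_Ici.2 (le_max_right b N))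
        (max_le_max_right N hab)
      linarith) (by simp) hB M
  have h2 : ∑ k ∈ Finset.Ioc 0 M, (w N - w (max k N)) * h k =
      ∑ k ∈ Finset.Ioc N M, (w N - w k) * h k := by
    rw [← Finset.sum_Ioc_consecutive _ (Nat.zero_le N) hNM, Finset.sum_eq_zero, zero_add]
    · refine Finset.sum_congr rfl fun k hk => ?_
      rw [max_eq_left (Finset.mem_Ioc.1 hk).1.le]
    · intro k hk
      rw [max_eq_right (Finset.mem_Ioc.1 hk).2, sub_self, zero_mul]
  have h3 : ∑ k ∈ Finset.Ioc N M, w k * h k =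
      w N * (∑ k ∈ Finset.Ioc 0 M, h k - ∑ k ∈ Finset.Ioc 0 N, h k) -
        ∑ k ∈ Finset.Ioc N M, (w N - w k) * h k := by
    rw [← split, Finset.mul_sum, ← Finset.sum_sub_distrib]
    exact Finset.sum_congr rfl fun k _ => by ring
  rw [h2] at h1
  rw [h3]
  have h4 : |w N * (∑ k ∈ Finset.Ioc 0 M, h k - ∑ k ∈ Finset.Ioc 0 N, h k)| ≤ w N * (B + B) := by
    rw [abs_mul, abs_of_nonneg (hw0 N)]
    exact mul_le_mul_of_nonneg_left ((abs_sub _ _).trans (add_le_add (hB M) (hB N))) (hw0 N)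
  have h5 : 2 * B * (w N - w (max M N)) ≤ 2 * B * w N :=
    mul_le_mul_of_nonneg_left (by linarith [hw0 (max M N)]) (by positivity)
  refine (abs_sub _ _).trans ?_
  linarith

lemma norm_LSeries_sub_sum_le {Q : ℕ} [NeZero Q] (χ : DirichletCharacter ℂ Q) {g : ℕ → ℝ}
    (hg : ∀ n : ℕ, χ n = g n) {B : ℝ} (hB : ∀ K, |∑ k ∈ Finset.Ioc 0 K, g k| ≤ B) {s : ℝ}
    (hs : 1 < s) {N : ℕ} (hN : 0 < N) :
    ‖LSeries (χ ·) s - ((∑ k ∈ Finset.Ioc 0 N, g k * (k : ℝ) ^ (-s) : ℝ) : ℂ)‖ ≤ 4 * B / N := by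
  have B0 : 0 ≤ B := (abs_nonneg _).trans (hB 0)
  have hsum := (DirichletCharacter.LSeriesSummable_of_one_lt_re χ
    (show 1 < (s : ℂ).re by simpa using hs)).hasSum.tendsto_sum_nat
  have hterm : ∀ k : ℕ, LSeries.term (χ ·) s k = ((g k * (k : ℝ) ^ (-s) : ℝ) : ℂ) := by
    intro k
    rcases Nat.eq_zero_or_pos k with rfl | hk
    · simp [Real.zero_rpow (by linarith : -s ≠ 0)]
    · rw [LSeries.term_of_ne_zero hk.ne', hg, Complex.ofReal_mul,
        Complex.ofReal_cpow (Nat.cast_nonneg k), Complex.ofReal_natCast, Complex.ofReal_neg,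
        Complex.cpow_neg, div_eq_mul_inv]
  have hpart : ∀ M, ∑ k ∈ Finset.range (M + 1), LSeries.term (χ ·) s k =
      ((∑ k ∈ Finset.Ioc 0 M, g k * (k : ℝ) ^ (-s) : ℝ) : ℂ) := by
    intro M
    simp_rw [hterm]
    rw [← Complex.ofReal_sum, Finset.sum_range_succ', Nat.cast_zero,
      Real.zero_rpow (by linarith : -s ≠ 0), mul_zero, add_zero,
      ← Finset.Ico_add_one_add_one_eq_Ioc,
      Finset.sum_Ico_eq_sum_range]
    simp [add_comm]
  have hlim := ((Filter.tendsto_add_atTop_iff_nat 1).2 hsum).sub_const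
    ((∑ k ∈ Finset.Ioc 0 N, g k * (k : ℝ) ^ (-s) : ℝ) : ℂ) |>.norm
  refine le_of_tendsto hlim (Filter.eventually_atTop.2 ⟨N, fun M hM => ?_⟩)
  rw [hpart, ← Complex.ofReal_sub, Complex.norm_real, Real.norm_eq_abs,
    ← Finset.sum_Ioc_consecutive _ (Nat.zero_le N) hM, add_sub_cancel_left]
  simp_rw [mul_comm (g _)]
  refine (abs_sum_antitone_mul_le (w := fun k : ℕ => (k : ℝ) ^ (-s)) ?_
    (fun n => by positivity) hB hM).trans ?_
  · intro a ha b hb hab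
    have : 0 < a := lt_of_lt_of_le hN ha
    exact Real.rpow_le_rpow_of_nonpos (by exact_mod_cast this) (by exact_mod_cast hab)
      (by linarith)
  · rw [div_eq_mul_inv]
    refine mul_le_mul_of_nonneg_left ?_ (by positivity)
    rw [← Real.rpow_neg_one]
    exact Real.rpow_le_rpow_of_exponent_le (by exact_mod_cast hN) (by linarith)

lemma exists_abs_sub_sum_div_le {Q : ℕ} [NeZero Q] {χ : DirichletCharacter ℂ Q} (hχ : χ ≠ 1)
    {g : ℕ → ℝ} (hg : ∀ n : ℕ, χ n = g n) {B : ℝ} (hB : ∀ K, |∑ k ∈ Finset.Ioc 0 K, g k| ≤ B) :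
    ∃ L : ℝ, L ≠ 0 ∧ ∀ N : ℕ, 0 < N → |L - ∑ k ∈ Finset.Ioc 0 N, g k / k| ≤ 4 * B / N := by
  have key : ∀ N : ℕ, 0 < N →
      ‖χ.LFunction 1 - ((∑ k ∈ Finset.Ioc 0 N, g k / k : ℝ) : ℂ)‖ ≤ 4 * B / N := by
    intro N hN
    have c1 : Filter.Tendsto (fun s : ℝ => χ.LFunction s) (nhdsWithin 1 (Set.Ioi 1))
        (nhds (χ.LFunction 1)) := by
      have := ((DirichletCharacter.differentiable_LFunction hχ).continuous.comp
        Complex.continuous_ofReal).tendsto 1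
      simp only [Function.comp_apply, Complex.ofReal_one] at this
      exact this.mono_left nhdsWithin_le_nhds
    have c2 : Filter.Tendsto (fun s : ℝ => ∑ k ∈ Finset.Ioc 0 N, g k * (k : ℝ) ^ (-s))
        (nhdsWithin 1 (Set.Ioi 1)) (nhds (∑ k ∈ Finset.Ioc 0 N, g k / k)) := by
      refine Filter.Tendsto.mono_left ?_ nhdsWithin_le_nhds
      refine tendsto_finsetSum _ fun k hk => ?_
      have hk0 : (k : ℝ) ≠ 0 := by
        have := (Finset.mem_Ioc.1 hk).1
        positivity
      rw [div_eq_mul_inv, ← Real.rpow_neg_one]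
      exact Filter.Tendsto.const_mul _ ((Real.continuous_const_rpow hk0).tendsto (-1) |>.comp
        (continuous_neg.tendsto (1 : ℝ)))
    have c3 := (c1.sub ((Complex.continuous_ofReal.tendsto _).comp c2)).norm
    refine le_of_tendsto c3 ?_
    filter_upwards [self_mem_nhdsWithin] with s hs
    have hs : 1 < s := hs
    rw [DirichletCharacter.LFunction_eq_LSeries χ (by simpa using hs)]
    exact norm_LSeries_sub_sum_le χ hg hB hs hN
  have him : (χ.LFunction 1).im = 0 := by
    have h : ∀ N : ℕ, |(χ.LFunction 1).im| ≤ 4 * B / ((N : ℝ) + 1) := by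
      intro N
      have h1 := (Complex.abs_im_le_norm _).trans (key (N + 1) N.succ_pos)
      rwa [Complex.sub_im, Complex.ofReal_im, sub_zero, Nat.cast_succ] at h1
    have h2 : Filter.Tendsto (fun N : ℕ => 4 * B / ((N : ℝ) + 1)) Filter.atTop (nhds 0) := by
      simpa using (tendsto_one_div_add_atTop_nhds_zero_nat (𝕜 := ℝ)).const_mul (4 * B) |>.congr
        (fun N => by ring_nf)
    exact abs_nonpos_iff.1 (ge_of_tendsto' h2 h)
  have hre : (((χ.LFunction 1).re : ℝ) : ℂ) = χ.LFunction 1 := by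
    apply Complex.ext <;> simp [him]
  refine ⟨(χ.LFunction 1).re, ?_, fun N hN => ?_⟩
  · intro h0
    apply DirichletCharacter.LFunction_apply_one_ne_zero hχ
    rw [← hre, h0, Complex.ofReal_zero]
  · have := key N hN
    rwa [← hre, ← Complex.ofReal_sub, Complex.norm_real, Real.norm_eq_abs] at this

section Mertens
open ArithmeticFunction
open scoped ArithmeticFunction.zeta

lemma sum_Ioc_vonMangoldt_le (N : ℕ) : ∑ n ∈ Finset.Ioc 0 N, Λ n ≤ 6 * N := by
  have h := Chebyshev.psi_le_const_mul_self (Nat.cast_nonneg (α := ℝ) N)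
  rw [Chebyshev.psi, Nat.floor_natCast] at h
  have h4 : Real.log 4 ≤ 2 := by
    rw [show (4 : ℝ) = 2 ^ 2 by norm_num, Real.log_pow]
    have := Real.log_two_lt_d9
    push_cast; linarith
  refine h.trans (mul_le_mul_of_nonneg_right (by linarith) (Nat.cast_nonneg N))

lemma sum_Ioc_log_eq (N : ℕ) :
    ∑ n ∈ Finset.Ioc 0 N, Real.log n = ∑ d ∈ Finset.Ioc 0 N, Λ d * ((N / d : ℕ) : ℝ) := by
  have h := sum_divisors_eq_sum_sum (fun d _ => Λ d) N
  simp_rw [vonMangoldt_sum] at h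
  rw [h]
  refine Finset.sum_congr rfl fun d _ => ?_
  simp [mul_comm]

lemma sum_Ioc_log_eq_log_factorial (N : ℕ) :
    ∑ n ∈ Finset.Ioc 0 N, Real.log n = Real.log (N.factorial : ℝ) := by
  induction N with
  | zero => simp
  | succ N ih =>
    rw [← Finset.sum_Ioc_consecutive _ (Nat.zero_le N) N.le_succ, ih, Nat.factorial_succ,
      Nat.cast_mul, Real.log_mul (by positivity) (by positivity)]
    simp [add_comm]

lemma abs_sum_vonMangoldt_div_sub_log_le {N : ℕ} (hN : 0 < N) :
    |∑ n ∈ Finset.Ioc 0 N, Λ n / n - Real.log N| ≤ 6 := by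
  have hN' : (0 : ℝ) < N := by exact_mod_cast hN
  have up : (N : ℝ) * ∑ n ∈ Finset.Ioc 0 N, Λ n / n ≤ N * Real.log N + 6 * N := by
    have h1 : (N : ℝ) * ∑ n ∈ Finset.Ioc 0 N, Λ n / n ≤
        ∑ n ∈ Finset.Ioc 0 N, (Λ n * ((N / n : ℕ) : ℝ) + Λ n) := by
      rw [Finset.mul_sum]
      refine Finset.sum_le_sum fun n hn => ?_
      have hn0 : 0 < n := (Finset.mem_Ioc.1 hn).1
      have h2 : (N : ℝ) / n ≤ ((N / n : ℕ) : ℝ) + 1 := by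
        rw [div_le_iff₀ (by exact_mod_cast hn0)]
        exact_mod_cast (Nat.lt_mul_div_succ N hn0).le.trans (by rw [mul_comm])
      calc (N : ℝ) * (Λ n / n) = Λ n * (N / n) := by ring
        _ ≤ Λ n * (((N / n : ℕ) : ℝ) + 1) := mul_le_mul_of_nonneg_left h2 vonMangoldt_nonneg
        _ = _ := by ring
    rw [Finset.sum_add_distrib, ← sum_Ioc_log_eq, sum_Ioc_log_eq_log_factorial] at h1
    have h3 : Real.log (N.factorial : ℝ) ≤ N * Real.log N := by
      rw [← Real.log_pow]
      exact Real.log_le_log (by positivity) (by exact_mod_cast Nat.factorial_le_pow N)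
    linarith [sum_Ioc_vonMangoldt_le N]
  have lo : (N : ℝ) * Real.log N - N ≤ N * ∑ n ∈ Finset.Ioc 0 N, Λ n / n := by
    have h1 : ∑ n ∈ Finset.Ioc 0 N, Λ n * ((N / n : ℕ) : ℝ) ≤
        N * ∑ n ∈ Finset.Ioc 0 N, Λ n / n := by
      rw [Finset.mul_sum]
      refine Finset.sum_le_sum fun n _ => ?_
      calc Λ n * ((N / n : ℕ) : ℝ) ≤ Λ n * (N / n) :=
            mul_le_mul_of_nonneg_left Nat.cast_div_le vonMangoldt_nonneg
        _ = _ := by ring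
    rw [← sum_Ioc_log_eq, sum_Ioc_log_eq_log_factorial] at h1
    have h2 := Stirling.le_log_factorial_stirling hN.ne'
    have h3 : 0 ≤ Real.log N := Real.log_natCast_nonneg N
    have h4 : 0 ≤ Real.log (2 * Real.pi) := Real.log_nonneg (by linarith [Real.pi_gt_three])
    linarith
  rw [abs_le]
  constructor <;> nlinarith

lemma abs_sum_mul_log_div_le {g : ℕ → ℝ} (hg1 : ∀ n, |g n| ≤ 1) {B : ℝ}
    (hB : ∀ K, |∑ k ∈ Finset.Ioc 0 K, g k| ≤ B) (N : ℕ) :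
    |∑ n ∈ Finset.Ioc 0 N, g n * (Real.log n / n)| ≤ 3 + 4 * B := by
  have B0 : 0 ≤ B := (abs_nonneg _).trans (hB 0)
  have w1 : ∀ n : ℕ, 0 ≤ Real.log n / n := fun n =>
    div_nonneg (Real.log_natCast_nonneg n) (Nat.cast_nonneg n)
  have w2 : ∀ n : ℕ, Real.log n / n ≤ 1 := fun n =>
    div_le_one_of_le₀ (Real.log_le_self (Nat.cast_nonneg n)) (Nat.cast_nonneg n)
  have small : ∀ M ≤ 3, |∑ n ∈ Finset.Ioc 0 M, g n * (Real.log n / n)| ≤ 3 := by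
    intro M hM
    refine (Finset.abs_sum_le_sum_abs _ _).trans ?_
    calc ∑ n ∈ Finset.Ioc 0 M, |g n * (Real.log n / n)| ≤ ∑ n ∈ Finset.Ioc 0 M, (1 : ℝ) := by
          refine Finset.sum_le_sum fun n _ => ?_
          rw [abs_mul, abs_of_nonneg (w1 n)]
          exact mul_le_one₀ (hg1 n) (w1 n) (w2 n)
      _ = M := by simp
      _ ≤ 3 := by exact_mod_cast hM
  rcases le_total N 3 with h | h
  · linarith [small N h]
  · rw [← Finset.sum_Ioc_consecutive _ (Nat.zero_le 3) h]
    refine (abs_add_le _ _).trans (add_le_add (small 3 le_rfl) ?_)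
    simp_rw [mul_comm (g _)]
    refine (abs_sum_antitone_mul_le (w := fun k : ℕ => Real.log k / k) ?_ w1 hB h).trans ?_
    · intro a ha b hb hab
      have he := Real.exp_one_lt_d9
      have ha : (3 : ℝ) ≤ a := by exact_mod_cast ha
      have hb : (3 : ℝ) ≤ b := by exact_mod_cast hb
      exact Real.log_div_self_antitoneOn (Set.mem_Ici.2 (by linarith))
        (Set.mem_Ici.2 (by linarith)) (by exact_mod_cast hab)
    · nlinarith [w2 3]

lemma exists_abs_sum_vonMangoldt_mul_div_le {Q : ℕ} [NeZero Q] {χ : DirichletCharacter ℂ Q}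
    (hχ : χ ≠ 1) {g : ℕ → ℝ} (hg : ∀ n : ℕ, χ n = g n) {B : ℝ}
    (hB : ∀ K, |∑ k ∈ Finset.Ioc 0 K, g k| ≤ B) :
    ∃ C : ℝ, ∀ N, |∑ n ∈ Finset.Ioc 0 N, Λ n * g n / n| ≤ C := by
  have B0 : 0 ≤ B := (abs_nonneg _).trans (hB 0)
  obtain ⟨L, hL0, hL⟩ := exists_abs_sub_sum_div_le hχ hg hB
  have hg1 : ∀ n, |g n| ≤ 1 := fun n => by
    have := χ.norm_le_one (n : ZMod Q)
    rwa [hg, Complex.norm_real, Real.norm_eq_abs] at this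
  have hgm : ∀ m n, g (m * n) = g m * g n := fun m n => by
    have := map_mul χ (m : ZMod Q) n
    rw [← Nat.cast_mul, hg, hg, hg, ← Complex.ofReal_mul] at this
    exact Complex.ofReal_injective this
  refine ⟨(3 + 52 * B) / |L|, fun N => ?_⟩
  rw [le_div_iff₀ (abs_pos.2 hL0), ← abs_mul, Finset.sum_mul]
  rcases Nat.eq_zero_or_pos N with rfl | hN
  · simp; positivity
  have hN' : (0 : ℝ) < N := by exact_mod_cast hN
  have h1 := sum_Ioc_mul_apply_mul Λ (ζ : ArithmeticFunction ℝ) (fun n => g n / n) N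
  rw [vonMangoldt_mul_zeta] at h1
  have h2 : ∀ m ∈ Finset.Ioc 0 N, ∑ k ∈ Finset.Ioc 0 (N / m),
      Λ m * (ζ : ArithmeticFunction ℝ) k * (g (m * k) / ((m * k : ℕ) : ℝ)) =
      Λ m * g m / m * ∑ k ∈ Finset.Ioc 0 (N / m), g k / k := by
    intro m _
    rw [Finset.mul_sum]
    refine Finset.sum_congr rfl fun k hk => ?_
    have hk0 : k ≠ 0 := (Finset.mem_Ioc.1 hk).1.ne'
    rw [natCoe_apply, zeta_apply_ne hk0, hgm, Nat.cast_one, Nat.cast_mul]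
    ring
  rw [Finset.sum_congr rfl h2] at h1
  have h3 : ∑ n ∈ Finset.Ioc 0 N, Λ n * g n / n * L =
      ∑ n ∈ Finset.Ioc 0 N, g n * (Real.log n / n) +
      ∑ m ∈ Finset.Ioc 0 N, Λ m * g m / m * (L - ∑ k ∈ Finset.Ioc 0 (N / m), g k / k) := by
    have h4 : ∑ n ∈ Finset.Ioc 0 N, g n * (Real.log n / n) =
        ∑ n ∈ Finset.Ioc 0 N, (log : ArithmeticFunction ℝ) n * (g n / n) :=
      Finset.sum_congr rfl fun n _ => by rw [log_apply]; ring
    rw [h4, h1, ← Finset.sum_add_distrib]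
    exact Finset.sum_congr rfl fun n _ => by ring
  rw [h3]
  have h5 : |∑ m ∈ Finset.Ioc 0 N, Λ m * g m / m * (L - ∑ k ∈ Finset.Ioc 0 (N / m), g k / k)| ≤
      48 * B := by
    refine (Finset.abs_sum_le_sum_abs _ _).trans ?_
    calc _ ≤ ∑ m ∈ Finset.Ioc 0 N, Λ m * (8 * B / N) := by
          refine Finset.sum_le_sum fun m hm => ?_
          obtain ⟨hm0, hmN⟩ := Finset.mem_Ioc.1 hm
          have hm' : (0 : ℝ) < m := by exact_mod_cast hm0
          have hd : 0 < N / m := Nat.div_pos hmN hm0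
          have hd' : (0 : ℝ) < ((N / m : ℕ) : ℝ) := by exact_mod_cast hd
          have hK : (N : ℝ) ≤ 2 * (m * ((N / m : ℕ) : ℝ)) := by
            have e1 := Nat.lt_mul_div_succ N hm0
            have e2 : m * 1 ≤ m * (N / m) := Nat.mul_le_mul_left m hd
            rw [mul_add] at e1
            exact_mod_cast (show N ≤ 2 * (m * (N / m)) by omega)
          rw [abs_mul, abs_div, abs_mul, abs_of_nonneg (vonMangoldt_nonneg (n := m)),
            abs_of_pos hm']
          calc Λ m * |g m| / m * |L - ∑ k ∈ Finset.Ioc 0 (N / m), g k / k|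
              ≤ Λ m * 1 / m * (4 * B / ((N / m : ℕ) : ℝ)) := by
                have := vonMangoldt_nonneg (n := m)
                gcongr
                · exact hg1 m
                · exact hL _ hd
            _ = Λ m * (4 * B / (m * ((N / m : ℕ) : ℝ))) := by field_simp
            _ ≤ Λ m * (8 * B / N) := by
                refine mul_le_mul_of_nonneg_left ?_ vonMangoldt_nonneg
                rw [div_le_div_iff₀ (by positivity) hN']
                nlinarith
      _ ≤ 6 * N * (8 * B / N) := by
          rw [← Finset.sum_mul]
          exact mul_le_mul_of_nonneg_right (sum_Ioc_vonMangoldt_le N) (by positivity)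
      _ = 48 * B := by field_simp; ring
  refine (abs_add_le _ _).trans ?_
  linarith [abs_sum_mul_log_div_le hg1 hB N]

end Mertens

lemma exists_dyadic_sum_ge {a : ℕ → ℝ} (ha : ∀ n, 0 ≤ a n) {C : ℝ}
    (hC : ∀ N : ℕ, 0 < N → |∑ n ∈ Finset.Ioc 0 N, a n / n - Real.log N| ≤ C) :
    ∃ i₀ : ℕ, ∀ Y : ℕ, 0 < Y → ∃ j < i₀, ((2 ^ j * Y : ℕ) : ℝ) / 2 ≤
      ∑ n ∈ Finset.Ioc (2 ^ j * Y) (2 * (2 ^ j * Y)), a n := by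
  obtain ⟨i₀, hi₀⟩ := exists_nat_gt (20 * C)
  refine ⟨i₀, fun Y hY => ?_⟩
  by_contra! hcon
  have step : ∀ i ≤ i₀, ∑ n ∈ Finset.Ioc 0 (2 ^ i * Y), a n / n ≤
      ∑ n ∈ Finset.Ioc 0 Y, a n / n + i / 2 := by
    intro i
    induction i with
    | zero => intro _; simp
    | succ i ih =>
      intro hi
      have h1 := ih (by omega)
      have h2 := hcon i (by omega)
      have hp : 0 < 2 ^ i * Y := by positivity
      have hp' : (0 : ℝ) < ((2 ^ i * Y : ℕ) : ℝ) := by exact_mod_cast hp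
      rw [pow_succ, mul_comm (2 ^ i) 2, mul_assoc, ← Finset.sum_Ioc_consecutive _ (Nat.zero_le _)
        (Nat.le_mul_of_pos_left (2 ^ i * Y) two_pos)]
      have h3 : ∑ n ∈ Finset.Ioc (2 ^ i * Y) (2 * (2 ^ i * Y)), a n / n ≤ 1 / 2 := by
        calc _ ≤ ∑ n ∈ Finset.Ioc (2 ^ i * Y) (2 * (2 ^ i * Y)), a n / ((2 ^ i * Y : ℕ) : ℝ) := by
              refine Finset.sum_le_sum fun n hn => ?_
              exact div_le_div_of_nonneg_left (ha n) hp'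
                (by exact_mod_cast (Finset.mem_Ioc.1 hn).1.le)
          _ ≤ 1 / 2 := by
              rw [← Finset.sum_div, div_le_iff₀ hp']
              linarith
      push_cast
      linarith
  have h1 := step i₀ le_rfl
  have h2 := abs_le.1 (hC Y hY)
  have h3 := abs_le.1 (hC (2 ^ i₀ * Y) (by positivity))
  have hY' : (Y : ℝ) ≠ 0 := by positivity
  rw [Nat.cast_mul, Real.log_mul (by positivity) hY', Nat.cast_pow, Real.log_pow] at h3
  have h4 := Real.log_two_gt_d9
  have h5 : (0 : ℝ) ≤ i₀ := Nat.cast_nonneg _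
  push_cast at h3
  nlinarith

section QuadraticCharacter
open ArithmeticFunction

/-- The Jacobi symbol `(p / n)` on odd `n`, extended by zero to even `n`. -/
noncomputable def oddJacobi (p n : ℕ) : ℤ := if Odd n then jacobiSym p n else 0

lemma oddJacobi_mod (p n : ℕ) : oddJacobi p (n % (4 * p)) = oddJacobi p n := by
  have h : Odd (n % (4 * p)) ↔ Odd n := by
    rw [Nat.odd_iff, Nat.odd_iff, Nat.mod_mod_of_dvd n ⟨2 * p, by ring⟩]
  unfold oddJacobi
  simp only [h]
  split_ifs with hn
  · have := jacobiSym.mod_right (p : ℤ) hn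
    rw [Int.natAbs_natCast] at this
    exact this.symm
  · rfl

lemma oddJacobi_mul (p m n : ℕ) : oddJacobi p (m * n) = oddJacobi p m * oddJacobi p n := by
  unfold oddJacobi
  by_cases hm : Odd m
  · by_cases hn : Odd n
    · have : NeZero m := ⟨by rintro rfl; simp at hm⟩
      have : NeZero n := ⟨by rintro rfl; simp at hn⟩
      rw [if_pos (hm.mul hn), if_pos hm, if_pos hn, jacobiSym.mul_right]
    · rw [if_neg (fun h => hn (Nat.odd_mul.1 h).2), if_neg hn, mul_zero]
  · rw [if_neg (fun h => hm (Nat.odd_mul.1 h).1), if_neg hm, zero_mul]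

lemma oddJacobi_one (p : ℕ) : oddJacobi p 1 = 1 := by simp [oddJacobi]

lemma oddJacobi_eq_zero {p n : ℕ} (h : ¬ Nat.Coprime n (4 * p)) : oddJacobi p n = 0 := by
  unfold oddJacobi
  split_ifs with hn
  · have : NeZero n := ⟨by rintro rfl; simp at hn⟩
    rw [jacobiSym.eq_zero_iff_not_coprime]
    intro h1
    rw [Int.gcd_natCast_natCast] at h1
    refine h (Nat.Coprime.mul_right ?_ (Nat.Coprime.symm h1))
    rw [show 4 = 2 ^ 2 by norm_num]
    exact Nat.Coprime.pow_right 2 hn.coprime_two_right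
  · rfl

lemma abs_oddJacobi_le (p n : ℕ) : |oddJacobi p n| ≤ 1 := by
  unfold oddJacobi
  split_ifs
  · rcases jacobiSym.trichotomy p n with h | h | h <;> simp [h]
  · simp

lemma exists_oddJacobi_eq_neg_one {p : ℕ} (hp : p.Prime) : ∃ n, oddJacobi p n = -1 := by
  rcases hp.eq_two_or_odd' with rfl | hodd
  · refine ⟨3, ?_⟩
    rw [oddJacobi, if_pos (by decide)]
    norm_num
  · have : Fact p.Prime := ⟨hp⟩
    have h2 : ringChar (ZMod p) ≠ 2 := by
      rw [ZMod.ringChar_zmod_n]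
      rintro rfl
      exact absurd hodd (by decide)
    obtain ⟨a, ha⟩ := FiniteField.exists_nonsquare h2
    have hco : Nat.Coprime 4 p := by
      rw [show 4 = 2 ^ 2 by norm_num]
      exact Nat.Coprime.pow_left 2 hodd.coprime_two_left
    obtain ⟨n, hn4, hnp⟩ := Nat.chineseRemainder hco 1 a.val
    have hn1 : n % 4 = 1 := hn4
    have hnodd : Odd n := Nat.odd_iff.2 (by omega)
    refine ⟨n, ?_⟩
    rw [oddJacobi, if_pos hnodd, ← jacobiSym.quadratic_reciprocity_one_mod_four hn1 hodd,
      ← jacobiSym.legendreSym.to_jacobiSym, legendreSym.eq_neg_one_iff]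
    have : ((n : ℕ) : ZMod p) = a := by
      rw [(ZMod.natCast_eq_natCast_iff n a.val p).2 hnp, ZMod.natCast_zmod_val]
    rwa [Int.cast_natCast, this]

/-- The quadratic Dirichlet character modulo `4 * p` attached to `oddJacobi p`. -/
noncomputable def jacobiCharacter (p : ℕ) [NeZero p] : DirichletCharacter ℂ (4 * p) where
  toFun a := (oddJacobi p a.val : ℂ)
  map_one' := by
    have := oddJacobi_mod p 1
    rw [ZMod.val_one_eq_one_mod, this, oddJacobi_one, Int.cast_one]
  map_mul' a b := by
    rw [ZMod.val_mul, oddJacobi_mod, oddJacobi_mul, Int.cast_mul]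
  map_nonunit' a ha := by
    rw [oddJacobi_eq_zero, Int.cast_zero]
    intro h
    apply ha
    rw [← ZMod.natCast_zmod_val a]
    exact (ZMod.isUnit_iff_coprime _ _).2 h

lemma jacobiCharacter_natCast (p : ℕ) [NeZero p] (n : ℕ) :
    jacobiCharacter p n = ((oddJacobi p n : ℝ) : ℂ) := by
  change ((oddJacobi p (n : ZMod (4 * p)).val : ℤ) : ℂ) = _
  rw [ZMod.val_natCast, oddJacobi_mod]
  simp

lemma jacobiCharacter_ne_one {p : ℕ} [NeZero p] (hp : p.Prime) : jacobiCharacter p ≠ 1 := by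
  intro h
  obtain ⟨n, hn⟩ := exists_oddJacobi_eq_neg_one hp
  have h1 := jacobiCharacter_natCast p n
  rw [h, hn] at h1
  by_cases hu : IsUnit (n : ZMod (4 * p))
  · rw [MulChar.one_apply hu] at h1
    norm_num at h1
  · rw [MulChar.map_nonunit _ hu] at h1
    norm_num at h1

lemma isBoundedPeriodicMul_oddJacobi {p : ℕ} (hp : p.Prime) :
    IsBoundedPeriodicMul (fun n => (oddJacobi p n : ℝ)) (4 * p) where
  pos := by have := hp.pos; omega
  map_mul m n := by rw [oddJacobi_mul, Int.cast_mul]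
  abs_le_one n := by exact_mod_cast abs_oddJacobi_le p n
  periodic n := by
    dsimp only
    rw [← oddJacobi_mod p (n + 4 * p), Nat.add_mod_right, oddJacobi_mod]

lemma isBoundedPeriodicMul_one : IsBoundedPeriodicMul (fun _ => 1) 1 where
  pos := one_pos
  map_mul m n := by simp
  abs_le_one n := by simp
  periodic n := rfl

lemma abs_sum_oddJacobi_le {p : ℕ} (hp : p.Prime) (K : ℕ) :
    |∑ k ∈ Finset.Ioc 0 K, (oddJacobi p k : ℝ)| ≤ 4 * p := by
  have : NeZero p := ⟨hp.ne_zero⟩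
  have hg := isBoundedPeriodicMul_oddJacobi hp
  have h0 : ∑ k ∈ Finset.range (4 * p), (oddJacobi p k : ℝ) = 0 := by
    have h1 := MulChar.sum_eq_zero_of_ne_one (jacobiCharacter_ne_one hp)
    have h2 := sum_range_zmod (ℓ := 4 * p) (fun a => (oddJacobi p a.val : ℝ))
    simp only [ZMod.val_natCast, oddJacobi_mod] at h2
    rw [h2]
    have h3 : ((∑ a : ZMod (4 * p), (oddJacobi p a.val : ℝ) : ℝ) : ℂ) = 0 := by
      rw [← h1, Complex.ofReal_sum]
      exact Finset.sum_congr rfl fun a _ => by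
        rw [Complex.ofReal_intCast]; rfl
    exact_mod_cast h3
  have hB : ∑ k ∈ Finset.range (4 * p), |(oddJacobi p k : ℝ)| ≤ 4 * p :=
    (Finset.sum_le_sum fun k _ => hg.abs_le_one k).trans (by simp)
  have h := abs_sum_range_periodic_le hg.pos hg.periodic h0 hB (K + 1)
  have hz : oddJacobi p 0 = 0 := by simp [oddJacobi]
  rwa [Finset.sum_range_succ', hz, Int.cast_zero, add_zero,
    show ∑ k ∈ Finset.range K, (oddJacobi p (k + 1) : ℝ) =
      ∑ k ∈ Finset.Ioc 0 K, (oddJacobi p k : ℝ) by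
      rw [← Finset.Ico_add_one_add_one_eq_Ioc, Finset.sum_Ico_eq_sum_range]
      simp [add_comm]] at h

/-- In one of boundedly many consecutive dyadic intervals, `Λ` puts mass `≫ 1` on the integers
`n` with `(p / n) ≠ 1`. -/
lemma exists_dyadic_sum_vonMangoldt_ge {p : ℕ} (hp : p.Prime) :
    ∃ i₀ : ℕ, ∀ Y : ℕ, 0 < Y → ∃ j < i₀, ((2 ^ j * Y : ℕ) : ℝ) / 2 ≤
      ∑ n ∈ Finset.Ioc (2 ^ j * Y) (2 * (2 ^ j * Y)), Λ n * (1 - (oddJacobi p n : ℝ)) := by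
  have : NeZero p := ⟨hp.ne_zero⟩
  obtain ⟨C, hC⟩ := exists_abs_sum_vonMangoldt_mul_div_le (jacobiCharacter_ne_one hp)
    (jacobiCharacter_natCast p) (abs_sum_oddJacobi_le hp)
  refine exists_dyadic_sum_ge (C := 6 + C) (fun n => ?_) fun N hN => ?_
  · have := (abs_le.1 ((isBoundedPeriodicMul_oddJacobi hp).abs_le_one n)).2
    exact mul_nonneg vonMangoldt_nonneg (by linarith)
  · have h1 := abs_sum_vonMangoldt_div_sub_log_le hN
    have h2 : ∑ n ∈ Finset.Ioc 0 N, Λ n * (1 - (oddJacobi p n : ℝ)) / n - Real.log N =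
        (∑ n ∈ Finset.Ioc 0 N, Λ n / n - Real.log N) -
          ∑ n ∈ Finset.Ioc 0 N, Λ n * (oddJacobi p n : ℝ) / n := by
      rw [sub_right_comm, ← Finset.sum_sub_distrib]
      congr 1
      exact Finset.sum_congr rfl fun n _ => by ring
    rw [h2]
    exact (abs_sub _ _).trans (add_le_add h1 (hC N))

lemma pow_half_eq_neg_one {p r : ℕ} (hr : r.Prime) (h : oddJacobi p r = -1) :
    (p : ZMod r) ^ ((r - 1) / 2) = -1 := by
  have : Fact r.Prime := ⟨hr⟩
  unfold oddJacobi at h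
  split_ifs at h with hodd
  have h1 := legendreSym.eq_pow r p
  rw [jacobiSym.legendreSym.to_jacobiSym, h] at h1
  push_cast at h1
  rw [h1]
  congr 1
  have := Nat.odd_iff.1 hodd
  omega

end QuadraticCharacter

section Selberg
open BoundingSieve

/-- The sum of the Selberg terms up to `R`. -/
noncomputable def selbergSum (s : BoundingSieve) (R : ℕ) : ℝ :=
  ∑ l ∈ s.prodPrimes.divisors.filter (· ≤ R), s.selbergTerms l

/-- The optimal weights in Selberg's sieve of level `R`. -/
noncomputable def selbergWeight (s : BoundingSieve) (R d : ℕ) : ℝ :=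
  (ArithmeticFunction.moebius d : ℝ) * (s.nu d)⁻¹ *
    (∑ l ∈ s.prodPrimes.divisors.filter (fun l => d ∣ l ∧ l ≤ R), s.selbergTerms l) /
      selbergSum s R

variable {s : BoundingSieve} {R : ℕ}

lemma one_le_selbergSum (hR : 1 ≤ R) : 1 ≤ selbergSum s R := by
  have h1 : (1 : ℕ) ∈ s.prodPrimes.divisors.filter (· ≤ R) := by
    simp [hR, prodPrimes_ne_zero]
  have h2 : s.selbergTerms 1 = 1 := selbergTerms_isMultiplicative.map_one
  rw [← h2]
  refine Finset.single_le_sum (f := fun l => s.selbergTerms l) (fun l hl => ?_) h1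
  exact (selbergTerms_pos (Nat.dvd_of_mem_divisors (Finset.mem_filter.1 hl).1)).le

lemma selbergWeight_one (hR : 1 ≤ R) : selbergWeight s R 1 = 1 := by
  have h := one_le_selbergSum (s := s) hR
  have h2 : s.nu 1 = 1 := s.nu_mult.map_one
  unfold selbergWeight
  simp only [one_dvd, true_and, h2, ArithmeticFunction.moebius_apply_one]
  rw [show ∑ l ∈ s.prodPrimes.divisors.filter (· ≤ R), s.selbergTerms l = selbergSum s R from rfl]
  have : selbergSum s R ≠ 0 := by linarith
  simp [this]

lemma selbergWeight_eq_zero {d : ℕ} (hd : R < d) : selbergWeight s R d = 0 := by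
  unfold selbergWeight
  rw [Finset.filter_false_of_mem]
  · simp
  · rintro l hl ⟨h1, h2⟩
    have := Nat.le_of_dvd (Nat.pos_of_mem_divisors hl) h1
    omega

lemma sum_nu_mul_selbergWeight {l : ℕ} (hl : l ∣ s.prodPrimes) :
    ∑ d ∈ s.prodPrimes.divisors, (if l ∣ d then s.nu d * selbergWeight s R d else 0) =
      if l ≤ R then (ArithmeticFunction.moebius l : ℝ) * s.selbergTerms l / selbergSum s R
        else 0 := by
  have hP0 := prodPrimes_ne_zero (s := s)
  have e1 : ∀ d ∈ s.prodPrimes.divisors,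
      (if l ∣ d then s.nu d * selbergWeight s R d else 0) =
      ∑ m ∈ s.prodPrimes.divisors.filter (· ≤ R),
        (s.selbergTerms m / selbergSum s R) *
          (if l ∣ d ∧ d ∣ m then (ArithmeticFunction.moebius d : ℝ) else 0) := by
    intro d hd
    have hnu := nu_ne_zero (Nat.dvd_of_mem_divisors hd)
    by_cases h : l ∣ d
    · rw [if_pos h]
      unfold selbergWeight
      simp only [h, true_and]
      rw [Finset.sum_congr rfl (fun m _ => mul_ite _ _ _ _)]
      simp only [mul_zero]
      rw [← Finset.sum_filter, Finset.filter_filter, ← Finset.sum_mul, ← Finset.sum_div]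
      simp_rw [and_comm (a := _ ≤ R)]
      field_simp
    · simp [h]
  have inner : ∀ m ∈ s.prodPrimes.divisors.filter (· ≤ R),
      ∑ d ∈ s.prodPrimes.divisors,
        (if l ∣ d ∧ d ∣ m then (ArithmeticFunction.moebius d : ℝ) else 0) =
        if m = l then (ArithmeticFunction.moebius l : ℝ) else 0 := by
    intro m hm
    obtain ⟨hm, -⟩ := Finset.mem_filter.1 hm
    have hmP := Nat.dvd_of_mem_divisors hm
    have hmsq := squarefree_of_dvd_prodPrimes hmP
    have hm0 := hmsq.ne_zero
    by_cases hlm : l ∣ m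
    · obtain ⟨k, rfl⟩ := hlm
      have hl0 : l ≠ 0 := fun h => hm0 (by simp [h])
      have hk0 : k ≠ 0 := fun h => hm0 (by simp [h])
      have hcop : ∀ e ∈ k.divisors, Nat.Coprime l e := fun e he =>
        (Nat.coprime_of_squarefree_mul hmsq).coprime_dvd_right (Nat.dvd_of_mem_divisors he)
      rw [← Finset.sum_filter]
      have : s.prodPrimes.divisors.filter (fun d => l ∣ d ∧ d ∣ l * k) =
          k.divisors.image (l * ·) := by
        ext d
        simp only [Finset.mem_filter, Nat.mem_divisors, Finset.mem_image]
        constructor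
        · rintro ⟨-, ⟨e, rfl⟩, h⟩
          exact ⟨e, ⟨Nat.dvd_of_mul_dvd_mul_left (Nat.pos_of_ne_zero hl0) h, hk0⟩, rfl⟩
        · rintro ⟨e, ⟨he, -⟩, rfl⟩
          exact ⟨⟨(mul_dvd_mul_left l he).trans hmP, hP0⟩, dvd_mul_right _ _,
            mul_dvd_mul_left l he⟩
      rw [this, Finset.sum_image (fun a _ b _ h => Nat.eq_of_mul_eq_mul_left
        (Nat.pos_of_ne_zero hl0) h)]
      rw [Finset.sum_congr rfl (g := fun e => (ArithmeticFunction.moebius l : ℝ) *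
        (ArithmeticFunction.moebius e : ℝ)) (fun e he => by
          rw [ArithmeticFunction.isMultiplicative_moebius.map_mul_of_coprime (hcop e he)]
          push_cast; rfl), ← Finset.mul_sum]
      have h1 : ∑ e ∈ k.divisors, ArithmeticFunction.moebius e = if k = 1 then 1 else 0 := by
        rw [← ArithmeticFunction.coe_mul_zeta_apply, ArithmeticFunction.moebius_mul_coe_zeta,
          ArithmeticFunction.one_apply]
      have h2 : ∑ e ∈ k.divisors, (ArithmeticFunction.moebius e : ℝ) = if k = 1 then 1 else 0 := by
        exact_mod_cast h1
      rw [h2]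
      by_cases hk1 : k = 1
      · simp [hk1]
      · have : l * k ≠ l := fun h => hk1 (by
          have := Nat.eq_of_mul_eq_mul_left (Nat.pos_of_ne_zero hl0) (h.trans (mul_one l).symm)
          exact this)
        simp [hk1, this]
    · rw [if_neg (fun h => hlm h.symm.dvd), Finset.sum_eq_zero]
      intro d _
      exact if_neg fun h => hlm (h.1.trans h.2)
  rw [Finset.sum_congr rfl e1, Finset.sum_comm]
  simp_rw [← Finset.mul_sum]
  rw [Finset.sum_congr rfl fun m hm => by rw [inner m hm]]
  simp_rw [mul_ite, mul_zero]
  rw [Finset.sum_ite_eq']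
  simp only [Finset.mem_filter, Nat.mem_divisors, hl, hP0, ne_eq, not_false_eq_true, and_self,
    true_and]
  split_ifs
  · ring
  · rfl

lemma mainSum_selbergWeight (hR : 1 ≤ R) :
    s.mainSum (lambdaSquared (selbergWeight s R)) = (selbergSum s R)⁻¹ := by
  have hS : selbergSum s R ≠ 0 := by linarith [one_le_selbergSum (s := s) hR]
  rw [mainSum_lambdaSquared_eq_sum_mul_sum_sq]
  rw [Finset.sum_congr rfl fun l hl => by
    rw [sum_nu_mul_selbergWeight (Nat.dvd_of_mem_divisors hl)]]
  have e : ∀ l ∈ s.prodPrimes.divisors, (s.selbergTerms l)⁻¹ *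
      (if l ≤ R then (ArithmeticFunction.moebius l : ℝ) * s.selbergTerms l / selbergSum s R
        else 0) ^ 2 = if l ≤ R then s.selbergTerms l / selbergSum s R ^ 2 else 0 := by
    intro l hl
    have hlP := Nat.dvd_of_mem_divisors hl
    have h0 := (selbergTerms_pos hlP).ne'
    have hmu : (ArithmeticFunction.moebius l : ℝ) ^ 2 = 1 := by
      exact_mod_cast ArithmeticFunction.moebius_sq_eq_one_of_squarefree
        (squarefree_of_dvd_prodPrimes hlP)
    split_ifs
    · rw [div_pow, mul_pow, hmu]
      field_simp
    · simp
  rw [Finset.sum_congr rfl e, ← Finset.sum_filter, ← Finset.sum_div,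
    show ∑ l ∈ s.prodPrimes.divisors.filter (· ≤ R), s.selbergTerms l = selbergSum s R from rfl]
  field_simp

lemma abs_selbergWeight_le (hR : 1 ≤ R)
    (hs : ∀ d, d ∣ s.prodPrimes → s.selbergTerms d ≤ d * s.nu d) {d : ℕ}
    (hd : d ∣ s.prodPrimes) : |selbergWeight s R d| ≤ R := by
  rcases lt_or_ge R d with hRd | hdR
  · rw [selbergWeight_eq_zero hRd]; simp
  have hS := one_le_selbergSum (s := s) hR
  have hnu := nu_pos_of_dvd_prodPrimes hd
  have hdpos : 0 < d := Nat.pos_of_dvd_of_pos hd (Nat.pos_of_ne_zero prodPrimes_ne_zero)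
  have h1 : ∑ l ∈ s.prodPrimes.divisors.filter (fun l => d ∣ l ∧ l ≤ R), s.selbergTerms l ≤
      s.selbergTerms d * selbergSum s R := by
    unfold selbergSum
    rw [Finset.mul_sum]
    have himg : s.prodPrimes.divisors.filter (fun l => d ∣ l ∧ l ≤ R) ⊆
        ((s.prodPrimes.divisors.filter (· ≤ R)).filter (fun e => d * e ∣ s.prodPrimes)).image
          (d * ·) := by
      intro l hl
      simp only [Finset.mem_filter, Nat.mem_divisors, Finset.mem_image] at hl ⊢
      obtain ⟨⟨hlP, hP0⟩, ⟨e, rfl⟩, hle⟩ := hl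
      exact ⟨e, ⟨⟨⟨(dvd_mul_left e d).trans hlP, hP0⟩,
        (Nat.le_mul_of_pos_left e hdpos).trans hle⟩, hlP⟩, rfl⟩
    have hnn : ∀ e, d * e ∣ s.prodPrimes → s.selbergTerms (d * e) =
        s.selbergTerms d * s.selbergTerms e := fun e he =>
      selbergTerms_isMultiplicative.map_mul_of_coprime
        (Nat.coprime_of_squarefree_mul (squarefree_of_dvd_prodPrimes he))
    refine (Finset.sum_le_sum_of_subset_of_nonneg himg fun l hl _ => ?_).trans ?_
    · obtain ⟨e, he, rfl⟩ := Finset.mem_image.1 hl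
      exact (selbergTerms_pos (Finset.mem_filter.1 he).2).le
    · rw [Finset.sum_image (fun a _ b _ h => Nat.eq_of_mul_eq_mul_left hdpos h)]
      rw [Finset.sum_congr rfl fun e he => hnn e (Finset.mem_filter.1 he).2]
      refine Finset.sum_le_sum_of_subset_of_nonneg (Finset.filter_subset _ _) fun e he _ => ?_
      exact mul_nonneg (selbergTerms_pos hd).le
        (selbergTerms_pos (Nat.dvd_of_mem_divisors (Finset.mem_filter.1 he).1)).le
  have h2 : 0 ≤ ∑ l ∈ s.prodPrimes.divisors.filter (fun l => d ∣ l ∧ l ≤ R), s.selbergTerms l :=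
    Finset.sum_nonneg fun l hl =>
      (selbergTerms_pos (Nat.dvd_of_mem_divisors (Finset.mem_filter.1 hl).1)).le
  have hmu : |(ArithmeticFunction.moebius d : ℝ)| ≤ 1 := abs_moebius_real_le_one d
  unfold selbergWeight
  rw [abs_div, abs_mul, abs_mul, abs_of_pos (by linarith : 0 < selbergSum s R), abs_of_nonneg h2,
    abs_of_pos (inv_pos.2 hnu), div_le_iff₀ (by linarith)]
  calc _ ≤ 1 * (s.nu d)⁻¹ * (d * s.nu d * selbergSum s R) := by
        gcongr
        exact h1.trans (mul_le_mul_of_nonneg_right (hs d hd) (by linarith))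
    _ = d * selbergSum s R := by field_simp
    _ ≤ R * selbergSum s R := by
        gcongr

theorem siftedSum_le_of_abs_rem_le (hR : 1 ≤ R)
    (hs : ∀ d, d ∣ s.prodPrimes → s.selbergTerms d ≤ d * s.nu d)
    (hrem : ∀ d, d ∣ s.prodPrimes → |s.rem d| ≤ d) :
    s.siftedSum ≤ s.totalMass / selbergSum s R + (R : ℝ) ^ 10 := by
  have h := siftedSum_le_mainSum_errSum_of_upperMoebius (s := s) _
    (upperMoebius_lambdaSquared _ (selbergWeight_one (s := s) hR))
  rw [mainSum_selbergWeight hR, ← div_eq_mul_inv] at h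
  refine h.trans (add_le_add_right ?_ _)
  unfold errSum
  have hR0 : (0 : ℝ) ≤ R := Nat.cast_nonneg _
  have e : ∀ d ∈ s.prodPrimes.divisors,
      |lambdaSquared (selbergWeight s R) d| * |s.rem d| ≤
        if d ∈ Finset.Ioc 0 (R ^ 2) then (R : ℝ) ^ 8 else 0 := by
    intro d hd
    have hdP := Nat.dvd_of_mem_divisors hd
    have hd0 := Nat.pos_of_mem_divisors hd
    by_cases hdR : d ≤ R ^ 2
    · rw [if_pos (Finset.mem_Ioc.2 ⟨hd0, hdR⟩)]
      have hdR' : (d : ℝ) ≤ (R : ℝ) ^ 2 := by exact_mod_cast hdR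
      have hw : ∀ e ∈ d.divisors, |selbergWeight s R e| ≤ R := fun e he =>
        abs_selbergWeight_le hR hs ((Nat.dvd_of_mem_divisors he).trans hdP)
      have hcard : (d.divisors.card : ℝ) ≤ d := by exact_mod_cast Nat.card_divisors_le_self d
      have h1 : |lambdaSquared (selbergWeight s R) d| ≤ d * (d * ((R : ℝ) * R)) := by
        unfold lambdaSquared
        refine (Finset.abs_sum_le_sum_abs _ _).trans ?_
        have h2 : ∀ d1 ∈ d.divisors, |∑ d2 ∈ d.divisors, if d = Nat.lcm d1 d2 then
            selbergWeight s R d1 * selbergWeight s R d2 else 0| ≤ d * ((R : ℝ) * R) := by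
          intro d1 hd1
          refine (Finset.abs_sum_le_sum_abs _ _).trans ?_
          refine (Finset.sum_le_card_nsmul _ _ ((R : ℝ) * R) fun d2 hd2 => ?_).trans ?_
          · split_ifs
            · rw [abs_mul]
              exact mul_le_mul (hw _ hd1) (hw _ hd2) (abs_nonneg _) hR0
            · simp; positivity
          · rw [nsmul_eq_mul]
            exact mul_le_mul_of_nonneg_right hcard (by positivity)
        refine (Finset.sum_le_card_nsmul _ _ _ h2).trans ?_
        rw [nsmul_eq_mul]
        exact mul_le_mul_of_nonneg_right hcard (by positivity)
      calc _ ≤ d * (d * ((R : ℝ) * R)) * d :=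
            mul_le_mul h1 (hrem d hdP) (abs_nonneg _) (by positivity)
        _ ≤ (R : ℝ) ^ 2 * ((R : ℝ) ^ 2 * ((R : ℝ) * R)) * (R : ℝ) ^ 2 := by gcongr
        _ = (R : ℝ) ^ 8 := by ring
    · rw [if_neg (fun h => hdR (Finset.mem_Ioc.1 h).2)]
      have : lambdaSquared (selbergWeight s R) d = 0 := by
        unfold lambdaSquared
        refine Finset.sum_eq_zero fun d1 _ => Finset.sum_eq_zero fun d2 _ => ?_
        split_ifs with hl
        · rcases lt_or_ge R d1 with h1 | h1
          · rw [selbergWeight_eq_zero h1, zero_mul]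
          rcases lt_or_ge R d2 with h2 | h2
          · rw [selbergWeight_eq_zero h2, mul_zero]
          exfalso
          apply hdR
          rw [hl, sq]
          exact (Nat.div_le_self _ _).trans (Nat.mul_le_mul h1 h2)
        · rfl
      rw [this]; simp
  refine (Finset.sum_le_sum e).trans ?_
  rw [← Finset.sum_filter, Finset.sum_const, nsmul_eq_mul]
  have : ((s.prodPrimes.divisors.filter (fun d => d ∈ Finset.Ioc 0 (R ^ 2))).card : ℝ) ≤
      (R : ℝ) ^ 2 := by
    have h1 : s.prodPrimes.divisors.filter (fun d => d ∈ Finset.Ioc 0 (R ^ 2)) ⊆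
        Finset.Ioc 0 (R ^ 2) := fun d hd => (Finset.mem_filter.1 hd).2
    have h2 := Finset.card_le_card h1
    rw [Nat.card_Ioc, Nat.sub_zero] at h2
    exact_mod_cast h2
  calc _ ≤ (R : ℝ) ^ 2 * (R : ℝ) ^ 8 := mul_le_mul_of_nonneg_right this (by positivity)
    _ = _ := by ring

end Selberg

section LinearPair
open BoundingSieve

/-- The indicator function of the positive integers coprime to `a`. -/
noncomputable def coprimeIndicator (a : ℕ) : ArithmeticFunction ℝ :=
  ⟨fun v => if v ≠ 0 ∧ Nat.Coprime v a then 1 else 0, by simp⟩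

lemma coprimeIndicator_apply (a v : ℕ) :
    coprimeIndicator a v = if v ≠ 0 ∧ Nat.Coprime v a then 1 else 0 := rfl

lemma isMultiplicative_coprimeIndicator (a : ℕ) : (coprimeIndicator a).IsMultiplicative := by
  rw [ArithmeticFunction.IsMultiplicative.iff_ne_zero]
  refine ⟨by simp [coprimeIndicator_apply], fun {m n} hm hn _ => ?_⟩
  simp only [coprimeIndicator_apply, ne_eq, mul_eq_zero, hm, hn, or_self, not_false_eq_true,
    true_and, Nat.coprime_mul_iff_left]
  split_ifs <;> simp_all

/-- The number of solutions of `m * (a * m + 1) ≡ 0` modulo a squarefree number. -/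
noncomputable def pairRootCount (a : ℕ) : ArithmeticFunction ℝ :=
  (ArithmeticFunction.zeta : ArithmeticFunction ℝ) * coprimeIndicator a

lemma pairRootCount_apply (a d : ℕ) :
    pairRootCount a d = ((d.divisors.filter (fun v => Nat.Coprime v a)).card : ℝ) := by
  rw [pairRootCount, ArithmeticFunction.coe_zeta_mul_apply, Finset.card_filter, Nat.cast_sum]
  refine Finset.sum_congr rfl fun v hv => ?_
  have := (Nat.pos_of_mem_divisors hv).ne'
  simp [coprimeIndicator_apply, this]

lemma pairRootCount_le (a d : ℕ) : pairRootCount a d ≤ d := by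
  rw [pairRootCount_apply]
  exact_mod_cast (Finset.card_filter_le _ _).trans (Nat.card_divisors_le_self d)

lemma pairRootCount_prime {a q : ℕ} (hq : q.Prime) :
    pairRootCount a q = if q ∣ a then 1 else 2 := by
  rw [pairRootCount_apply, hq.divisors]
  have h1 : Nat.Coprime 1 a := Nat.coprime_one_left a
  split_ifs with h
  · have h2 : ¬ Nat.Coprime q a := fun hc => (hq.coprime_iff_not_dvd.1 hc) h
    rw [Finset.filter_insert, if_pos h1, Finset.filter_singleton, if_neg h2]
    simp
  · have h2 : Nat.Coprime q a := hq.coprime_iff_not_dvd.2 h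
    rw [Finset.filter_insert, if_pos h1, Finset.filter_singleton, if_pos h2]
    rw [Finset.card_pair hq.one_lt.ne]
    norm_num

lemma abs_card_modEq_sub_le (X c : ℕ) {d : ℕ} (hd : 0 < d) :
    |(((Finset.Ioc 0 X).filter (fun m => m ≡ c [MOD d])).card : ℝ) - X / d| ≤ 1 := by
  have h := Nat.Ioc_filter_modEq_card 0 X hd c
  set N := ((Finset.Ioc 0 X).filter (fun m => m ≡ c [MOD d])).card
  have hd' : (0 : ℚ) < d := by exact_mod_cast hd
  have h1 := Int.floor_le (((X : ℚ) - c) / d)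
  have h2 := Int.lt_floor_add_one (((X : ℚ) - c) / d)
  have h3 := Int.floor_le ((((0 : ℕ) : ℚ) - c) / d)
  have h4 := Int.lt_floor_add_one ((((0 : ℕ) : ℚ) - c) / d)
  have hmono : ⌊(((0 : ℕ) : ℚ) - c) / d⌋ ≤ ⌊((X : ℚ) - c) / d⌋ := by
    apply Int.floor_le_floor
    gcongr
    exact X.zero_le
  rw [max_eq_left (by omega)] at h
  have hq : (N : ℚ) = (⌊((X : ℚ) - c) / d⌋ : ℚ) - (⌊(((0 : ℕ) : ℚ) - c) / d⌋ : ℚ) := by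
    exact_mod_cast h
  have e : ((X : ℚ) - c) / d - (((0 : ℕ) : ℚ) - c) / d = X / d := by
    push_cast; ring
  have key : |(N : ℚ) - X / d| ≤ 1 := by
    rw [hq, abs_le]
    constructor <;> linarith
  have : ((|(N : ℚ) - X / d| : ℚ) : ℝ) ≤ ((1 : ℚ) : ℝ) := by exact_mod_cast key
  push_cast at this
  exact this

lemma exists_modEq_iff {a u v : ℕ} (huv : Nat.Coprime u v) (hva : Nat.Coprime v a) (hv : 0 < v) :
    ∃ c, ∀ m, (u ∣ m ∧ v ∣ a * m + 1) ↔ m ≡ c [MOD u * v] := by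
  have : NeZero v := ⟨hv.ne'⟩
  set t : ZMod v := -(ZMod.unitOfCoprime a hva.symm)⁻¹ with ht
  have hat : (a : ZMod v) * t = -1 := by
    have := Units.mul_inv (ZMod.unitOfCoprime a hva.symm)
    rw [ZMod.coe_unitOfCoprime] at this
    rw [ht, mul_neg, this]
  obtain ⟨c, hc0, hct⟩ := Nat.chineseRemainder huv 0 t.val
  have hc : (c : ZMod v) = t := by
    rw [(ZMod.natCast_eq_natCast_iff c t.val v).2 hct, ZMod.natCast_zmod_val]
  refine ⟨c, fun m => ?_⟩
  rw [← Nat.modEq_and_modEq_iff_modEq_mul huv]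
  refine and_congr ?_ ?_
  · rw [← Nat.modEq_zero_iff_dvd]
    exact ⟨fun h => h.trans hc0.symm, fun h => h.trans hc0⟩
  · rw [← ZMod.natCast_eq_natCast_iff, hc, ← ZMod.natCast_eq_zero_iff]
    push_cast
    constructor
    · intro h
      have h1 : (a : ZMod v) * m = a * t := by rw [hat]; linear_combination h
      have hu : IsUnit (a : ZMod v) := by
        rw [← ZMod.coe_unitOfCoprime a hva.symm]; exact Units.isUnit _
      exact hu.mul_left_cancel h1
    · intro h
      rw [h, hat]; ring

lemma abs_card_dvd_pair_sub_le (a X : ℕ) {d : ℕ} (hd : Squarefree d) :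
    |(((Finset.Ioc 0 X).filter (fun m => d ∣ m * (a * m + 1))).card : ℝ) -
      pairRootCount a d / d * X| ≤ pairRootCount a d := by
  have hd0 : 0 < d := Nat.pos_of_ne_zero hd.ne_zero
  have hcop1 : ∀ m, Nat.Coprime m (a * m + 1) := fun m => by simp
  have hfib := Finset.card_eq_sum_card_fiberwise
    (s := (Finset.Ioc 0 X).filter (fun m => d ∣ m * (a * m + 1)))
    (t := d.divisors.filter (fun v => Nat.Coprime v a)) (f := fun m => Nat.gcd d (a * m + 1))
    (fun m _ => by
      simp only [Finset.coe_filter, Nat.mem_divisors, Set.mem_ofPred_eq]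
      refine ⟨⟨Nat.gcd_dvd_left _ _, hd0.ne'⟩, ?_⟩
      refine Nat.Coprime.coprime_dvd_left (Nat.gcd_dvd_right _ _) ?_
      simp)
  have hone : ∀ v ∈ d.divisors.filter (fun v => Nat.Coprime v a),
      |((((Finset.Ioc 0 X).filter (fun m => d ∣ m * (a * m + 1))).filter
        (fun m => Nat.gcd d (a * m + 1) = v)).card : ℝ) - X / d| ≤ 1 := by
    intro v hv
    obtain ⟨hvd, hva⟩ := Finset.mem_filter.1 hv
    have hv0 := Nat.pos_of_mem_divisors hvd
    obtain ⟨u, hu⟩ := Nat.dvd_of_mem_divisors hvd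
    have huv : Nat.Coprime u v := (Nat.coprime_of_squarefree_mul (hu ▸ hd)).symm
    obtain ⟨c, hc⟩ := exists_modEq_iff huv hva hv0
    have : ((Finset.Ioc 0 X).filter (fun m => d ∣ m * (a * m + 1))).filter
        (fun m => Nat.gcd d (a * m + 1) = v) =
          (Finset.Ioc 0 X).filter (fun m => m ≡ c [MOD d]) := by
      rw [Finset.filter_filter]
      refine Finset.filter_congr fun m _ => ?_
      rw [hu, mul_comm v u, ← hc]
      constructor
      · rintro ⟨h1, h2⟩
        have hv' : v ∣ a * m + 1 := by
          have := Nat.gcd_dvd_right (u * v) (a * m + 1)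
          rwa [h2] at this
        refine ⟨?_, hv'⟩
        have h3 : Nat.Coprime u (a * m + 1) := by
          have : Nat.gcd u (a * m + 1) ∣ v := by
            conv_rhs => rw [← h2]
            exact Nat.gcd_dvd_gcd_of_dvd_left _ (dvd_mul_right u v)
          exact Nat.eq_one_of_dvd_coprimes huv (Nat.gcd_dvd_left _ _) this
        exact h3.dvd_of_dvd_mul_right ((dvd_mul_right u v).trans h1)
      · rintro ⟨h1, h2⟩
        refine ⟨mul_dvd_mul h1 h2, ?_⟩
        have h3 : Nat.Coprime u (a * m + 1) := (hcop1 m).coprime_dvd_left h1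
        rw [Nat.Coprime.gcd_mul_left_cancel _ h3]
        exact Nat.gcd_eq_left h2
    rw [this]
    exact abs_card_modEq_sub_le X c hd0
  rw [hfib, Nat.cast_sum]
  have e : pairRootCount a d / d * X =
      ∑ v ∈ d.divisors.filter (fun v => Nat.Coprime v a), (X : ℝ) / d := by
    rw [Finset.sum_const, nsmul_eq_mul, ← pairRootCount_apply]; ring
  rw [e, ← Finset.sum_sub_distrib]
  refine (Finset.abs_sum_le_sum_abs _ _).trans ((Finset.sum_le_sum hone).trans ?_)
  rw [Finset.sum_const, nsmul_eq_mul, mul_one, ← pairRootCount_apply]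

/-- The density `pairRootCount a d / d`. -/
noncomputable def pairDensity (a : ℕ) : ArithmeticFunction ℝ :=
  ⟨fun d => pairRootCount a d / d, by simp⟩

lemma pairDensity_apply (a d : ℕ) : pairDensity a d = pairRootCount a d / d := rfl

lemma isMultiplicative_pairDensity (a : ℕ) : (pairDensity a).IsMultiplicative := by
  have h : (pairRootCount a).IsMultiplicative :=
    ArithmeticFunction.isMultiplicative_zeta.natCast.mul (isMultiplicative_coprimeIndicator a)
  rw [ArithmeticFunction.IsMultiplicative.iff_ne_zero]
  refine ⟨by simp [pairDensity_apply, h.map_one], fun {m n} _ _ hmn => ?_⟩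
  rw [pairDensity_apply, pairDensity_apply, pairDensity_apply, h.map_mul_of_coprime hmn,
    Nat.cast_mul, mul_div_mul_comm]

lemma pairDensity_prime_bounds {a q : ℕ} (ha : 2 ∣ a) (hq : q.Prime) :
    0 < pairDensity a q ∧ (1 : ℝ) / q ≤ 1 - pairDensity a q := by
  have hq0 : (0 : ℝ) < q := by exact_mod_cast hq.pos
  rw [pairDensity_apply, pairRootCount_prime hq]
  split_ifs with h
  · refine ⟨by positivity, ?_⟩
    have : (2 : ℝ) ≤ q := by exact_mod_cast hq.two_le
    rw [le_sub_iff_add_le, ← add_div, div_le_one hq0]; linarith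
  · refine ⟨by positivity, ?_⟩
    have h3 : 3 ≤ q := by
      rcases hq.two_le.eq_or_lt with h2 | h2
      · exact absurd (h2 ▸ ha) h
      · exact h2
    have : (3 : ℝ) ≤ q := by exact_mod_cast h3
    rw [le_sub_iff_add_le, ← add_div, div_le_one hq0]; linarith

/-- The sieve removing the `m ≤ X` for which `m * (a * m + 1)` has a prime factor at most `R`. -/
noncomputable def pairSieve (a X R : ℕ) (ha : 2 ∣ a) : BoundingSieve where
  support := (Finset.Ioc 0 X).image (fun m => m * (a * m + 1))
  prodPrimes := primorial R
  prodPrimes_squarefree := squarefree_primorial R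
  weights _ := 1
  weights_nonneg _ := zero_le_one
  totalMass := X
  nu := pairDensity a
  nu_mult := isMultiplicative_pairDensity a
  nu_pos_of_prime q hq _ := (pairDensity_prime_bounds ha hq).1
  nu_lt_one_of_prime q hq _ := by
    have h1 := (pairDensity_prime_bounds ha hq).2
    have h2 : (0 : ℝ) < 1 / q := by
      have := hq.pos
      positivity
    linarith

lemma injective_mul_linear (a : ℕ) : Function.Injective (fun m => m * (a * m + 1)) := by
  have : StrictMono (fun m => m * (a * m + 1)) := by
    intro m n hmn
    dsimp only
    have h1 : a * m + 1 ≤ a * n + 1 := by gcongr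
    exact Nat.mul_lt_mul_of_lt_of_le hmn h1 (by omega)
  exact this.injective

lemma siftedSum_pairSieve (a X R : ℕ) (ha : 2 ∣ a) : (pairSieve a X R ha).siftedSum =
    (((Finset.Ioc 0 X).filter
      (fun m => Nat.Coprime (primorial R) (m * (a * m + 1)))).card : ℝ) := by
  unfold siftedSum
  change ∑ d ∈ (Finset.Ioc 0 X).image (fun m => m * (a * m + 1)),
    (if Nat.Coprime (primorial R) d then (1 : ℝ) else 0) = _
  rw [Finset.sum_image fun m _ n _ h => injective_mul_linear a h, Finset.sum_boole]

lemma multSum_pairSieve (a X R : ℕ) (ha : 2 ∣ a) (d : ℕ) : (pairSieve a X R ha).multSum d =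
    (((Finset.Ioc 0 X).filter (fun m => d ∣ m * (a * m + 1))).card : ℝ) := by
  unfold multSum
  change ∑ n ∈ (Finset.Ioc 0 X).image (fun m => m * (a * m + 1)),
    (if d ∣ n then (1 : ℝ) else 0) = _
  rw [Finset.sum_image fun m _ n _ h => injective_mul_linear a h, Finset.sum_boole]

lemma selbergTerms_pairSieve_le (a X R : ℕ) (ha : 2 ∣ a) {d : ℕ} (hd : d ∣ primorial R) :
    (pairSieve a X R ha).selbergTerms d ≤ d * (pairSieve a X R ha).nu d := by
  have hsq := Squarefree.squarefree_of_dvd hd (squarefree_primorial R)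
  rw [selbergTerms_apply, mul_comm]
  refine mul_le_mul_of_nonneg_right ?_ (nu_pos_of_dvd_prodPrimes (s := pairSieve a X R ha) hd).le
  conv_rhs => rw [← Nat.prod_primeFactors_of_squarefree hsq]
  rw [Nat.cast_prod]
  refine Finset.prod_le_prod (fun q hq => ?_) fun q hq => ?_
  all_goals
    have hqp := Nat.prime_of_mem_primeFactors hq
    have h := (pairDensity_prime_bounds ha hqp).2
    have hq0 : (0 : ℝ) < q := by exact_mod_cast hqp.pos
    have h1 : (0 : ℝ) < 1 / q := by positivity
    change _ ≤ 1 - (pairSieve a X R ha).nu q at h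
  · exact inv_nonneg.2 (h1.le.trans h)
  · rw [inv_le_comm₀ (h1.trans_le h) hq0, ← one_div]
    exact h

lemma nu_le_selbergTerms_pairSieve (a X R : ℕ) (ha : 2 ∣ a) {d : ℕ} (hd : d ∣ primorial R) :
    pairRootCount a d / d ≤ (pairSieve a X R ha).selbergTerms d := by
  rw [selbergTerms_apply]
  have h0 := (nu_pos_of_dvd_prodPrimes (s := pairSieve a X R ha) hd).le
  change (pairSieve a X R ha).nu d ≤ _
  refine le_mul_of_one_le_right h0 ?_
  have : ∀ q ∈ d.primeFactors, (1 : ℝ) ≤ (1 - (pairSieve a X R ha).nu q)⁻¹ := by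
    intro q hq
    have hqp := Nat.prime_of_mem_primeFactors hq
    have h := pairDensity_prime_bounds ha hqp
    have hq0 : (0 : ℝ) < q := by exact_mod_cast hqp.pos
    have h1 : (0 : ℝ) < 1 / q := by positivity
    change 0 < (pairSieve a X R ha).nu q ∧ _ ≤ 1 - (pairSieve a X R ha).nu q at h
    exact (one_le_inv₀ (h1.trans_le h.2)).2 (by linarith)
  calc (1 : ℝ) = ∏ q ∈ d.primeFactors, (1 : ℝ) := by simp
    _ ≤ _ := Finset.prod_le_prod (fun _ _ => zero_le_one) this

lemma card_pairSieve_le (a X : ℕ) {R : ℕ} (hR : 1 ≤ R) (ha : 2 ∣ a) :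
    (((Finset.Ioc 0 X).filter
      (fun m => Nat.Coprime (primorial R) (m * (a * m + 1)))).card : ℝ) ≤
      X / selbergSum (pairSieve a X R ha) R + (R : ℝ) ^ 10 := by
  rw [← siftedSum_pairSieve a X R ha]
  refine siftedSum_le_of_abs_rem_le hR (fun d hd => selbergTerms_pairSieve_le a X R ha hd)
    fun d hd => ?_
  unfold rem
  rw [multSum_pairSieve]
  exact (abs_card_dvd_pair_sub_le a X
    (Squarefree.squarefree_of_dvd hd (squarefree_primorial R))).trans (pairRootCount_le a d)

end LinearPair

lemma sum_le_sum_mul_sum_of_injOn {α β γ : Type*} {s : Finset α} {t : Finset β} {r : Finset γ}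
    {f : α → β} {h : α → γ} {w : α → ℝ} {F : β → ℝ} {G : γ → ℝ} (hf : ∀ x ∈ s, f x ∈ t)
    (hh : ∀ x ∈ s, h x ∈ r) (hinj : Set.InjOn (fun x => (f x, h x)) s)
    (hw : ∀ x ∈ s, w x = F (f x) * G (h x)) (hF : ∀ y ∈ t, 0 ≤ F y) (hG : ∀ z ∈ r, 0 ≤ G z) :
    ∑ x ∈ s, w x ≤ (∑ y ∈ t, F y) * ∑ z ∈ r, G z := by
  rw [Finset.sum_mul_sum, ← Finset.sum_product']
  rw [Finset.sum_congr rfl hw, ← Finset.sum_image (f := fun p : β × γ => F p.1 * G p.2) hinj]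
  refine Finset.sum_le_sum_of_subset_of_nonneg ?_ fun p hp _ => ?_
  · intro p hp
    obtain ⟨x, hx, rfl⟩ := Finset.mem_image.1 hp
    exact Finset.mem_product.2 ⟨hf x hx, hh x hx⟩
  · obtain ⟨h1, h2⟩ := Finset.mem_product.1 hp
    exact mul_nonneg (hF _ h1) (hG _ h2)

lemma sum_Ioc_inv_sq_le_two (N : ℕ) : ∑ n ∈ Finset.Ioc 0 N, (1 : ℝ) / (n : ℝ) ^ 2 ≤ 2 := by
  have h : ∀ N : ℕ, ∑ n ∈ Finset.Ioc 0 (N + 1), (1 : ℝ) / (n : ℝ) ^ 2 ≤ 2 - 1 / ((N : ℝ) + 1) := by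
    intro N
    induction N with
    | zero => norm_num
    | succ k ih =>
      rw [Finset.sum_Ioc_succ_top (Nat.zero_le _)]
      push_cast at ih ⊢
      have h1 : (1 : ℝ) / ((k : ℝ) + 1 + 1) ^ 2 ≤ 1 / ((k : ℝ) + 1) - 1 / ((k : ℝ) + 1 + 1) := by
        rw [div_sub_div _ _ (by positivity) (by positivity), div_le_div_iff₀ (by positivity)
          (by positivity)]
        nlinarith [(Nat.cast_nonneg k : (0 : ℝ) ≤ k)]
      linarith
  rcases N with _ | N
  · simp
  · have h1 : (0 : ℝ) ≤ 1 / ((N : ℝ) + 1) := by positivity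
    linarith [h N]

lemma log_le_sum_Ioc_inv (N : ℕ) : Real.log N ≤ ∑ n ∈ Finset.Ioc 0 N, (1 : ℝ) / n := by
  have h := log_add_one_le_harmonic N
  have e : ((harmonic N : ℚ) : ℝ) = ∑ n ∈ Finset.Ioc 0 N, (1 : ℝ) / n := by
    rw [harmonic_eq_sum_Icc]
    push_cast
    refine Finset.sum_congr (by ext; simp; omega) fun n _ => by rw [one_div]
  rw [← e]
  rcases N.eq_zero_or_pos with rfl | hN
  · simp
  refine le_trans (Real.log_le_log (by exact_mod_cast hN) ?_) h
  push_cast; linarith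

lemma sum_Ioc_inv_le_squarefree (T : ℕ) : ∑ n ∈ Finset.Ioc 0 T, (1 : ℝ) / n ≤
    2 * ∑ n ∈ (Finset.Ioc 0 T).filter Squarefree, (1 : ℝ) / n := by
  choose a b hab using fun n : ℕ => Nat.sq_mul_squarefree n
  have key : ∀ n ∈ Finset.Ioc 0 T, 0 < b n ∧ 0 < a n ∧ b n ≤ T ∧ a n ≤ T := by
    intro n hn
    obtain ⟨h1, h2⟩ := Finset.mem_Ioc.1 hn
    have hmul := (hab n).1
    have hb : 0 < b n := Nat.pos_of_ne_zero fun h => by rw [h] at hmul; omega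
    have ha : 0 < a n := Nat.pos_of_ne_zero fun h => by rw [h] at hmul; omega
    refine ⟨hb, ha, ?_, ?_⟩
    · exact (Nat.le_of_dvd h1 ⟨b n * a n, by rw [← mul_assoc, ← sq, hmul]⟩).trans h2
    · exact (Nat.le_of_dvd h1 ⟨b n ^ 2, by rw [mul_comm, hmul]⟩).trans h2
  have h := sum_le_sum_mul_sum_of_injOn (s := Finset.Ioc 0 T) (t := Finset.Ioc 0 T)
    (r := (Finset.Ioc 0 T).filter Squarefree) (f := b) (h := a) (w := fun n => (1 : ℝ) / n)
    (F := fun n => (1 : ℝ) / (n : ℝ) ^ 2) (G := fun n => (1 : ℝ) / n)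
    (fun n hn => Finset.mem_Ioc.2 ⟨(key n hn).1, (key n hn).2.2.1⟩)
    (fun n hn => Finset.mem_filter.2 ⟨Finset.mem_Ioc.2 ⟨(key n hn).2.1, (key n hn).2.2.2⟩,
      (hab n).2⟩)
    (fun m _ n _ hmn => by
      obtain ⟨h1, h2⟩ := Prod.mk.inj hmn
      rw [← (hab m).1, ← (hab n).1, h1, h2])
    (fun n _ => by
      conv_lhs => rw [← (hab n).1]
      push_cast
      rw [div_mul_div_comm, one_mul])
    (fun n _ => by positivity) (fun n _ => by positivity)
  refine h.trans (mul_le_mul_of_nonneg_right (sum_Ioc_inv_sq_le_two T) ?_)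
  exact Finset.sum_nonneg fun n _ => by positivity

/-- Pairs of coprime squarefree numbers at most `T`. -/
noncomputable def squarefreePairs (T : ℕ) : Finset (ℕ × ℕ) :=
  (Finset.Ioc 0 T ×ˢ Finset.Ioc 0 T).filter (fun p => Squarefree (p.1 * p.2))

lemma mem_squarefreePairs {T : ℕ} {p : ℕ × ℕ} : p ∈ squarefreePairs T ↔
    ((0 < p.1 ∧ p.1 ≤ T) ∧ (0 < p.2 ∧ p.2 ≤ T)) ∧ Squarefree (p.1 * p.2) := by
  simp [squarefreePairs]

lemma sum_squarefree_sq_le (T : ℕ) :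
    (∑ n ∈ (Finset.Ioc 0 T).filter Squarefree, (1 : ℝ) / n) ^ 2 ≤
      2 * ∑ p ∈ squarefreePairs T, (1 : ℝ) / (p.1 * p.2) := by
  rw [sq, Finset.sum_mul_sum, ← Finset.sum_product']
  set S := (Finset.Ioc 0 T).filter Squarefree with hS
  have key : ∀ p ∈ S ×ˢ S, (0 < p.1 ∧ p.1 ≤ T ∧ Squarefree p.1) ∧
      (0 < p.2 ∧ p.2 ≤ T ∧ Squarefree p.2) := by
    intro p hp
    simpa [hS, and_assoc] using hp
  have e1 : ∀ p : ℕ × ℕ, Nat.gcd p.1 p.2 * (p.1 / Nat.gcd p.1 p.2) = p.1 := fun p =>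
    Nat.mul_div_cancel' (Nat.gcd_dvd_left _ _)
  have e2 : ∀ p : ℕ × ℕ, Nat.gcd p.1 p.2 * (p.2 / Nat.gcd p.1 p.2) = p.2 := fun p =>
    Nat.mul_div_cancel' (Nat.gcd_dvd_right _ _)
  have h := sum_le_sum_mul_sum_of_injOn (s := S ×ˢ S) (t := Finset.Ioc 0 T)
    (r := squarefreePairs T) (f := fun p => Nat.gcd p.1 p.2)
    (h := fun p => (p.1 / Nat.gcd p.1 p.2, p.2 / Nat.gcd p.1 p.2))
    (w := fun p => (1 : ℝ) / p.1 * (1 / p.2))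
    (F := fun n => (1 : ℝ) / (n : ℝ) ^ 2) (G := fun p => (1 : ℝ) / (p.1 * p.2))
    (fun p hp => by
      obtain ⟨⟨h1, h2, _⟩, _⟩ := key p hp
      exact Finset.mem_Ioc.2 ⟨Nat.gcd_pos_of_pos_left _ h1, (Nat.gcd_le_left _ h1).trans h2⟩)
    (fun p hp => by
      obtain ⟨⟨h1, h2, h3⟩, h4, h5, h6⟩ := key p hp
      have hg := Nat.gcd_pos_of_pos_left p.2 h1
      refine mem_squarefreePairs.2 ⟨⟨⟨Nat.div_pos (Nat.gcd_le_left _ h1) hg,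
        (Nat.div_le_self _ _).trans h2⟩, Nat.div_pos (Nat.gcd_le_right _ h4) hg,
        (Nat.div_le_self _ _).trans h5⟩, ?_⟩
      dsimp only
      rw [Nat.squarefree_mul (Nat.coprime_div_gcd_div_gcd hg)]
      exact ⟨h3.squarefree_of_dvd (Nat.div_dvd_of_dvd (Nat.gcd_dvd_left _ _)),
        h6.squarefree_of_dvd (Nat.div_dvd_of_dvd (Nat.gcd_dvd_right _ _))⟩)
    (fun p _ q _ hpq => by
      simp only [Prod.mk.injEq] at hpq
      obtain ⟨h1, h2, h3⟩ := hpq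
      ext
      · rw [← e1 p, ← e1 q, h2, h1]
      · rw [← e2 p, ← e2 q, h3, h1])
    (fun p _ => by
      dsimp only
      conv_lhs => rw [← e1 p]
      conv_lhs => enter [2]; rw [← e2 p]
      push_cast
      rw [div_mul_div_comm, div_mul_div_comm, one_mul]
      congr 1
      ring)
    (fun n _ => by positivity) (fun n _ => by positivity)
  refine h.trans (mul_le_mul_of_nonneg_right (sum_Ioc_inv_sq_le_two T) ?_)
  exact Finset.sum_nonneg fun n _ => by positivity

/-- The sum of the reciprocals of the divisors of `a`. -/
noncomputable def sumInvDivisors (a : ℕ) : ℝ := ∑ e ∈ a.divisors, (1 : ℝ) / e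

lemma sumInvDivisors_nonneg (a : ℕ) : 0 ≤ sumInvDivisors a :=
  Finset.sum_nonneg fun n _ => by positivity

lemma sum_squarefreePairs_le {a : ℕ} (ha : 0 < a) (T : ℕ) :
    ∑ p ∈ squarefreePairs T, (1 : ℝ) / (p.1 * p.2) ≤ sumInvDivisors a *
      ∑ p ∈ (squarefreePairs T).filter (fun p => Nat.Coprime p.2 a), (1 : ℝ) / (p.1 * p.2) := by
  have e2 : ∀ p : ℕ × ℕ, Nat.gcd p.2 a * (p.2 / Nat.gcd p.2 a) = p.2 := fun p =>
    Nat.mul_div_cancel' (Nat.gcd_dvd_left _ _)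
  refine sum_le_sum_mul_sum_of_injOn (f := fun p => Nat.gcd p.2 a)
    (h := fun p => (p.1, p.2 / Nat.gcd p.2 a)) ?_ ?_ ?_ ?_
    (fun n _ => by positivity) (fun n _ => by positivity)
  · intro p _
    exact Nat.mem_divisors.2 ⟨Nat.gcd_dvd_right _ _, ha.ne'⟩
  · intro p hp
    obtain ⟨⟨h1, h2, h3⟩, h4⟩ := mem_squarefreePairs.1 hp
    have hdvd : p.2 / Nat.gcd p.2 a ∣ p.2 := Nat.div_dvd_of_dvd (Nat.gcd_dvd_left _ _)
    refine Finset.mem_filter.2 ⟨mem_squarefreePairs.2 ⟨⟨h1, Nat.div_pos (Nat.gcd_le_left _ h2)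
      (Nat.gcd_pos_of_pos_left _ h2), (Nat.div_le_self _ _).trans h3⟩,
      h4.squarefree_of_dvd (mul_dvd_mul_left _ hdvd)⟩, ?_⟩
    have hsq : Squarefree p.2 := h4.of_mul_right
    have hc : Nat.Coprime (Nat.gcd p.2 a) (p.2 / Nat.gcd p.2 a) :=
      Nat.coprime_of_squarefree_mul (by rw [e2 p]; exact hsq)
    refine Nat.Coprime.symm (Nat.eq_one_of_dvd_coprimes hc ?_ (Nat.gcd_dvd_right _ _))
    exact Nat.dvd_gcd ((Nat.gcd_dvd_right _ _).trans hdvd) (Nat.gcd_dvd_left _ _)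
  · intro p _ q _ hpq
    simp only [Prod.mk.injEq] at hpq
    obtain ⟨h1, h2, h3⟩ := hpq
    ext
    · exact h2
    · rw [← e2 p, ← e2 q, h3, h1]
  · intro p _
    dsimp only
    conv_lhs => enter [2, 2]; rw [← e2 p]
    push_cast
    rw [div_mul_div_comm, one_mul]
    congr 1
    ring

lemma sum_squarefreePairs_le_selbergSum (a X : ℕ) (ha : 2 ∣ a) {T R : ℕ} (hTR : T ^ 2 ≤ R) :
    ∑ p ∈ (squarefreePairs T).filter (fun p => Nat.Coprime p.2 a), (1 : ℝ) / (p.1 * p.2) ≤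
      selbergSum (pairSieve a X R ha) R := by
  have hmaps : ∀ p ∈ (squarefreePairs T).filter (fun p => Nat.Coprime p.2 a),
      p.1 * p.2 ∈ (primorial R).divisors.filter (· ≤ R) := by
    intro p hp
    obtain ⟨⟨⟨h1, h2⟩, h3, h4⟩, h5⟩ := mem_squarefreePairs.1 (Finset.mem_filter.1 hp).1
    have hle : p.1 * p.2 ≤ R := (Nat.mul_le_mul h2 h4).trans (by rwa [← sq])
    refine Finset.mem_filter.2 ⟨Nat.mem_divisors.2 ⟨?_, (squarefree_primorial R).ne_zero⟩, hle⟩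
    rw [← Nat.prod_primeFactors_of_squarefree h5]
    refine Finset.prod_dvd_prod_of_subset _ _ _ fun q hq => ?_
    have hq' := Nat.le_of_mem_primeFactors hq
    simp only [Finset.mem_filter, Finset.mem_range]
    exact ⟨by omega, Nat.prime_of_mem_primeFactors hq⟩
  rw [← Finset.sum_fiberwise_of_maps_to hmaps]
  refine Finset.sum_le_sum fun l hl => ?_
  have hldvd := Nat.dvd_of_mem_divisors (Finset.mem_filter.1 hl).1
  have hl0 : l ≠ 0 := (Nat.pos_of_mem_divisors (Finset.mem_filter.1 hl).1).ne'
  refine le_trans ?_ (nu_le_selbergTerms_pairSieve a X R ha hldvd)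
  rw [Finset.sum_congr rfl (g := fun _ => (1 : ℝ) / l) fun p hp => by
    rw [← (Finset.mem_filter.1 hp).2]; push_cast; rfl]
  rw [Finset.sum_const, nsmul_eq_mul, mul_one_div, pairRootCount_apply]
  gcongr
  refine Finset.card_le_card_of_injOn (fun p => p.2) ?_ ?_
  · intro p hp
    obtain ⟨h1, h2⟩ := Finset.mem_filter.1 hp
    have h3 := (Finset.mem_filter.1 h1).2
    exact Finset.mem_filter.2 ⟨Nat.mem_divisors.2 ⟨⟨p.1, by rw [← h2]; ring⟩, hl0⟩, h3⟩
  · intro p hp q hq hpq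
    have h1 := (Finset.mem_filter.1 hp).2
    have h2 := (Finset.mem_filter.1 hq).2
    have hp0 : 0 < p.2 := by
      rcases Nat.eq_zero_or_pos p.2 with h | h
      · rw [h] at h1; omega
      · exact h
    dsimp only at hpq
    ext
    · refine Nat.eq_of_mul_eq_mul_right hp0 ?_
      rw [h1]; rw [hpq]; exact h2.symm
    · exact hpq

lemma log_sq_le_selbergSum {a : ℕ} (X : ℕ) (ha : 2 ∣ a) (ha0 : 0 < a) {T R : ℕ} (hT : 1 ≤ T)
    (hTR : T ^ 2 ≤ R) : Real.log T ^ 2 ≤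
      8 * sumInvDivisors a * selbergSum (pairSieve a X R ha) R := by
  have h1 := (log_le_sum_Ioc_inv T).trans (sum_Ioc_inv_le_squarefree T)
  have h0 : 0 ≤ Real.log T := Real.log_nonneg (by exact_mod_cast hT)
  have h2 := pow_le_pow_left₀ h0 h1 2
  have h3 := sum_squarefree_sq_le T
  have h4 := sum_squarefreePairs_le ha0 T
  have h5 := mul_le_mul_of_nonneg_left (sum_squarefreePairs_le_selbergSum a X ha hTR)
    (sumInvDivisors_nonneg a)
  rw [mul_pow] at h2
  linarith

/-- An upper bound for the number of `m ≤ X` such that `m` and `a * m + 1` have no prime factors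
at most `T ^ 2`. -/
lemma card_coprime_primorial_le {a : ℕ} (X : ℕ) (ha : 2 ∣ a) (ha0 : 0 < a) {T : ℕ} (hT : 2 ≤ T) :
    (((Finset.Ioc 0 X).filter
      (fun m => Nat.Coprime (primorial (T ^ 2)) (m * (a * m + 1)))).card : ℝ) ≤
      8 * sumInvDivisors a * X / Real.log T ^ 2 + (T : ℝ) ^ 20 := by
  have hR : 1 ≤ T ^ 2 := Nat.one_le_pow _ _ (by omega)
  have h := card_pairSieve_le a X hR ha
  have hl : 0 < Real.log T := Real.log_pos (by exact_mod_cast hT)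
  have h1 := log_sq_le_selbergSum X ha ha0 (T := T) (by omega) le_rfl
  have h2 := one_le_selbergSum (s := pairSieve a X (T ^ 2) ha) hR
  refine h.trans (add_le_add ?_ (le_of_eq (by push_cast; ring)))
  rw [div_le_div_iff₀ (by linarith) (by positivity)]
  nlinarith [mul_le_mul_of_nonneg_left h1 (Nat.cast_nonneg X : (0 : ℝ) ≤ X)]

lemma sumInvDivisors_mul_le {j k : ℕ} (hj : 0 < j) (hk : 0 < k) :
    sumInvDivisors (j * k) ≤ sumInvDivisors j * sumInvDivisors k := by
  have e : ∀ n, Nat.gcd n j * (n / Nat.gcd n j) = n := fun n =>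
    Nat.mul_div_cancel' (Nat.gcd_dvd_left _ _)
  refine sum_le_sum_mul_sum_of_injOn (f := fun n => Nat.gcd n j) (h := fun n => n / Nat.gcd n j)
    ?_ ?_ ?_ ?_ (fun n _ => by positivity) (fun n _ => by positivity)
  · intro n _
    exact Nat.mem_divisors.2 ⟨Nat.gcd_dvd_right _ _, hj.ne'⟩
  · intro n hn
    refine Nat.mem_divisors.2 ⟨?_, hk.ne'⟩
    have hg : 0 < Nat.gcd n j := Nat.gcd_pos_of_pos_right _ hj
    have h1 : n / Nat.gcd n j ∣ j / Nat.gcd n j * k := by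
      refine Nat.dvd_of_mul_dvd_mul_left hg ?_
      rw [e n, ← mul_assoc, Nat.mul_div_cancel' (Nat.gcd_dvd_right _ _)]
      exact Nat.dvd_of_mem_divisors hn
    exact (Nat.coprime_div_gcd_div_gcd hg).dvd_of_dvd_mul_left h1
  · intro m _ n _ hmn
    obtain ⟨h1, h2⟩ := Prod.mk.inj hmn
    rw [← e m, ← e n, h2, h1]
  · intro n _
    conv_lhs => rw [← e n]
    push_cast
    rw [div_mul_div_comm, one_mul]

lemma sumInvDivisors_prime_le {q : ℕ} (hq : q.Prime) : sumInvDivisors q ≤ 2 := by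
  have h1 : (1 : ℝ) ≤ q := by exact_mod_cast hq.one_lt.le
  have h2 : (1 : ℝ) / q ≤ 1 := (div_le_one (by linarith)).2 h1
  rw [sumInvDivisors, hq.sum_divisors]
  push_cast
  linarith

lemma sum_sumInvDivisors_div_le (J : ℕ) :
    ∑ j ∈ Finset.Ioc 0 J, sumInvDivisors j / j ≤ 2 * (1 + Real.log J) := by
  have h := sum_divisors_eq_sum_sum (fun e n => (1 : ℝ) / e / n) J
  have e1 : ∀ j ∈ Finset.Ioc 0 J, sumInvDivisors j / j = ∑ e ∈ j.divisors, (1 : ℝ) / e / j := by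
    intro j _
    rw [sumInvDivisors, Finset.sum_div]
  rw [Finset.sum_congr rfl e1, h]
  have hH := sum_Ioc_inv_le J
  have hH0 : (0 : ℝ) ≤ ∑ n ∈ Finset.Ioc 0 J, (1 : ℝ) / n :=
    Finset.sum_nonneg fun n _ => by positivity
  calc ∑ d ∈ Finset.Ioc 0 J, ∑ k ∈ Finset.Ioc 0 (J / d), (1 : ℝ) / d / ((d * k : ℕ) : ℝ)
      ≤ ∑ d ∈ Finset.Ioc 0 J, (1 : ℝ) / (d : ℝ) ^ 2 * ∑ n ∈ Finset.Ioc 0 J, (1 : ℝ) / n := by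
        refine Finset.sum_le_sum fun d _ => ?_
        rw [Finset.mul_sum]
        refine (Finset.sum_le_sum_of_subset_of_nonneg (Finset.Ioc_subset_Ioc_right
          (Nat.div_le_self J d)) fun k _ _ => by positivity).trans (le_of_eq ?_)
        refine Finset.sum_congr rfl fun k _ => ?_
        push_cast
        rw [div_div, div_mul_div_comm, one_mul]
        congr 1
        ring
    _ ≤ 2 * ∑ n ∈ Finset.Ioc 0 J, (1 : ℝ) / n := by
        rw [← Finset.sum_mul]
        exact mul_le_mul_of_nonneg_right (sum_Ioc_inv_sq_le_two J) hH0
    _ ≤ _ := by linarith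

lemma coprime_primorial_of_prime {q R : ℕ} (hq : q.Prime) (hR : R < q) :
    Nat.Coprime (primorial R) q := by
  refine Nat.Coprime.symm ((hq.coprime_iff_not_dvd).2 fun h => ?_)
  rw [primorial, hq.prime.dvd_finsetProd_iff] at h
  obtain ⟨s, hs, hqs⟩ := h
  simp only [Finset.mem_filter, Finset.mem_range] at hs
  have := Nat.le_of_dvd hs.2.pos hqs
  omega

/-- The primes in `(D, 4 * D]`. -/
noncomputable def levelPrimes (D : ℕ) : Finset ℕ := (Finset.Ioc D (4 * D)).filter Nat.Prime

lemma mem_levelPrimes {D l : ℕ} : l ∈ levelPrimes D ↔ (D < l ∧ l ≤ 4 * D) ∧ l.Prime := by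
  simp [levelPrimes]

/-- The pairs of a level prime `l` and a prime `r` in `(y, 2 * y]` with `r ≡ 1` modulo `l`, for
which `r - 1` has a prime factor larger than `4 * D`. -/
noncomputable def roughPairs (D y : ℕ) : Finset (ℕ × ℕ) :=
  (levelPrimes D ×ˢ Finset.Ioc y (2 * y)).filter
    (fun x => x.2.Prime ∧ x.1 ∣ x.2 - 1 ∧ ∃ s, s.Prime ∧ 4 * D < s ∧ s ∣ x.2 - 1)

lemma card_roughPairs_le_sum {D y T J : ℕ} (hD : 2 ≤ D) (hTD : T ^ 2 ≤ 4 * D)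
    (hTy : T ^ 2 ≤ y) (hJ : 2 * y ≤ J * D ^ 2) :
    (roughPairs D y).card ≤
      ∑ x ∈ levelPrimes D ×ˢ (Finset.Ioc 0 J).filter (2 ∣ ·),
        ((Finset.Ioc 0 (2 * y / (x.2 * x.1))).filter
          (fun m => Nat.Coprime (primorial (T ^ 2)) (m * (x.2 * x.1 * m + 1)))).card := by
  have hsub : roughPairs D y ⊆ (levelPrimes D ×ˢ (Finset.Ioc 0 J).filter (2 ∣ ·)).biUnion
      (fun x => ((Finset.Ioc 0 (2 * y / (x.2 * x.1))).filter
        (fun m => Nat.Coprime (primorial (T ^ 2)) (m * (x.2 * x.1 * m + 1)))).image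
          (fun m => (x.1, x.2 * x.1 * m + 1))) := by
    rintro ⟨l, r⟩ hx
    obtain ⟨hx1, hr, hlr, s, hs, hDs, hsr⟩ := Finset.mem_filter.1 hx
    obtain ⟨hl, hry⟩ := Finset.mem_product.1 hx1
    dsimp only at hr hlr hsr hl hry
    obtain ⟨⟨hl1, hl2⟩, hlp⟩ := mem_levelPrimes.1 hl
    obtain ⟨hr1, hr2⟩ := Finset.mem_Ioc.1 hry
    have hcop : Nat.Coprime l s := (Nat.coprime_primes hlp hs).2 (by omega)
    obtain ⟨j, hj⟩ := hcop.mul_dvd_of_dvd_of_dvd hlr hsr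
    have hr0 := hr.two_le
    have hrj : j * l * s + 1 = r := by
      have : l * s * j = j * l * s := by ring
      omega
    have hr3 : 2 < r := by
      have hT : D ^ 2 * 1 ≤ D ^ 2 * J := by
        rcases J.eq_zero_or_pos with h | h
        · rw [h] at hJ; omega
        · exact Nat.mul_le_mul_left _ h
      by_contra hcon
      have hr2' : r = 2 := by omega
      have : l ∣ 1 := by simpa [hr2'] using hlr
      exact hlp.one_lt.ne' (Nat.dvd_one.1 this)
    have hj0 : 0 < j := by
      rcases j.eq_zero_or_pos with h | h
      · rw [h] at hrj; omega
      · exact h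
    have hjJ : j ≤ J := by
      have h1 : j * D ^ 2 ≤ J * D ^ 2 := by
        calc j * D ^ 2 = j * D * D := by ring
          _ ≤ j * l * s := Nat.mul_le_mul (Nat.mul_le_mul_left _ hl1.le) (by omega)
          _ ≤ 2 * y := by omega
          _ ≤ _ := hJ
      exact Nat.le_of_mul_le_mul_right h1 (by positivity)
    have hjeven : 2 ∣ j := by
      have hrodd : Odd r := hr.odd_of_ne_two (by omega)
      have hlodd : Odd l := hlp.odd_of_ne_two (by omega)
      have hsodd : Odd s := hs.odd_of_ne_two (by omega)
      rw [← hrj, Nat.odd_add_one, Nat.not_odd_iff_even, Nat.even_mul, Nat.even_mul] at hrodd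
      rw [← even_iff_two_dvd]
      rcases hrodd with (h | h) | h
      · exact h
      · exact absurd hlodd (Nat.not_odd_iff_even.2 h)
      · exact absurd hsodd (Nat.not_odd_iff_even.2 h)
    refine Finset.mem_biUnion.2 ⟨(l, j), Finset.mem_product.2 ⟨hl, Finset.mem_filter.2
      ⟨Finset.mem_Ioc.2 ⟨hj0, hjJ⟩, hjeven⟩⟩, Finset.mem_image.2 ⟨s, Finset.mem_filter.2
      ⟨Finset.mem_Ioc.2 ⟨hs.pos, ?_⟩, ?_⟩, ?_⟩⟩
    · rw [Nat.le_div_iff_mul_le (Nat.mul_pos hj0 hlp.pos)]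
      have : s * (j * l) = j * l * s := by ring
      omega
    · refine Nat.Coprime.mul_right (coprime_primorial_of_prime hs (by omega)) ?_
      rw [hrj]
      exact coprime_primorial_of_prime hr (by omega)
    · simp [hrj]
  refine (Finset.card_le_card hsub).trans (Finset.card_biUnion_le.trans ?_)
  exact Finset.sum_le_sum fun x _ => Finset.card_image_le

lemma card_roughPairs_le {D y T J : ℕ} (hD : 2 ≤ D) (hT : 2 ≤ T) (hTD : T ^ 2 ≤ 4 * D)
    (hTy : T ^ 2 ≤ y) (hJ : 2 * y ≤ J * D ^ 2) :
    ((roughPairs D y).card : ℝ) ≤ (levelPrimes D).card *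
      (64 * (1 + Real.log J) * (y / (D * Real.log T ^ 2)) + J * (T : ℝ) ^ 20) := by
  have hl : 0 < Real.log T := Real.log_pos (by exact_mod_cast hT)
  have hD0 : (0 : ℝ) < D := by positivity
  have h := card_roughPairs_le_sum hD hTD hTy hJ
  have h' : ((roughPairs D y).card : ℝ) ≤
      ∑ x ∈ levelPrimes D ×ˢ (Finset.Ioc 0 J).filter (2 ∣ ·),
        (((Finset.Ioc 0 (2 * y / (x.2 * x.1))).filter
          (fun m => Nat.Coprime (primorial (T ^ 2)) (m * (x.2 * x.1 * m + 1)))).card : ℝ) := by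
    exact_mod_cast h
  refine h'.trans ?_
  have hterm : ∀ x ∈ levelPrimes D ×ˢ (Finset.Ioc 0 J).filter (2 ∣ ·),
      (((Finset.Ioc 0 (2 * y / (x.2 * x.1))).filter
        (fun m => Nat.Coprime (primorial (T ^ 2)) (m * (x.2 * x.1 * m + 1)))).card : ℝ) ≤
      32 * (sumInvDivisors x.2 / x.2) * (y / (D * Real.log T ^ 2)) + (T : ℝ) ^ 20 := by
    rintro ⟨l, j⟩ hx
    obtain ⟨hl1, hj1⟩ := Finset.mem_product.1 hx
    obtain ⟨⟨hDl, _⟩, hlp⟩ := mem_levelPrimes.1 hl1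
    obtain ⟨hj2, hj3⟩ := Finset.mem_filter.1 hj1
    have hj0 : 0 < j := (Finset.mem_Ioc.1 hj2).1
    have hj0' : (0 : ℝ) < j := by exact_mod_cast hj0
    have hl0' : (0 : ℝ) < l := by exact_mod_cast hlp.pos
    have hDl' : (D : ℝ) ≤ l := by exact_mod_cast hDl.le
    dsimp only at hj3 ⊢
    refine (card_coprime_primorial_le (2 * y / (j * l)) (hj3.mul_right l)
      (Nat.mul_pos hj0 hlp.pos) hT).trans (add_le_add ?_ le_rfl)
    have hs : sumInvDivisors (j * l) ≤ 2 * sumInvDivisors j := by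
      refine (sumInvDivisors_mul_le hj0 hlp.pos).trans ?_
      rw [mul_comm]
      exact mul_le_mul_of_nonneg_right (sumInvDivisors_prime_le hlp) (sumInvDivisors_nonneg j)
    have hX : ((2 * y / (j * l) : ℕ) : ℝ) ≤ 2 * y / (j * D) := by
      refine Nat.cast_div_le.trans ?_
      push_cast
      gcongr
    have hs0 := sumInvDivisors_nonneg j
    calc 8 * sumInvDivisors (j * l) * ((2 * y / (j * l) : ℕ) : ℝ) / Real.log T ^ 2
        ≤ 8 * (2 * sumInvDivisors j) * (2 * y / (j * D)) / Real.log T ^ 2 := by gcongr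
      _ = _ := by field_simp; ring
  refine (Finset.sum_le_sum hterm).trans ?_
  rw [Finset.sum_product]
  dsimp only
  rw [Finset.sum_const, nsmul_eq_mul]
  refine mul_le_mul_of_nonneg_left ?_ (Nat.cast_nonneg _)
  have hB : (0 : ℝ) ≤ y / (D * Real.log T ^ 2) := by positivity
  refine (Finset.sum_le_sum_of_subset_of_nonneg (Finset.filter_subset _ _) fun j _ _ => ?_).trans ?_
  · have := sumInvDivisors_nonneg j
    positivity
  rw [Finset.sum_add_distrib, Finset.sum_const, nsmul_eq_mul, Nat.card_Ioc, Nat.sub_zero,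
    ← Finset.sum_mul, ← Finset.mul_sum]
  refine add_le_add (mul_le_mul_of_nonneg_right ?_ hB) le_rfl
  linarith [sum_sumInvDivisors_div_le J]

section PrimePairs
open ArithmeticFunction

lemma oddJacobi_eq_one_or_neg_one {p r : ℕ} (hp : p.Prime) (hr : r.Prime) (hr2 : r ≠ 2)
    (hpr : p ≠ r) : oddJacobi p r = 1 ∨ oddJacobi p r = -1 := by
  unfold oddJacobi
  rw [if_pos (hr.odd_of_ne_two hr2)]
  refine jacobiSym.eq_one_or_neg_one ?_
  rw [Int.gcd_natCast_natCast]
  exact (Nat.coprime_primes hp hr).2 hpr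

lemma apDisc_prime {l r : ℕ} (hr : r.Prime) (hl : l.Prime) (hlr : l < r) :
    apDisc l r = (if l ∣ r - 1 then 1 else 0) - 1 / ((l : ℝ) - 1) := by
  unfold apDisc
  have h1 : (r : ZMod l) ≠ 0 := by
    rw [Ne, ZMod.natCast_eq_zero_iff]
    exact fun h => hlr.ne ((Nat.prime_dvd_prime_iff_eq hl hr).1 h)
  have h2 : (r : ZMod l) = 1 ↔ l ∣ r - 1 := by
    have := ZMod.natCast_eq_natCast_iff 1 r l
    rw [Nat.cast_one] at this
    rw [eq_comm, this, Nat.modEq_iff_dvd' hr.one_lt.le]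
  simp only [h1, h2, if_false]

lemma sum_not_prime_vonMangoldt_le {y : ℕ} (hy : 1 ≤ y) :
    ∑ n ∈ (Finset.Ioc y (2 * y)).filter (fun n => ¬ n.Prime), vonMangoldt n ≤
      2 * √(2 * y) * Real.log (2 * y) := by
  have hy1 : (1 : ℝ) ≤ y := by exact_mod_cast hy
  have h1 := Chebyshev.psi_sub_theta_le (x := 2 * y) (by linarith)
  rw [Chebyshev.psi_sub_theta_eq_sum_not_prime] at h1
  have e : ⌊(2 * y : ℝ)⌋₊ = 2 * y := by
    rw [show (2 * y : ℝ) = ((2 * y : ℕ) : ℝ) by push_cast; rfl, Nat.floor_natCast]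
  rw [e] at h1
  refine le_trans (Finset.sum_le_sum_of_subset_of_nonneg ?_ fun n _ _ => vonMangoldt_nonneg) h1
  exact Finset.filter_subset_filter _ (Finset.Ioc_subset_Ioc_left (Nat.zero_le _))

/-- The pairs of a level prime `l` and a prime `r` in `(y, 2 * y]` with `r ≡ 1` modulo `l` such
that `p` is not a square modulo `r`. -/
noncomputable def primePairs (p D y : ℕ) : Finset (ℕ × ℕ) :=
  (levelPrimes D ×ˢ Finset.Ioc y (2 * y)).filter
    (fun x => x.2.Prime ∧ oddJacobi p x.2 = -1 ∧ x.1 ∣ x.2 - 1)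

/-- The sum of `1 / (l - 1)` over the level primes. -/
noncomputable def levelMass (D : ℕ) : ℝ := ∑ l ∈ levelPrimes D, 1 / ((l : ℝ) - 1)

lemma sum_mul_dvd_le_primePairs {p D y : ℕ} (hp : p.Prime) (hpy : p ≤ y) (hy : 2 ≤ y) :
    ∑ n ∈ (Finset.Ioc y (2 * y)).filter Nat.Prime, vonMangoldt n * (1 - (oddJacobi p n : ℝ)) *
      ∑ l ∈ levelPrimes D, (if l ∣ n - 1 then (1 : ℝ) else 0) ≤
      2 * Real.log (2 * y) * (primePairs p D y).card := by
  rw [primePairs, Finset.card_filter, Finset.sum_product_right, Nat.cast_sum, Finset.mul_sum,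
    Finset.sum_filter]
  refine Finset.sum_le_sum fun n hn => ?_
  obtain ⟨hn1, hn2⟩ := Finset.mem_Ioc.1 hn
  split_ifs with hnp
  · have hlog : Real.log n ≤ Real.log (2 * y) :=
      Real.log_le_log (by exact_mod_cast hnp.pos) (by exact_mod_cast hn2)
    rw [vonMangoldt_apply_prime hnp]
    rcases oddJacobi_eq_one_or_neg_one hp hnp (by omega) (by omega : p ≠ n) with h | h
    · simp [h]
    · simp only [h, hnp, true_and]
      push_cast
      have h0 : (0 : ℝ) ≤ ∑ l ∈ levelPrimes D, (if l ∣ n - 1 then (1 : ℝ) else 0) :=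
        Finset.sum_nonneg fun l _ => by split_ifs <;> norm_num
      refine mul_le_mul_of_nonneg_right ?_ h0
      linarith
  · have : 0 ≤ Real.log (2 * y) := Real.log_nonneg (by norm_cast; omega)
    positivity

lemma abs_sum_sub_le {f : ℕ → ℝ} {B : ℝ} {y : ℕ} (h1 : |∑ n ∈ Finset.Ioc 0 y, f n| ≤ B)
    (h2 : |∑ n ∈ Finset.Ioc 0 (2 * y), f n| ≤ B) : |∑ n ∈ Finset.Ioc y (2 * y), f n| ≤ 2 * B := by
  have e : Finset.Ioc 0 (2 * y) = Finset.Ioc 0 y ∪ Finset.Ioc y (2 * y) :=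
    (Finset.Ioc_union_Ioc_eq_Ioc (Nat.zero_le _) (by omega)).symm
  have hd : Disjoint (Finset.Ioc 0 y) (Finset.Ioc y (2 * y)) :=
    Finset.disjoint_left.2 fun n h h' => by simp at h h'; omega
  rw [e, Finset.sum_union hd] at h2
  rw [abs_le] at *
  constructor <;> linarith [h1.1, h1.2, h2.1, h2.2]

lemma levelMass_mul_le {p D U y : ℕ} (hp : p.Prime) (hU : 0 < U) (hUD : U ≤ D)
    (hpD : 4 * p ≤ D) (hDy : D ^ 2 * U ≤ y) (hDy' : 4 * D ≤ y)
    (hmain : (y : ℝ) / 2 ≤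
      ∑ n ∈ Finset.Ioc y (2 * y), vonMangoldt n * (1 - (oddJacobi p n : ℝ))) :
    levelMass D * (y / 2 - 4 * √(2 * y) * Real.log (2 * y)) ≤
      2 * Real.log (2 * y) * (primePairs p D y).card +
      16 * D * (√(2 * y) * Real.log (2 * y)) +
      4 * (160 * p * D * U ^ 2 * (1 + Real.log (2 * y)) +
        4096 * (1 + Real.log (2 * y)) ^ 5 * (2 * y / √U)) := by
  have hp0 := hp.two_le
  have hy2 : 2 ≤ y := by omega
  have hy2' : (2 : ℝ) ≤ y := by exact_mod_cast hy2
  have hP : ∀ l ∈ levelPrimes D, l.Prime ∧ D < l ∧ l ≤ 4 * D := fun l hl => by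
    obtain ⟨h1, h2⟩ := mem_levelPrimes.1 hl
    exact ⟨h2, h1⟩
  set E := 2 * √(2 * y) * Real.log (2 * y) with hE
  set V := 160 * p * D * U ^ 2 * (1 + Real.log (2 * y)) +
        4096 * (1 + Real.log (2 * y)) ^ 5 * (2 * y / √U) with hV
  set F : ℕ → ℝ := fun n => ∑ l ∈ levelPrimes D, apDisc l n with hF
  set g : ℕ → ℝ := fun n => (oddJacobi p n : ℝ) with hg
  have hLnn : 0 ≤ Real.log (y : ℝ) := Real.log_nonneg (by linarith)
  have hLle : Real.log (y : ℝ) ≤ Real.log (2 * y) := Real.log_le_log (by linarith) (by linarith)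
  have hVle : ∀ (Q Y : ℕ), (Q : ℝ) ≤ 4 * p → (Y : ℝ) ≤ 2 * y → (0 : ℝ) < Y → 0 ≤ Real.log Y →
      40 * Q * D * (U : ℝ) ^ 2 * (1 + Real.log Y) + 4096 * (1 + Real.log Y) ^ 5 * (Y / √U) ≤ V := by
    intro Q Y hQ hY hY0 hY1
    have hl : Real.log Y ≤ Real.log (2 * y) := Real.log_le_log hY0 hY
    rw [hV]
    refine add_le_add ?_ ?_
    · have : 40 * (Q : ℝ) ≤ 160 * p := by linarith
      gcongr
    · gcongr
      exact mul_nonneg (by norm_num) (pow_nonneg (by linarith) _)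
  have hg1 := isBoundedPeriodicMul_oddJacobi hp
  have hone := isBoundedPeriodicMul_one
  have hp0' : (2 : ℝ) ≤ p := by exact_mod_cast hp0
  have hg2 : ∀ Y : ℕ, (Y = y ∨ Y = 2 * y) →
      |∑ n ∈ Finset.Ioc 0 Y, vonMangoldt n * (g n * F n)| ≤ V ∧
      |∑ n ∈ Finset.Ioc 0 Y, vonMangoldt n * (1 * F n)| ≤ V := by
    intro Y hY
    have hYy : y ≤ Y ∧ Y ≤ 2 * y := by omega
    have hY1 : (1 : ℝ) ≤ Y := by exact_mod_cast (by omega : 1 ≤ Y)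
    have hY2 : (Y : ℝ) ≤ 2 * y := by exact_mod_cast hYy.2
    constructor
    · exact (abs_sum_vonMangoldt_mul_apDisc_le hg1 hP hU hUD hpD (hDy.trans hYy.1)).trans
        (hVle _ _ (by push_cast; linarith) hY2 (by linarith) (Real.log_nonneg hY1))
    · exact (abs_sum_vonMangoldt_mul_apDisc_le hone hP hU hUD (by omega) (hDy.trans hYy.1)).trans
        (hVle _ _ (by push_cast; linarith) hY2 (by linarith) (Real.log_nonneg hY1))
  have hA1 := abs_sum_sub_le (hg2 y (Or.inl rfl)).1 (hg2 (2 * y) (Or.inr rfl)).1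
  have hA2 := abs_sum_sub_le (hg2 y (Or.inl rfl)).2 (hg2 (2 * y) (Or.inr rfl)).2
  have hA : -(4 * V) ≤ ∑ n ∈ Finset.Ioc y (2 * y), vonMangoldt n * (1 - g n) * F n := by
    have e : ∑ n ∈ Finset.Ioc y (2 * y), vonMangoldt n * (1 - g n) * F n =
        ∑ n ∈ Finset.Ioc y (2 * y), vonMangoldt n * (1 * F n) -
        ∑ n ∈ Finset.Ioc y (2 * y), vonMangoldt n * (g n * F n) := by
      rw [← Finset.sum_sub_distrib]
      exact Finset.sum_congr rfl fun n _ => by ring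
    rw [e]
    linarith [(abs_le.1 hA1).2, (abs_le.1 hA2).1]
  have hcard : ((levelPrimes D).card : ℝ) ≤ 4 * D := by
    have : (levelPrimes D).card ≤ 4 * D := by
      refine (Finset.card_filter_le _ _).trans ?_
      rw [Nat.card_Ioc]; omega
    exact_mod_cast this
  have hEsum := sum_not_prime_vonMangoldt_le (y := y) (by omega)
  have hgle : ∀ n, 0 ≤ 1 - g n ∧ 1 - g n ≤ 2 := fun n => by
    have := abs_le.1 (hg1.abs_le_one n)
    constructor <;> linarith [this.1, this.2]
  have hFle : ∀ n, F n ≤ 4 * D := fun n => by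
    refine le_trans (Finset.sum_le_sum (g := fun _ => (1 : ℝ)) fun l hl =>
      (le_abs_self _).trans (abs_apDisc_le_one (hP l hl).1 n)) ?_
    rw [Finset.sum_const, nsmul_eq_mul, mul_one]
    exact hcard
  have hnp1 : ∑ n ∈ (Finset.Ioc y (2 * y)).filter (fun n => ¬ n.Prime),
      vonMangoldt n * (1 - g n) ≤ 2 * E := by
    refine le_trans (Finset.sum_le_sum (g := fun n => 2 * vonMangoldt n) fun n _ => ?_) ?_
    · nlinarith [(hgle n).2, vonMangoldt_nonneg (n := n)]
    · rw [← Finset.mul_sum]; linarith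
  have hnp2 : ∑ n ∈ (Finset.Ioc y (2 * y)).filter (fun n => ¬ n.Prime),
      vonMangoldt n * (1 - g n) * F n ≤ 8 * D * E := by
    calc _ ≤ ∑ n ∈ (Finset.Ioc y (2 * y)).filter (fun n => ¬ n.Prime),
          vonMangoldt n * (1 - g n) * (4 * D) := Finset.sum_le_sum fun n _ =>
          mul_le_mul_of_nonneg_left (hFle n) (mul_nonneg vonMangoldt_nonneg (hgle n).1)
      _ = (∑ n ∈ (Finset.Ioc y (2 * y)).filter (fun n => ¬ n.Prime),
          vonMangoldt n * (1 - g n)) * (4 * D) := by rw [Finset.sum_mul]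
      _ ≤ 2 * E * (4 * D) := mul_le_mul_of_nonneg_right hnp1 (by positivity)
      _ = _ := by ring
  rw [← Finset.sum_filter_add_sum_filter_not _ Nat.Prime] at hA hmain
  have hprime : ∑ n ∈ (Finset.Ioc y (2 * y)).filter Nat.Prime, vonMangoldt n * (1 - g n) * F n =
      ∑ n ∈ (Finset.Ioc y (2 * y)).filter Nat.Prime, vonMangoldt n * (1 - g n) *
        ∑ l ∈ levelPrimes D, (if l ∣ n - 1 then (1 : ℝ) else 0) - levelMass D *
      ∑ n ∈ (Finset.Ioc y (2 * y)).filter Nat.Prime, vonMangoldt n * (1 - g n) := by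
    rw [Finset.mul_sum, ← Finset.sum_sub_distrib]
    refine Finset.sum_congr rfl fun n hn => ?_
    obtain ⟨hn1, hn2⟩ := Finset.mem_filter.1 hn
    have hn3 := (Finset.mem_Ioc.1 hn1).1
    have : F n = ∑ l ∈ levelPrimes D, (if l ∣ n - 1 then (1 : ℝ) else 0) - levelMass D := by
      rw [levelMass, ← Finset.sum_sub_distrib]
      refine Finset.sum_congr rfl fun l hl => ?_
      obtain ⟨h1, h2, h3⟩ := hP l hl
      exact apDisc_prime hn2 h1 (by omega)
    rw [this]; ring
  have hB := sum_mul_dvd_le_primePairs (D := D) hp (by omega) hy2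
  have hS0 : 0 ≤ levelMass D := Finset.sum_nonneg fun l hl => by
    have : (1 : ℝ) ≤ l := by exact_mod_cast (hP l hl).1.one_lt.le
    have : (0 : ℝ) ≤ (l : ℝ) - 1 := by linarith
    positivity
  have hM : (y : ℝ) / 2 - 2 * E ≤
      ∑ n ∈ (Finset.Ioc y (2 * y)).filter Nat.Prime, vonMangoldt n * (1 - g n) := by linarith
  have := mul_le_mul_of_nonneg_left hM hS0
  have e1 : (y : ℝ) / 2 - 4 * √(2 * y) * Real.log (2 * y) = y / 2 - 2 * E := by rw [hE]; ring
  have e2 : 16 * D * (√(2 * y) * Real.log (2 * y)) = 8 * D * E := by rw [hE]; ring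
  rw [e1, e2]
  linarith

end PrimePairs

lemma exists_forall_mul_log_pow_le (K c : ℝ) (n : ℕ) :
    ∃ w₀ : ℕ, ∀ w : ℕ, w₀ ≤ w → K * (1 + c * Real.log w) ^ n ≤ √w := by
  have h1 : (fun x : ℝ => (1 + c * (2 * Real.log x)) ^ n) =O[Filter.atTop]
      (fun x : ℝ => Real.log x ^ n) := by
    refine Asymptotics.IsBigO.pow ?_ n
    refine Asymptotics.IsBigO.add ?_ ?_
    · exact (Real.isLittleO_const_log_atTop).isBigO
    · simp only [← mul_assoc]
      exact Asymptotics.isBigO_const_mul_self _ _ _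
  have h2 := (h1.trans_isLittleO (Real.isLittleO_pow_log_id_atTop (n := n))).const_mul_left K
  have h3 := h2.bound (c := 1) one_pos
  have h4 : Filter.Tendsto (fun w : ℕ => √(w : ℝ)) Filter.atTop Filter.atTop :=
    Real.tendsto_sqrt_atTop.comp tendsto_natCast_atTop_atTop
  obtain ⟨w₀, hw₀⟩ := Filter.eventually_atTop.1 (h4.eventually h3)
  refine ⟨w₀, fun w hw => ?_⟩
  have h5 := hw₀ w hw
  rw [Real.log_sqrt (Nat.cast_nonneg w), mul_div_cancel₀ _ (two_ne_zero), one_mul, id,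
    Real.norm_of_nonneg (Real.sqrt_nonneg _)] at h5
  exact (Real.le_norm_self _).trans h5

lemma theta_sub_theta_le_card_levelPrimes (D : ℕ) :
    Chebyshev.theta (4 * D : ℕ) - Chebyshev.theta D ≤
      (levelPrimes D).card * Real.log (4 * D) := by
  unfold Chebyshev.theta
  rw [Nat.floor_natCast, Nat.floor_natCast, sub_le_iff_le_add']
  have e : (Finset.Ioc 0 (4 * D)).filter Nat.Prime =
      (Finset.Ioc 0 D).filter Nat.Prime ∪ levelPrimes D := by
    rw [levelPrimes, ← Finset.filter_union, Finset.Ioc_union_Ioc_eq_Ioc (Nat.zero_le _) (by omega)]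
  rw [e]
  have hd : Disjoint ((Finset.Ioc 0 D).filter Nat.Prime) (levelPrimes D) :=
    Finset.disjoint_left.2 fun l hl hl' => by
      have h1 := (Finset.mem_Ioc.1 (Finset.mem_filter.1 hl).1).2
      have h2 := (mem_levelPrimes.1 hl').1.1
      omega
  rw [Finset.sum_union hd, ← nsmul_eq_mul]
  refine add_le_add le_rfl (Finset.sum_le_card_nsmul _ _ _ fun l hl => ?_)
  obtain ⟨⟨_, h2⟩, h3⟩ := mem_levelPrimes.1 hl
  exact Real.log_le_log (by exact_mod_cast h3.pos) (by exact_mod_cast h2)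

lemma exists_le_card_levelPrimes :
    ∃ D₀ : ℕ, ∀ D : ℕ, D₀ ≤ D → (D : ℝ) ≤ (levelPrimes D).card * Real.log (4 * D) := by
  obtain ⟨w₀, hw₀⟩ := exists_forall_mul_log_pow_le 100 1 1
  refine ⟨w₀ + 4, fun D hD => ?_⟩
  have h1 := theta_sub_theta_le_card_levelPrimes D
  have h2 := Chebyshev.theta_le_log4_mul_x (x := D) (Nat.cast_nonneg D)
  have h3 := Chebyshev.theta_ge (4 * D)
  have h4 := hw₀ (4 * D) (by omega)
  have hD4 : (4 : ℝ) ≤ D := by exact_mod_cast (by omega : 4 ≤ D)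
  have e4 : Real.log 4 = 2 * Real.log 2 := by
    rw [show (4 : ℝ) = 2 ^ 2 by norm_num, Real.log_pow]; norm_num
  rw [pow_one, one_mul] at h4
  push_cast at *
  have hl2 := Real.log_two_gt_d9
  have hl2' := Real.log_two_lt_d9
  have hlog1 : Real.log (4 * D + 1) ≤ 1 + Real.log (4 * D) := by
    have : Real.log (4 * D + 1) ≤ Real.log (4 * D * 2) :=
      Real.log_le_log (by positivity) (by linarith)
    rw [Real.log_mul (by positivity) (by norm_num)] at this
    linarith
  have hs0 : 0 ≤ √(4 * D : ℝ) := Real.sqrt_nonneg _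
  have hs := Real.mul_self_sqrt (show (0 : ℝ) ≤ 4 * D by positivity)
  have hs1 : 1 ≤ √(4 * D : ℝ) := Real.one_le_sqrt.2 (by linarith)
  have h5 : √(4 * D : ℝ) * (1 + Real.log (4 * D)) ≤ 4 * D / 100 := by nlinarith
  have h6 : 0 ≤ Real.log (4 * D : ℝ) := Real.log_nonneg (by linarith)
  rw [e4] at h2
  nlinarith

lemma card_div_le_levelMass (D : ℕ) : ((levelPrimes D).card : ℝ) / (4 * D) ≤ levelMass D := by
  rw [levelMass, div_eq_mul_one_div, ← nsmul_eq_mul, ← Finset.sum_const]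
  refine Finset.sum_le_sum fun l hl => ?_
  obtain ⟨⟨h1, h2⟩, h3⟩ := mem_levelPrimes.1 hl
  have h4 : (1 : ℝ) < l := by exact_mod_cast h3.one_lt
  have h5 : (l : ℝ) ≤ 4 * D := by exact_mod_cast h2
  exact one_div_le_one_div_of_le (by linarith) (by linarith)

/-- The primes `r` in `(y, 2 * y]` such that `p` is not a square modulo `r` and `r - 1` has no
prime factor larger than `4 * D`. -/
noncomputable def smoothPrimes (p D y : ℕ) : Finset ℕ :=
  (Finset.Ioc y (2 * y)).filter
    (fun r => r.Prime ∧ oddJacobi p r = -1 ∧ ∀ s, s.Prime → s ∣ r - 1 → s ≤ 4 * D)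

lemma two_pow_card_primeFactors_le {n : ℕ} (hn : 0 < n) : 2 ^ n.primeFactors.card ≤ n :=
  (Finset.pow_card_le_prod _ _ _ fun _ hq => (Nat.prime_of_mem_primeFactors hq).two_le).trans
    (Nat.le_of_dvd hn (Nat.prod_primeFactors_dvd n))

lemma card_primePairs_le (p D y : ℕ) : ((primePairs p D y).card : ℝ) ≤
    (roughPairs D y).card + 2 * Real.log (2 * y) * (smoothPrimes p D y).card := by
  have hsub : primePairs p D y ⊆ roughPairs D y ∪ (smoothPrimes p D y).biUnion
      (fun r => ((r - 1).primeFactors).image (fun l => (l, r))) := by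
    rintro ⟨l, r⟩ hx
    obtain ⟨hx1, hr, hj, hlr⟩ := Finset.mem_filter.1 hx
    obtain ⟨hl, hry⟩ := Finset.mem_product.1 hx1
    dsimp only at hr hj hlr hl hry
    rw [Finset.mem_union]
    by_cases hs : ∃ s, s.Prime ∧ 4 * D < s ∧ s ∣ r - 1
    · left
      exact Finset.mem_filter.2 ⟨hx1, hr, hlr, hs⟩
    · right
      push Not at hs
      refine Finset.mem_biUnion.2 ⟨r, Finset.mem_filter.2 ⟨hry, hr, hj, fun s h1 h2 => ?_⟩,
        Finset.mem_image.2 ⟨l, ?_, rfl⟩⟩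
      · by_contra h3
        exact hs s h1 (not_le.1 h3) h2
      · exact Nat.mem_primeFactors.2 ⟨(mem_levelPrimes.1 hl).2, hlr, by
          have := hr.two_le; omega⟩
  have h1 := (Finset.card_le_card hsub).trans (Finset.card_union_le _ _)
  have h2 : (((smoothPrimes p D y).biUnion
      (fun r => ((r - 1).primeFactors).image (fun l => (l, r)))).card : ℝ) ≤
      2 * Real.log (2 * y) * (smoothPrimes p D y).card := by
    have h3 : (((smoothPrimes p D y).biUnion
        (fun r => ((r - 1).primeFactors).image (fun l => (l, r)))).card : ℝ) ≤
        ∑ r ∈ smoothPrimes p D y, ((r - 1).primeFactors.card : ℝ) := by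
      exact_mod_cast Finset.card_biUnion_le.trans (Finset.sum_le_sum fun r _ =>
        Finset.card_image_le)
    refine h3.trans ((Finset.sum_le_card_nsmul _ _ (2 * Real.log (2 * y)) fun r hr => ?_).trans
      (le_of_eq ?_))
    · obtain ⟨hr1, hr2, -⟩ := Finset.mem_filter.1 hr
      have hr0 := hr2.two_le
      have h4 := two_pow_card_primeFactors_le (n := r - 1) (by omega)
      have h5 : (2 : ℝ) ^ (r - 1).primeFactors.card ≤ 2 * y := by
        exact_mod_cast h4.trans (by have := (Finset.mem_Ioc.1 hr1).2; omega)
      have h6 := Real.log_le_log (by positivity) h5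
      rw [Real.log_pow] at h6
      have := Real.log_two_gt_d9
      have h7 : (0 : ℝ) ≤ ((r - 1).primeFactors.card : ℝ) := Nat.cast_nonneg _
      nlinarith
    · rw [nsmul_eq_mul, mul_comm]
  have h1' : ((primePairs p D y).card : ℝ) ≤ (roughPairs D y).card +
      (((smoothPrimes p D y).biUnion
        (fun r => ((r - 1).primeFactors).image (fun l => (l, r)))).card : ℝ) := by
    exact_mod_cast h1
  linarith

lemma mul_le_of_levelMass_bound {y s D w q lam S N p r : ℝ} (hy : y = s ^ 2) (hs : 0 < s)
    (hr : r ≤ 2 * s) (hq : q ^ 2 = w) (hD : 0 ≤ D) (hDw : D * w ^ 2 ≤ s)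
    (hws : w ≤ s) (hK : 4194304 * p * lam ^ 6 ≤ q) (hp : 1 ≤ p) (hlam : 1 ≤ lam)
    (hS : 1 / (4 * lam) ≤ S)
    (h : S * (y / 2 - 4 * r * (lam - 1)) ≤ 2 * (lam - 1) * N + 16 * D * (r * (lam - 1)) +
      4 * (160 * p * D * w ^ 2 * lam + 4096 * lam ^ 5 * (2 * y / q))) :
    S * y / 4 ≤ 2 * (lam - 1) * N := by
  have hlam0 : 0 < lam := by linarith
  have hl2 : lam ^ 2 ≤ lam ^ 6 := pow_le_pow_right₀ hlam (by norm_num)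
  have hl1 : lam ≤ lam ^ 6 := le_self_pow₀ hlam (by norm_num)
  have hp6 : lam ^ 6 ≤ p * lam ^ 6 := le_mul_of_one_le_left (by positivity) hp
  have hp2 : p * lam ^ 2 ≤ p * lam ^ 6 := mul_le_mul_of_nonneg_left hl2 (by linarith)
  have h61 : 1 ≤ lam ^ 6 := one_le_pow₀ hlam
  have hq1 : 1 ≤ q := by nlinarith
  have hqw : q ≤ w := by rw [← hq]; nlinarith
  have hw1 : 1 ≤ w := hq1.trans hqw
  have hSp : 0 < S := lt_of_lt_of_le (by positivity) hS
  have hy0 : 0 < y := by rw [hy]; positivity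
  have hDq : D * q ≤ s := by
    refine le_trans (mul_le_mul_of_nonneg_left ?_ hD) hDw
    nlinarith
  have t0 : S * (4 * r * (lam - 1)) ≤ S * (y / 8) := by
    refine mul_le_mul_of_nonneg_left ?_ hSp.le
    have h1 : 4 * r * (lam - 1) ≤ 4 * (2 * s) * lam := by gcongr; linarith
    have h2 : 64 * lam ≤ s := by linarith
    rw [hy]
    nlinarith
  have t1 : 16 * D * (r * (lam - 1)) ≤ y / (128 * lam) := by
    rw [le_div_iff₀ (by positivity)]
    have h1 : 16 * D * (r * (lam - 1)) ≤ 16 * D * (2 * s * lam) := by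
      gcongr; linarith
    have h2 : D * (4096 * lam ^ 2) ≤ s :=
      (mul_le_mul_of_nonneg_left (by linarith) hD).trans hDq
    calc 16 * D * (r * (lam - 1)) * (128 * lam) ≤ 16 * D * (2 * s * lam) * (128 * lam) := by gcongr
      _ = s * (D * (4096 * lam ^ 2)) := by ring
      _ ≤ s * s := by gcongr
      _ = y := by rw [hy]; ring
  have t2 : 4 * (160 * p * D * w ^ 2 * lam) ≤ y / (128 * lam) := by
    rw [le_div_iff₀ (by positivity)]
    have h2 : 81920 * (p * lam ^ 2) ≤ s := by linarith
    calc 4 * (160 * p * D * w ^ 2 * lam) * (128 * lam)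
        = D * w ^ 2 * (81920 * (p * lam ^ 2)) := by ring
      _ ≤ s * s := by gcongr
      _ = y := by rw [hy]; ring
  have t3 : 4 * (4096 * lam ^ 5 * (2 * y / q)) ≤ y / (128 * lam) := by
    have hq0 : 0 < q := by linarith
    rw [le_div_iff₀ (by positivity)]
    have e : 4 * (4096 * lam ^ 5 * (2 * y / q)) * (128 * lam) = 4194304 * lam ^ 6 * y / q := by
      field_simp; ring
    rw [e, div_le_iff₀ hq0, mul_comm y q]
    refine mul_le_mul_of_nonneg_right ?_ hy0.le
    linarith
  have t4 : y / (128 * lam) = 1 / (4 * lam) * (y / 32) := by field_simp; ring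
  have t5 : 1 / (4 * lam) * (y / 32) ≤ S * (y / 32) :=
    mul_le_mul_of_nonneg_right hS (by positivity)
  have t6 : 0 ≤ S * y := by positivity
  rw [t4] at t1 t2 t3
  linarith

lemma two_mul_roughBound_le {y D lw L T20 J h w : ℝ} (hh : 4194304 ≤ h) (hlw : 1 ≤ lw)
    (hL : L ≤ 81 * h * lw) (hy : 0 < y) (hD : 0 < D) (hJ : J * T20 * D * w ≤ y)
    (hJ0 : 0 ≤ J * T20) (hLw : 128 * L ≤ w) :
    2 * L * (64 * (1 + 5 * lw) * (y / (D * (h * lw) ^ 2)) + J * T20) ≤ y / (32 * D) := by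
  have hlw0 : 0 < lw := by linarith
  have hh0 : 0 < h := by linarith
  have h1 : 2 * L * (64 * (1 + 5 * lw) * (y / (D * (h * lw) ^ 2))) ≤ y / (64 * D) := by
    calc 2 * L * (64 * (1 + 5 * lw) * (y / (D * (h * lw) ^ 2)))
        ≤ 2 * (81 * h * lw) * (64 * (lw + 5 * lw) * (y / (D * (h * lw) ^ 2))) := by gcongr
      _ = 62208 * y / (D * h) := by field_simp; ring
      _ ≤ y / (64 * D) := by
        rw [div_le_div_iff₀ (by positivity) (by positivity)]
        nlinarith [mul_pos hy hD]
  have h2 : 2 * L * (J * T20) ≤ y / (64 * D) := by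
    rw [le_div_iff₀ (by positivity)]
    calc 2 * L * (J * T20) * (64 * D) = J * T20 * D * (128 * L) := by ring
      _ ≤ J * T20 * D * w := by gcongr
      _ ≤ y := hJ
  have h3 : y / (64 * D) + y / (64 * D) = y / (32 * D) := by field_simp; ring
  rw [mul_add]
  linarith

set_option maxHeartbeats 1000000 in
/-- There are many primes `r` in a dyadic interval near `w ^ (80 * h)` such that `p` is not a
square modulo `r` and all prime factors of `r - 1` are at most `4 * w ^ (40 * h - 2)`. -/
theorem exists_le_card_smoothPrimes {p : ℕ} (hp : p.Prime) {h : ℕ} (hh : 4194304 ≤ h) :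
    ∃ C w₀ : ℕ, 0 < C ∧ ∀ w : ℕ, w₀ ≤ w → ∃ y : ℕ, w ^ (80 * h) ≤ y ∧ y ≤ C * w ^ (80 * h) ∧
      (y : ℝ) ≤ 128 * Real.log (2 * y) ^ 3 * (smoothPrimes p (w ^ (40 * h - 2)) y).card := by
  obtain ⟨i₀, hi₀⟩ := exists_dyadic_sum_vonMangoldt_ge hp
  obtain ⟨w₁, hw₁⟩ := exists_forall_mul_log_pow_le (4194304 * p) (80 * h + 1) 6
  obtain ⟨D₀, hD₀⟩ := exists_le_card_levelPrimes
  refine ⟨2 ^ i₀, w₁ + D₀ + 2 * 2 ^ i₀ + 4 * p + 10, by positivity, fun w hw => ?_⟩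
  have hw10 : 10 ≤ w := by omega
  have hw0 : 0 < w := by omega
  obtain ⟨j, hj, hmain⟩ := hi₀ (w ^ (80 * h)) (by positivity)
  obtain ⟨y, hydef⟩ : ∃ y, y = 2 ^ j * w ^ (80 * h) := ⟨_, rfl⟩
  rw [← hydef] at hmain
  have hyl : w ^ (80 * h) ≤ y := hydef ▸ Nat.le_mul_of_pos_left _ (by positivity)
  have hyu : y ≤ 2 ^ i₀ * w ^ (80 * h) := hydef ▸
    Nat.mul_le_mul_right _ (Nat.pow_le_pow_right (by norm_num) hj.le)
  refine ⟨y, hyl, hyu, ?_⟩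
  have h2y : 2 * y ≤ w * w ^ (80 * h) := by
    calc 2 * y ≤ 2 * (2 ^ i₀ * w ^ (80 * h)) := Nat.mul_le_mul_left _ hyu
      _ = 2 * 2 ^ i₀ * w ^ (80 * h) := by ring
      _ ≤ w * w ^ (80 * h) := Nat.mul_le_mul_right _ (by omega)
  obtain ⟨D, hDdef⟩ : ∃ D, D = w ^ (40 * h - 2) := ⟨_, rfl⟩
  rw [← hDdef]
  have hDw : D * w ^ 2 = w ^ (40 * h) := by
    rw [hDdef, ← pow_add]; congr 1; omega
  have hsq : (w ^ (40 * h)) ^ 2 = w ^ (80 * h) := by rw [← pow_mul]; congr 1; ring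
  have hwD : w ≤ D := by
    rw [hDdef]; exact Nat.le_self_pow (by omega) w
  have hDD : D ^ 2 * w ^ 4 = w ^ (80 * h) := by
    rw [← hsq, ← hDw]; ring
  have hDy : D ^ 2 * w ≤ y := by
    refine le_trans (Nat.mul_le_mul_left _ (Nat.le_self_pow (n := 4) (by norm_num) w)) ?_
    rw [hDD]; exact hyl
  have h4D : 4 * D ≤ y := by
    calc 4 * D ≤ D ^ 2 * w := by nlinarith
      _ ≤ y := hDy
  have hy1 : 1 ≤ y := by omega
  -- real versions
  have hwR : (10 : ℝ) ≤ w := by exact_mod_cast hw10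
  have hyR : (0 : ℝ) < y := by exact_mod_cast hy1
  have hDR : (0 : ℝ) < D := by exact_mod_cast (by omega : 0 < D)
  set lw := Real.log w with hlw
  have hlw1 : 1 ≤ lw := by
    rw [hlw, Real.le_log_iff_exp_le (by linarith)]
    linarith [Real.exp_one_lt_d9]
  set L := Real.log (2 * y) with hL
  have hLlw : L ≤ (80 * h + 1) * lw := by
    have h1 : (2 * y : ℝ) ≤ (w : ℝ) ^ (80 * h + 1) := by
      have : 2 * y ≤ w ^ (80 * h + 1) := h2y.trans_eq (by ring)
      exact_mod_cast this
    have h2 := Real.log_le_log (by positivity) h1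
    rw [Real.log_pow] at h2
    push_cast at h2
    exact h2
  have hyR1 : (1 : ℝ) ≤ y := by exact_mod_cast hy1
  have hL0 : 0 ≤ L := Real.log_nonneg (by linarith)
  have hhR : (4194304 : ℝ) ≤ h := by exact_mod_cast hh
  have hpR : (1 : ℝ) ≤ p := by exact_mod_cast hp.one_lt.le
  have hK : 4194304 * (p : ℝ) * (1 + L) ^ 6 ≤ √(w : ℝ) := by
    refine le_trans ?_ (hw₁ w (by omega))
    gcongr
  have hq := Real.sq_sqrt (show (0 : ℝ) ≤ w by linarith)
  have hlog4D : Real.log (4 * D) ≤ L :=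
    Real.log_le_log (by positivity) (by exact_mod_cast (by omega : 4 * D ≤ 2 * y))
  have hcard := hD₀ D (by omega)
  set Pc : ℝ := ((levelPrimes D).card : ℝ) with hPc
  have hPc0 : 0 ≤ Pc := Nat.cast_nonneg _
  have hPcL : (D : ℝ) ≤ Pc * L := hcard.trans (mul_le_mul_of_nonneg_left hlog4D hPc0)
  have hSle := card_div_le_levelMass D
  rw [← hPc] at hSle
  have hS : 1 / (4 * (1 + L)) ≤ levelMass D := by
    refine le_trans ?_ hSle
    rw [div_le_div_iff₀ (by positivity) (by positivity)]
    nlinarith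
  have hmass := levelMass_mul_le hp hw0 hwD (by omega) hDy h4D hmain
  rw [← hL] at hmass
  have hsR : ((w ^ (40 * h) : ℕ) : ℝ) ≤ √(y : ℝ) := by
    refine Real.le_sqrt_of_sq_le ?_
    exact_mod_cast hsq.le.trans hyl
  have hDws : (D : ℝ) * (w : ℝ) ^ 2 ≤ √(y : ℝ) := by
    refine le_trans ?_ hsR
    exact_mod_cast hDw.le
  have hwsq : (w : ℝ) ≤ √(y : ℝ) := by
    refine le_trans ?_ hsR
    exact_mod_cast Nat.le_self_pow (by omega) w
  have hr : √(2 * y : ℝ) ≤ 2 * √(y : ℝ) := by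
    rw [Real.sqrt_mul (by norm_num)]
    refine mul_le_mul_of_nonneg_right ?_ (Real.sqrt_nonneg _)
    exact Real.sqrt_le_iff.2 ⟨by norm_num, by norm_num⟩
  have hpairs := mul_le_of_levelMass_bound (y := y) (s := √(y : ℝ)) (D := D) (w := w)
    (q := √(w : ℝ)) (lam := 1 + L) (S := levelMass D) (N := (primePairs p D y).card) (p := p)
    (r := √(2 * y : ℝ)) (Real.sq_sqrt hyR.le).symm (Real.sqrt_pos.2 hyR) hr hq
    hDR.le hDws hwsq hK hpR (by linarith) hS (by rw [add_sub_cancel_left]; exact hmass)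
  rw [add_sub_cancel_left] at hpairs
  have hpairs2 : Pc * y / (16 * D) ≤ 2 * L * (primePairs p D y).card := by
    refine le_trans (le_of_eq ?_) ((div_le_div_of_nonneg_right
      (mul_le_mul_of_nonneg_right hSle hyR.le) (by norm_num)).trans hpairs)
    field_simp; ring
  -- rough pairs
  have hT2 : (w ^ h) ^ 2 ≤ D := by
    rw [← pow_mul, hDdef]; exact Nat.pow_le_pow_right hw0 (by omega)
  have hwT : w ≤ w ^ h := Nat.le_self_pow (by omega) w
  have hJ : 2 * y ≤ w ^ 5 * D ^ 2 := h2y.trans_eq (by rw [← hDD]; ring)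
  have hTD : (w ^ h) ^ 2 ≤ 4 * D := hT2.trans (Nat.le_mul_of_pos_left D (by norm_num))
  have hrough := card_roughPairs_le (D := D) (y := y) (T := w ^ h) (J := w ^ 5) (by omega)
    (le_trans (by omega) hwT) hTD (hTD.trans h4D) hJ
  push_cast at hrough
  rw [Real.log_pow, Real.log_pow, ← hlw, ← hPc] at hrough
  push_cast at hrough
  have h2L : L ≤ 81 * h * lw := by
    refine hLlw.trans (mul_le_mul_of_nonneg_right ?_ (by linarith))
    linarith
  have h128 : 128 * L ≤ w := by
    have h1 : 1 + L ≤ (1 + L) ^ 6 := le_self_pow₀ (by linarith) (by norm_num)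
    have h2 : (1 + L) ^ 6 ≤ p * (1 + L) ^ 6 := le_mul_of_one_le_left (by positivity) hpR
    have h3 : √(w : ℝ) ≤ w := Real.sqrt_le_iff.2 ⟨by linarith, by nlinarith⟩
    linarith
  have hbound := two_mul_roughBound_le (y := y) (D := D) (lw := lw) (L := L)
    (T20 := ((w : ℝ) ^ h) ^ 20) (J := (w : ℝ) ^ 5) (h := h) (w := w) hhR hlw1 h2L hyR hDR (by
      have h1 : w ^ 5 * (w ^ h) ^ 20 * D * w ≤ y := by
        refine le_trans (le_of_eq ?_) ((Nat.pow_le_pow_right hw0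
          (by omega : 5 + h * 20 + (40 * h - 2) + 1 ≤ 80 * h)).trans hyl)
        rw [pow_add, pow_add, pow_add, pow_mul, pow_one, hDdef]
      exact_mod_cast h1) (by positivity) h128
  have hpp := card_primePairs_le p D y
  rw [← hL] at hpp
  set N : ℝ := ((smoothPrimes p D y).card : ℝ) with hN
  have hfin : Pc * y / (32 * D) ≤ 4 * L ^ 2 * N := by
    have h1 := mul_le_mul_of_nonneg_left hpp (show 0 ≤ 2 * L by linarith)
    have h2 := mul_le_mul_of_nonneg_left hrough (show 0 ≤ 2 * L by linarith)
    have h3 := mul_le_mul_of_nonneg_left hbound hPc0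
    have e1 : Pc * (y / (32 * D)) = Pc * y / (32 * D) := by ring
    have e2 : Pc * y / (16 * D) = Pc * y / (32 * D) + Pc * y / (32 * D) := by field_simp; ring
    linarith
  rw [div_le_iff₀ (by positivity)] at hfin
  refine le_of_mul_le_mul_right ?_ hDR
  nlinarith [mul_le_mul_of_nonneg_right hPcL hyR.le, mul_le_mul_of_nonneg_left hfin hL0]

lemma natCast_pow_pow_two_mul_eq_one {p M d : ℕ} (hd : d ∣ p ^ M + 1) (j : ℕ) :
    ((p ^ j : ℕ) : ZMod d) ^ (2 * M) = 1 := by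
  have h : ((p ^ M + 1 : ℕ) : ZMod d) = 0 := (ZMod.natCast_eq_zero_iff _ _).2 hd
  push_cast at h ⊢
  have h' : (p : ZMod d) ^ M = -1 := eq_neg_of_add_eq_zero_left h
  rw [← pow_mul, mul_comm j, mul_assoc, mul_comm 2, mul_assoc, pow_mul, h', mul_comm, pow_mul]
  simp

lemma totient_prod_primes {T : Finset ℕ} (hT : ∀ r ∈ T, r.Prime) :
    Nat.totient (∏ r ∈ T, r) = ∏ r ∈ T, (r - 1) := by
  induction T using Finset.induction_on with
  | empty => simp
  | insert a T ha ih =>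
    have hT' : ∀ r ∈ T, r.Prime := fun r hr => hT r (Finset.mem_insert_of_mem hr)
    have hap := hT a (Finset.mem_insert_self _ _)
    rw [Finset.prod_insert ha, Finset.prod_insert ha, Nat.totient_mul, Nat.totient_prime hap,
      ih hT']
    refine Nat.Coprime.prod_right fun r hr => ?_
    exact (Nat.coprime_primes hap (hT' r hr)).2 fun e => ha (e ▸ hr)

/-- Lower bound for the sum of `φ(d) / ord_d(q)` obtained from products of `k` primes which all
divide `p ^ M + 1`. -/
lemma choose_mul_pow_le_sum {p M y k X : ℕ} (hM : 0 < M) (P : Finset ℕ)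
    (hP : ∀ r ∈ P, r.Prime ∧ y < r ∧ r ≤ 2 * y ∧ r ∣ p ^ M + 1) (hX : (2 * y) ^ k ≤ X) (j : ℕ) :
    (P.card.choose k : ℝ) * (y : ℝ) ^ k ≤ 2 * M *
      ∑ d ∈ (Finset.Icc 1 X).filter (fun d => ∃ n : ℕ, 1 ≤ n ∧ d ∣ p ^ n + 1),
        (Nat.totient d : ℝ) / (orderOf ((p ^ j : ℕ) : ZMod d) : ℝ) := by
  have hpr : ∀ T ∈ P.powersetCard k, ∀ r ∈ T, r.Prime := fun T hT r hr =>
    (hP r ((Finset.mem_powersetCard.1 hT).1 hr)).1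
  have hinj : Set.InjOn (fun T : Finset ℕ => ∏ r ∈ T, r) (P.powersetCard k : Set (Finset ℕ)) := by
    intro T hT T' hT' e
    have e' := congrArg Nat.primeFactors e
    dsimp only at e'
    rwa [Nat.primeFactors_prod (hpr T hT), Nat.primeFactors_prod (hpr T' hT')] at e'
  have hdvd : ∀ T ∈ P.powersetCard k, ∏ r ∈ T, r ∣ p ^ M + 1 := fun T hT =>
    Finset.prod_primes_dvd _ (fun r hr => (hpr T hT r hr).prime)
      (fun r hr => (hP r ((Finset.mem_powersetCard.1 hT).1 hr)).2.2.2)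
  have hsub : (P.powersetCard k).image (fun T => ∏ r ∈ T, r) ⊆
      (Finset.Icc 1 X).filter (fun d => ∃ n : ℕ, 1 ≤ n ∧ d ∣ p ^ n + 1) := by
    intro d hd
    obtain ⟨T, hT, rfl⟩ := Finset.mem_image.1 hd
    refine Finset.mem_filter.2 ⟨Finset.mem_Icc.2 ⟨?_, ?_⟩, M, hM, hdvd T hT⟩
    · exact Finset.prod_pos fun r hr => (hpr T hT r hr).pos
    · obtain ⟨hTP, hTk⟩ := Finset.mem_powersetCard.1 hT
      refine le_trans ?_ hX
      rw [← hTk]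
      exact Finset.prod_le_pow_card _ _ _ fun r hr => (hP r (hTP hr)).2.2.1
  have hM' : (0 : ℝ) < 2 * M := by positivity
  rw [← div_le_iff₀' hM']
  refine le_trans ?_ (Finset.sum_le_sum_of_subset_of_nonneg hsub fun _ _ _ => by positivity)
  rw [Finset.sum_image hinj]
  have hc : (P.card.choose k : ℝ) * (y : ℝ) ^ k / (2 * M) =
      ∑ _T ∈ P.powersetCard k, (y : ℝ) ^ k / (2 * M) := by
    rw [Finset.sum_const, Finset.card_powersetCard, nsmul_eq_mul, mul_div_assoc]
  rw [hc]
  refine Finset.sum_le_sum fun T hT => ?_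
  obtain ⟨hTP, hTk⟩ := Finset.mem_powersetCard.1 hT
  have hdM := hdvd T hT
  have h1 := natCast_pow_pow_two_mul_eq_one hdM j
  have hord : 0 < orderOf ((p ^ j : ℕ) : ZMod (∏ r ∈ T, r)) :=
    orderOf_pos_iff.2 (isOfFinOrder_iff_pow_eq_one.2 ⟨2 * M, by omega, h1⟩)
  have hle := orderOf_le_of_pow_eq_one (by omega) h1
  have hphi : y ^ k ≤ Nat.totient (∏ r ∈ T, r) := by
    rw [totient_prod_primes (hpr T hT), ← hTk]
    exact Finset.pow_card_le_prod _ _ _ fun r hr => by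
      have := (hP r (hTP hr)).2.1
      omega
  have hle' : (orderOf ((p ^ j : ℕ) : ZMod (∏ r ∈ T, r)) : ℝ) ≤ 2 * M := by exact_mod_cast hle
  have hphi' : (y : ℝ) ^ k ≤ (Nat.totient (∏ r ∈ T, r) : ℝ) := by exact_mod_cast hphi
  have hord' : (0 : ℝ) < (orderOf ((p ^ j : ℕ) : ZMod (∏ r ∈ T, r)) : ℝ) := by exact_mod_cast hord
  exact div_le_div₀ (by positivity) hphi' hord' hle'

lemma div_pow_le_choose {N k : ℕ} (h : 2 * k ≤ N) :
    ((N : ℝ) / (2 * k)) ^ k ≤ (N.choose k : ℝ) := by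
  rcases Nat.eq_zero_or_pos k with rfl | hk
  · simp
  refine le_trans ?_ (Nat.pow_le_choose k N)
  have h1 : ((k.factorial : ℕ) : ℝ) ≤ (k : ℝ) ^ k := by exact_mod_cast Nat.factorial_le_pow k
  have h2 : (N : ℝ) / 2 ≤ ((N + 1 - k : ℕ) : ℝ) := by
    rw [div_le_iff₀ (by norm_num)]
    exact_mod_cast (by omega : N ≤ (N + 1 - k) * 2)
  rw [← div_div, div_pow]
  have h3 : (0 : ℝ) < ((k.factorial : ℕ) : ℝ) := by exact_mod_cast Nat.factorial_pos k
  gcongr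

/-- The largest odd number that can be composed of prime powers `s ^ e ≤ z` with `s ≤ n`. -/
noncomputable def oddLcmBound (n z : ℕ) : ℕ :=
  ∏ s ∈ (Finset.Icc 3 n).filter Nat.Prime, s ^ Nat.log s z

lemma odd_oddLcmBound (n z : ℕ) : Odd (oddLcmBound n z) := by
  refine Finset.prod_induction _ Odd (fun _ _ => Odd.mul) odd_one fun s hs => ?_
  obtain ⟨h1, h2⟩ := Finset.mem_filter.1 hs
  have := (Finset.mem_Icc.1 h1).1
  exact (h2.odd_of_ne_two (by omega)).pow

lemma oddLcmBound_le {n z : ℕ} (hz : 0 < z) : oddLcmBound n z ≤ z ^ n := by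
  refine (Finset.prod_le_pow_card _ _ z fun s _ => Nat.pow_log_le_self s hz.ne').trans ?_
  refine Nat.pow_le_pow_right hz ((Finset.card_filter_le _ _).trans ?_)
  rw [Nat.card_Icc]; omega

lemma dvd_oddLcmBound {n z m : ℕ} (hm : Odd m) (hmz : m ≤ z)
    (hs : ∀ s, s.Prime → s ∣ m → s ≤ n) : m ∣ oddLcmBound n z := by
  have hm0 : m ≠ 0 := hm.pos.ne'
  have hprod : m = ∏ s ∈ m.primeFactors, s ^ m.factorization s :=
    (Nat.prod_factorization_pow_eq_self hm0).symm
  have hsub : m.primeFactors ⊆ (Finset.Icc 3 n).filter Nat.Prime := by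
    intro s h
    have hp := Nat.prime_of_mem_primeFactors h
    have hd := Nat.dvd_of_mem_primeFactors h
    refine Finset.mem_filter.2 ⟨Finset.mem_Icc.2 ⟨?_, hs s hp hd⟩, hp⟩
    have h2 : s ≠ 2 := by
      rintro rfl
      exact (Nat.not_even_iff_odd.2 hm) (even_iff_two_dvd.2 hd)
    have := hp.two_le
    omega
  rw [hprod]
  refine (Finset.prod_dvd_prod_of_dvd _ _ fun s h => ?_).trans
    (Finset.prod_dvd_prod_of_subset _ _ _ hsub)
  exact pow_dvd_pow s (Nat.le_log_of_pow_le (Nat.prime_of_mem_primeFactors h).one_lt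
    ((Nat.le_of_dvd hm.pos (Nat.ordProj_dvd m s)).trans hmz))

/-- Among the primes in `smoothPrimes p D y` a positive proportion, up to a logarithm, divides a
common `p ^ M + 1` with small `M`. -/
lemma exists_common_exponent (p D y : ℕ) (hy : 2 ≤ y) :
    ∃ (P : Finset ℕ) (M : ℕ), 0 < M ∧ 2 * M ≤ (2 * y) ^ (4 * D + 2) ∧
      (smoothPrimes p D y).card ≤ (Nat.log 2 (2 * y) + 1) * P.card ∧
      ∀ r ∈ P, r.Prime ∧ y < r ∧ r ≤ 2 * y ∧ r ∣ p ^ M + 1 := by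
  set S := smoothPrimes p D y with hS
  have hmem : ∀ r ∈ S, (y < r ∧ r ≤ 2 * y) ∧ r.Prime ∧ oddJacobi p r = -1 ∧
      ∀ s, s.Prime → s ∣ r - 1 → s ≤ 4 * D := fun r hr => by
    obtain ⟨h1, h2⟩ := Finset.mem_filter.1 hr
    exact ⟨Finset.mem_Ioc.1 h1, h2⟩
  have hmaps : ∀ r ∈ S, (r - 1).factorization 2 ∈ Finset.range (Nat.log 2 (2 * y) + 1) := by
    intro r hr
    obtain ⟨⟨h1, h2⟩, -⟩ := hmem r hr
    refine Finset.mem_range.2 (Nat.lt_succ_of_le (Nat.le_log_of_pow_le (by norm_num) ?_))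
    exact (Nat.le_of_dvd (by omega) (Nat.ordProj_dvd (r - 1) 2)).trans (by omega)
  obtain ⟨v, hv, hvS⟩ : ∃ v ∈ Finset.range (Nat.log 2 (2 * y) + 1), S.card ≤
      (Nat.log 2 (2 * y) + 1) * (S.filter fun r => (r - 1).factorization 2 = v).card := by
    by_contra! hcon
    have h := Finset.card_eq_sum_card_fiberwise (f := fun r => (r - 1).factorization 2)
      (s := S) (t := Finset.range (Nat.log 2 (2 * y) + 1)) hmaps
    have h2 : (Nat.log 2 (2 * y) + 1) * S.card < (Nat.log 2 (2 * y) + 1) * S.card := by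
      calc (Nat.log 2 (2 * y) + 1) * S.card
          = ∑ v ∈ Finset.range (Nat.log 2 (2 * y) + 1), (Nat.log 2 (2 * y) + 1) *
            (S.filter fun r => (r - 1).factorization 2 = v).card := by
              rw [← Finset.mul_sum, ← h]
        _ < ∑ v ∈ Finset.range (Nat.log 2 (2 * y) + 1), S.card :=
            Finset.sum_lt_sum_of_nonempty ⟨0, by simp⟩ hcon
        _ = _ := by simp
    exact lt_irrefl _ h2
  refine ⟨S.filter fun r => (r - 1).factorization 2 = v,
    2 ^ (v - 1) * oddLcmBound (4 * D) (2 * y), ?_, ?_, hvS, fun r hr => ?_⟩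
  · exact Nat.mul_pos (by positivity) (odd_oddLcmBound _ _).pos
  · have h1 : 2 ^ v ≤ 2 * y := Nat.pow_le_of_le_log (by omega) (by
      have := Finset.mem_range.1 hv; omega)
    have h2 : 2 ^ (v - 1) ≤ 2 * y := (Nat.pow_le_pow_right (by norm_num) (by omega)).trans h1
    calc 2 * (2 ^ (v - 1) * oddLcmBound (4 * D) (2 * y))
        ≤ (2 * y) * ((2 * y) * (2 * y) ^ (4 * D)) := by
          gcongr
          · omega
          · exact oddLcmBound_le (by omega)
      _ = _ := by ring
  · obtain ⟨hrS, hrv⟩ := Finset.mem_filter.1 hr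
    obtain ⟨⟨h1, h2⟩, hp, hj, hsm⟩ := hmem r hrS
    refine ⟨hp, h1, h2, ?_⟩
    have hodd : Odd r := hp.odd_of_ne_two (by omega)
    have h2r : 2 ∣ r - 1 := by obtain ⟨t, rfl⟩ := hodd; omega
    have hr1 : r - 1 ≠ 0 := by omega
    obtain ⟨m, hm⟩ := Nat.ordProj_dvd (r - 1) 2
    rw [hrv] at hm
    have hv1 : v ≠ 0 := by
      rw [← hrv]
      exact (Nat.prime_two.factorization_pos_of_dvd hr1 h2r).ne'
    have hmodd : Odd m := by
      rw [← Nat.not_even_iff_odd, even_iff_two_dvd]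
      rintro ⟨t, rfl⟩
      refine Nat.pow_succ_factorization_not_dvd hr1 Nat.prime_two ?_
      rw [hrv, hm]
      exact ⟨t, by ring⟩
    have hmd : m ∣ r - 1 := ⟨2 ^ v, by rw [hm]; ring⟩
    obtain ⟨c, hc⟩ := dvd_oddLcmBound (n := 4 * D) (z := 2 * y) hmodd
      ((Nat.le_of_dvd (by omega) hmd).trans (by omega))
      fun s hs hsd => hsm s hs (hsd.trans hmd)
    have hcodd : Odd c := by
      have := odd_oddLcmBound (4 * D) (2 * y)
      rw [hc] at this
      exact (Nat.odd_mul.1 this).2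
    obtain ⟨u, rfl⟩ := Nat.exists_eq_succ_of_ne_zero hv1
    have hhalf : (r - 1) / 2 = 2 ^ u * m := by
      rw [hm, Nat.succ_eq_add_one, pow_succ, mul_right_comm]
      exact Nat.mul_div_cancel _ (by norm_num)
    have hpow := pow_half_eq_neg_one hp hj
    rw [hhalf] at hpow
    rw [← ZMod.natCast_eq_zero_iff, hc]
    push_cast
    rw [← mul_assoc, pow_mul, hpow, hcodd.neg_one_pow]
    ring

lemma exists_four_mul_log_add_le (c : ℝ) {h : ℝ} (hh : 0 < h) :
    ∃ L₀ : ℝ, ∀ L, L₀ ≤ L → 4 * Real.log L + c ≤ L / (400 * h) ∧ 1 ≤ L ∧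
      Real.log 2 ≤ L / (800 * h) := by
  have h1 := Real.isLittleO_log_id_atTop.bound (show (0 : ℝ) < 1 / (4 * (800 * h)) by positivity)
  obtain ⟨L₀, hL₀⟩ := Filter.eventually_atTop.1 h1
  refine ⟨max L₀ (max 1 (max (c * (800 * h)) (Real.log 2 * (800 * h)))), fun L hL => ?_⟩
  simp only [max_le_iff] at hL
  obtain ⟨ha, hb, hc, hd⟩ := hL
  have h2 := hL₀ L ha
  rw [Real.norm_of_nonneg (Real.log_nonneg hb), id, Real.norm_of_nonneg (by linarith)] at h2
  refine ⟨?_, hb, (le_div_iff₀ (by positivity)).2 hd⟩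
  have h3 : c ≤ L / (800 * h) := (le_div_iff₀ (by positivity)).2 hc
  have e1 : 4 * (1 / (4 * (800 * h)) * L) = L / (800 * h) := by field_simp
  have e2 : L / (800 * h) + L / (800 * h) = L / (400 * h) := by field_simp; norm_num
  linarith

lemma exists_pow_le_lt_succ_pow {n : ℕ} (hn : n ≠ 0) {W : ℕ} {t : ℝ} (ht : (W : ℝ) ^ n ≤ t) :
    ∃ w : ℕ, W ≤ w ∧ (w : ℝ) ^ n ≤ t ∧ t < ((w : ℝ) + 1) ^ n := by
  have hex : ∃ v : ℕ, t < (v : ℝ) ^ n := by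
    obtain ⟨v, hv⟩ := exists_nat_gt (max t 1)
    rw [max_lt_iff] at hv
    exact ⟨v, hv.1.trans_le (le_self_pow₀ hv.2.le hn)⟩
  have hs := Nat.find_spec hex
  have hpos : 0 < Nat.find hex := by
    rcases Nat.eq_zero_or_pos (Nat.find hex) with h0 | h0
    · rw [h0, Nat.cast_zero, zero_pow hn] at hs
      have : (0 : ℝ) ≤ (W : ℝ) ^ n := by positivity
      linarith
    · exact h0
  have hm := Nat.find_min hex (Nat.sub_lt hpos one_pos)
  have hc : ((Nat.find hex - 1 : ℕ) : ℝ) + 1 = Nat.find hex := by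
    exact_mod_cast Nat.sub_add_cancel hpos
  refine ⟨Nat.find hex - 1, ?_, not_lt.1 hm, by rw [hc]; exact hs⟩
  have h3 : (W : ℝ) < Nat.find hex := lt_of_pow_lt_pow_left₀ n (by positivity) (ht.trans_lt hs)
  have h4 : W < Nat.find hex := by exact_mod_cast h3
  omega

lemma natLog_two_succ_le {z : ℕ} (hz : 0 < z) (hL : 1 ≤ Real.log z) :
    ((Nat.log 2 z + 1 : ℕ) : ℝ) ≤ 3 * Real.log z := by
  have h1 : ((2 : ℝ) ^ Nat.log 2 z) ≤ z := by exact_mod_cast Nat.pow_log_le_self 2 hz.ne'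
  have h2 := Real.log_le_log (by positivity) h1
  rw [Real.log_pow] at h2
  have h3 := Real.log_two_gt_d9
  push_cast
  nlinarith [(Nat.cast_nonneg (Nat.log 2 z) : (0 : ℝ) ≤ _)]

lemma le_log_div {h L lw N k A C y : ℝ} (hh : 1 ≤ h) (hN : 0 < N) (hk : 0 < k) (hy : 0 < y)
    (hL : L = Real.log (2 * y)) (hL1 : 1 ≤ L) (hlw : 80 * h * lw ≤ L)
    (hlC : L ≤ Real.log (2 * C) + 80 * h * lw) (hC : 1 ≤ C)
    (hNy : 2 * y ≤ 768 * L ^ 4 * N) (hkA : Real.log k ≤ Real.log A + (40 * h - 1) * lw)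
    (hbig : 4 * Real.log L + (Real.log 768 + Real.log 2 + Real.log A + Real.log (2 * C)) ≤
      L / (400 * h)) :
    L / 2 + L / (100 * h) ≤ Real.log (N / (2 * k)) := by
  have hL0 : 0 < L := by linarith
  have h1 := Real.log_le_log (by positivity) hNy
  rw [← hL, Real.log_mul (by positivity) hN.ne', Real.log_mul (by norm_num) (by positivity),
    Real.log_pow] at h1
  push_cast at h1
  rw [Real.log_div hN.ne' (by positivity), Real.log_mul (by norm_num) hk.ne']
  have hlC0 : 0 ≤ Real.log (2 * C) := Real.log_nonneg (by linarith)
  have h2 : (L - Real.log (2 * C)) / (80 * h) ≤ lw := by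
    rw [div_le_iff₀ (by positivity)]; linarith
  have h3 : Real.log (2 * C) / (80 * h) ≤ Real.log (2 * C) :=
    div_le_self hlC0 (by linarith)
  rw [sub_div] at h2
  have e : L / (80 * h) = L / (100 * h) + L / (400 * h) := by field_simp; norm_num
  linarith

lemma rpow_le_of_le_log {h L N k D y x : ℝ} {n m : ℕ} (hh : 1 ≤ h) (hx : 0 < x) (hy : 0 < y)
    (hN : 0 < N) (hk0 : 0 < k) (hL : L = Real.log (2 * y)) (hL1 : 1 ≤ L) (hn : (n : ℝ) = k)
    (hm : (m : ℝ) = 4 * D + 2) (hkx : Real.log x ≤ (k + 1) * L)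
    (hk : 400 * h * (4 * D + 4) ≤ k) (hL2 : Real.log 2 ≤ L / (800 * h))
    (hg : L / 2 + L / (100 * h) ≤ Real.log (N / (2 * k))) :
    x ^ (1 + (1 / 2 + 1 / (200 * h))) * (2 * y) ^ m ≤ (N / (2 * k)) ^ n * y ^ n := by
  have hh0 : 0 < h := by linarith
  have hz : 0 < N / (2 * k) := by positivity
  rw [← Real.log_le_log_iff (by positivity) (by positivity),
    Real.log_mul (by positivity) (by positivity), Real.log_mul (by positivity) (by positivity),
    Real.log_rpow hx, Real.log_pow, Real.log_pow, Real.log_pow, hn, hm, ← hL]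
  have hly : Real.log y = L - Real.log 2 := by
    rw [hL, Real.log_mul (by norm_num) hy.ne']; ring
  rw [hly]
  have hα : 1 + (1 / 2 + 1 / (200 * h)) ≤ 2 := by
    have : 1 / (200 * h) ≤ 1 / 2 := by
      rw [div_le_div_iff₀ (by positivity) (by norm_num)]; linarith
    linarith
  have h1 : (1 + (1 / 2 + 1 / (200 * h))) * Real.log x ≤
      (1 + (1 / 2 + 1 / (200 * h))) * ((k + 1) * L) :=
    mul_le_mul_of_nonneg_left hkx (by positivity)
  have h2 : (1 + (1 / 2 + 1 / (200 * h))) * L ≤ 2 * L :=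
    mul_le_mul_of_nonneg_right hα (by linarith)
  have h3 := mul_le_mul_of_nonneg_left hg hk0.le
  have h4 := mul_le_mul_of_nonneg_left hL2 hk0.le
  have h5 : (4 * D + 4) * L ≤ k * L / (400 * h) := by
    rw [le_div_iff₀ (by positivity)]
    nlinarith
  have h6 : 0 ≤ k * L / (800 * h) := by positivity
  have e : k * (L / (100 * h)) = k * L / (200 * h) + k * L / (400 * h) + k * L / (400 * h) := by
    field_simp; norm_num
  have e2 : k * (L / (800 * h)) = k * L / (800 * h) := by ring
  have e3 : k * L / (400 * h) = k * L / (800 * h) + k * L / (800 * h) := by field_simp; norm_num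
  have e4 : (1 + (1 / 2 + 1 / (200 * h))) * ((k + 1) * L) =
    k * L + k * L / 2 + k * L / (200 * h) + (1 + (1 / 2 + 1 / (200 * h))) * L := by ring
  linarith

lemma exists_rpow_le_sum {p : ℕ} (hp : p.Prime) {h : ℕ} (hh : 4194304 ≤ h) :
    ∃ x₀ : ℝ, 0 < x₀ ∧ ∀ (j : ℕ) (x : ℝ), x₀ ≤ x →
      x ^ (1 + (1 / 2 + 1 / (200 * (h : ℝ)))) ≤
        ∑ d ∈ (Finset.Icc 1 ⌊x⌋₊).filter (fun d => ∃ n : ℕ, 1 ≤ n ∧ d ∣ p ^ n + 1),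
          (Nat.totient d : ℝ) / (orderOf ((p ^ j : ℕ) : ZMod d) : ℝ) := by
  obtain ⟨C, w₀, hC, H⟩ := exists_le_card_smoothPrimes hp hh
  have hhR : (1 : ℝ) ≤ h := by exact_mod_cast (by omega : 1 ≤ h)
  obtain ⟨L₀, hL₀⟩ := exists_four_mul_log_add_le (Real.log 768 + Real.log 2 +
    Real.log ((2 : ℝ) ^ (40 * h - 1)) + Real.log (2 * C)) (h := h) (by linarith)
  obtain ⟨w₁, hw₁⟩ := exists_forall_mul_log_pow_le (3600 * h) (80 * h + 1) 1
  obtain ⟨n, hn⟩ : ∃ n, n = 40 * h - 1 := ⟨_, rfl⟩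
  have hn1 : n = (40 * h - 2) + 1 := by omega
  set W := w₀ + w₁ + 2 * C + ⌈Real.exp L₀⌉₊ + 2 with hW
  refine ⟨Real.exp ((W : ℝ) ^ n), Real.exp_pos _, fun j x hx => ?_⟩
  have hx0 : 0 < x := (Real.exp_pos _).trans_le hx
  obtain ⟨w, hWw, hwx, hxw⟩ := exists_pow_le_lt_succ_pow (by omega)
    ((Real.le_log_iff_exp_le hx0).2 hx)
  obtain ⟨y, hyl, hyu, hyS⟩ := H w (by omega)
  have hw2 : 2 ≤ w := by omega
  have hwR : (2 : ℝ) ≤ w := by exact_mod_cast hw2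
  obtain ⟨D, hD⟩ : ∃ D, D = w ^ (40 * h - 2) := ⟨_, rfl⟩
  rw [← hD] at hyS
  have hD1 : 1 ≤ D := hD ▸ Nat.one_le_pow _ _ (by omega)
  have hwy : w ≤ y := (Nat.le_self_pow (by omega) w).trans hyl
  have hy2 : 2 ≤ y := hw2.trans hwy
  have hyR : (2 : ℝ) ≤ y := by exact_mod_cast hy2
  have hDR : (1 : ℝ) ≤ D := by exact_mod_cast hD1
  have hCR : (1 : ℝ) ≤ C := by exact_mod_cast hC
  obtain ⟨L, hL⟩ : ∃ L, L = Real.log (2 * y) := ⟨_, rfl⟩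
  obtain ⟨lw, hlw⟩ : ∃ lw, lw = Real.log w := ⟨_, rfl⟩
  rw [← hL] at hyS
  have hlw0 : 0 ≤ lw := hlw ▸ Real.log_nonneg (by linarith)
  have hlL : 80 * h * lw ≤ L := by
    have h1 : (w : ℝ) ^ (80 * h) ≤ y := by exact_mod_cast hyl
    have h2 := Real.log_le_log (by positivity) (h1.trans (by linarith : (y : ℝ) ≤ 2 * y))
    rw [Real.log_pow, ← hL, ← hlw] at h2
    push_cast at h2
    exact h2
  have hlC : L ≤ Real.log (2 * C) + 80 * h * lw := by
    have h1 : (y : ℝ) ≤ C * (w : ℝ) ^ (80 * h) := by exact_mod_cast hyu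
    have h2 := Real.log_le_log (by positivity)
      (by linarith : (2 * y : ℝ) ≤ 2 * C * (w : ℝ) ^ (80 * h))
    rw [← hL, Real.log_mul (by positivity) (by positivity), Real.log_pow, ← hlw] at h2
    push_cast at h2
    exact h2
  have hlL0 : L₀ ≤ lw := by
    rw [hlw, Real.le_log_iff_exp_le (by linarith)]
    refine (Nat.le_ceil _).trans ?_
    exact_mod_cast (by omega : ⌈Real.exp L₀⌉₊ ≤ w)
  obtain ⟨hbig, hL1, hL2⟩ := hL₀ L (by nlinarith)
  have hLw : 3600 * h * L ≤ w := by
    have h1 := hw₁ w (by omega)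
    have h2 : √(w : ℝ) ≤ w := Real.sqrt_le_iff.2 ⟨by linarith, by nlinarith⟩
    have h3 : Real.log (2 * C) ≤ lw := by
      rw [hlw]
      refine Real.log_le_log (by positivity) ?_
      exact_mod_cast (by omega : 2 * C ≤ w)
    rw [pow_one, ← hlw] at h1
    refine le_trans (mul_le_mul_of_nonneg_left ?_ (by positivity)) (h1.trans h2)
    linarith
  have hL0 : 0 < L := by linarith
  obtain ⟨k, hk⟩ : ∃ k, k = ⌊Real.log x / L⌋₊ := ⟨_, rfl⟩
  have hlx0 : 0 ≤ Real.log x := le_trans (by positivity) hwx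
  have hk1 : (k : ℝ) * L ≤ Real.log x :=
    (le_div_iff₀ hL0).1 (hk ▸ Nat.floor_le (by positivity))
  have hk2 : Real.log x ≤ (k + 1) * L :=
    (div_le_iff₀ hL0).1 (hk ▸ (Nat.lt_floor_add_one _).le)
  have hkD : 400 * (h : ℝ) * (4 * D + 4) ≤ k := by
    have h1 : (w : ℝ) ^ n = D * w := by rw [hD, hn1, pow_succ]; push_cast; rfl
    have h2 : D * (3600 * h * L) ≤ (k + 1) * L := by
      refine le_trans (mul_le_mul_of_nonneg_left hLw (by linarith)) ?_
      rw [← h1]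
      exact hwx.trans hk2
    have h3 : D * (3600 * h) ≤ (k + 1 : ℝ) := by
      refine le_of_mul_le_mul_right ?_ hL0
      linarith
    nlinarith
  have hk0 : (0 : ℝ) < k := lt_of_lt_of_le (by positivity) hkD
  have hkA : Real.log k ≤ Real.log ((2 : ℝ) ^ (40 * h - 1)) + (40 * h - 1) * lw := by
    have h1 : (k : ℝ) ≤ (2 : ℝ) ^ n * (w : ℝ) ^ n := by
      calc (k : ℝ) ≤ k * L := le_mul_of_one_le_right hk0.le hL1
        _ ≤ Real.log x := hk1
        _ ≤ ((w : ℝ) + 1) ^ n := hxw.le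
        _ ≤ (2 * w) ^ n := by gcongr; linarith
        _ = _ := mul_pow _ _ _
    have h2 := Real.log_le_log hk0 h1
    have h3 : (n : ℝ) = 40 * h - 1 := by
      have : n + 1 = 40 * h := by omega
      have : (n : ℝ) + 1 = 40 * h := by exact_mod_cast this
      linarith
    rw [Real.log_mul (by positivity) (by positivity), Real.log_pow w, ← hlw, h3] at h2
    rwa [← hn]
  obtain ⟨P, M, hM, hMy, hSP, hP⟩ := exists_common_exponent p D y hy2
  have hNy : 2 * (y : ℝ) ≤ 768 * L ^ 4 * P.card := by
    have h1 : ((smoothPrimes p D y).card : ℝ) ≤ ((Nat.log 2 (2 * y) + 1 : ℕ) : ℝ) * P.card := by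
      exact_mod_cast hSP
    have h2 := natLog_two_succ_le (z := 2 * y) (by omega) (by push_cast; rw [← hL]; exact hL1)
    push_cast at h1 h2
    rw [← hL] at h2
    calc 2 * (y : ℝ) ≤ 2 * (128 * L ^ 3 * (smoothPrimes p D y).card) := by linarith
      _ ≤ 2 * (128 * L ^ 3 * ((3 * L) * P.card)) := by
        gcongr
        exact h1.trans (mul_le_mul_of_nonneg_right h2 (Nat.cast_nonneg _))
      _ = _ := by ring
  have hN0 : (0 : ℝ) < P.card := by
    by_contra hcon
    have : (P.card : ℝ) = 0 := le_antisymm (not_lt.1 hcon) (Nat.cast_nonneg _)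
    rw [this] at hNy
    linarith
  have hg := le_log_div hhR hN0 hk0 (by linarith) hL hL1 hlL hlC hCR hNy hkA hbig
  have hkN : 2 * k ≤ P.card := by
    have h1 : 0 ≤ Real.log ((P.card : ℝ) / (2 * k)) := le_trans (by positivity) hg
    rw [Real.log_nonneg_iff (by positivity), one_le_div (by positivity)] at h1
    exact_mod_cast h1
  have hX : (2 * y) ^ k ≤ ⌊x⌋₊ := by
    refine Nat.le_floor ?_
    push_cast
    rw [← Real.log_le_log_iff (by positivity) hx0, Real.log_pow, ← hL]
    exact hk1
  have hmain := choose_mul_pow_le_sum hM P hP hX j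
  have hfin := rpow_le_of_le_log (m := 4 * D + 2) hhR hx0 (by linarith) hN0 hk0 hL hL1 rfl
    (by push_cast; rfl) hk2 hkD hL2 hg
  have hM2 : (2 : ℝ) * M ≤ (2 * y) ^ (4 * D + 2) := by exact_mod_cast hMy
  refine le_of_mul_le_mul_right (hfin.trans ?_) (show (0 : ℝ) < (2 * y) ^ (4 * D + 2) by positivity)
  refine (mul_le_mul_of_nonneg_right (div_pow_le_choose hkN) (by positivity)).trans ?_
  refine hmain.trans ?_
  rw [mul_comm]
  exact mul_le_mul_of_nonneg_left hM2 (Finset.sum_nonneg fun _ _ => by positivity)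

/-- There is an absolute constant `α > 1/2` such that for every
prime `p` and every power `q` of `p`, for all `x` sufficiently large depending
only on `p`, `(1/x) Σ_{d ≤ x, d ∈ U_p} φ(d)/ℓ_q(d) ≥ x^α`, where `U_p` is the
set of positive integers dividing `p^n + 1` for some `n ≥ 1` and `ℓ_q(d)` is
the multiplicative order of `q` mod `d`. -/
theorem rank_stats_stmt14 :
    ∃ α : ℝ, 1 / 2 < α ∧ ∀ p : ℕ, p.Prime → ∃ x0 : ℝ,
      ∀ q : ℕ, (∃ k : ℕ, 1 ≤ k ∧ q = p ^ k) → ∀ x : ℝ, x0 ≤ x →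
        x ^ α ≤ (1 / x) *
          ∑ d ∈ (Finset.Icc 1 ⌊x⌋₊).filter (fun d => ∃ n : ℕ, 1 ≤ n ∧ d ∣ p ^ n + 1),
            (Nat.totient d : ℝ) / orderOf ((q : ZMod d)) := by
  refine ⟨1 / 2 + 1 / (200 * ((4194304 : ℕ) : ℝ)), ?_, fun p hp => ?_⟩
  · exact lt_add_of_pos_right _ (by positivity)
  obtain ⟨x₀, hx₀, H⟩ := exists_rpow_le_sum hp (h := 4194304) le_rfl
  refine ⟨x₀, ?_⟩
  rintro _ ⟨j, -, rfl⟩ x hx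
  have hx0 : 0 < x := hx₀.trans_le hx
  have h := H j x hx
  rw [Real.rpow_add hx0, Real.rpow_one] at h
  rwa [one_div_mul_eq_div, le_div_iff₀ hx0, mul_comm]
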